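/- arXiv:2603.29473 — 5 statements merged into one kernel-verified Lean document; each statement's English description precedes it below -/
import Mathlib

section
/- Let f,g:[0,∞)→ℝ be continuous with f(t)² ≥ 4g(t) for all t≥0, f(t)→∞ and g(t)/f(t)→0 as t→∞, and suppose for some T>0 that g/f is Lebesgue integrable on [T,∞) and g is bounded on [T,∞). Let u:[0,∞)→ℝ be a twice continuously differentiable solution of −u''(t) + f(t)·u'(t) = g(t)·u(t) with (u(t),u'(t)) ≠ (0,0) for all t, and suppose ∫_0^∞ u(t)²·exp(−∫_0^t f(s) ds) dt < ∞. Let r:[0,∞)→(0,∞) and θ:[0,∞)→ℝ be continuously differentiable with u(t)=r(t)cos(θ(t)) and u'(t)=r(t)sin(θ(t)), θ taking values in [−π/2,π/2] for large t. Then θ(t) → 0 as t → ∞. -/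
open Real Filter MeasureTheory

/-- A function with nonnegative derivative on a half-line is monotone there. -/
theorem le_of_hasDerivAt_nonneg_Ici {h hd : ℝ → ℝ} {a b : ℝ} (hab : a ≤ b)
    (hh : ∀ t, a ≤ t → HasDerivAt h (hd t) t) (h0 : ∀ t, a ≤ t → 0 ≤ hd t) : h a ≤ h b := by
  have hm : MonotoneOn h (Set.Ici a) := by
    refine monotoneOn_of_hasDerivWithinAt_nonneg (f' := hd) (convex_Ici a)
      (fun t ht => (hh t ht).continuousAt.continuousWithinAt) ?_ ?_
    · intro t ht
      exact (hh t (interior_subset ht)).hasDerivWithinAt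
    · intro t ht
      exact h0 t (interior_subset ht)
  exact hm Set.self_mem_Ici hab hab

/-- A level which is only crossed upwards is a lower barrier. -/
theorem le_of_deriv_pos_on_level {w wd : ℝ → ℝ} {a b K : ℝ} (hab : a ≤ b)
    (hw : ∀ t, a ≤ t → HasDerivAt w (wd t) t) (ha : K ≤ w a)
    (hK : ∀ t, a ≤ t → w t = K → 0 < wd t) : K ≤ w b := by
  refine image_le_of_deriv_right_lt_deriv_boundary' (f := fun _ => K) (f' := fun _ => 0)
    (B := w) (B' := wd) (a := a) (b := b) continuousOn_const
    (fun t _ => hasDerivWithinAt_const _ _ _) ha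
    (fun t ht => (hw t ht.1).continuousAt.continuousWithinAt)
    (fun t ht => (hw t ht.1).hasDerivWithinAt)
    (fun t ht h => hK t ht.1 h.symm) ⟨hab, le_rfl⟩

/-- A global solution of the Riccati equation `w' = f w - g - w²` cannot go below `-ε`
where `|g| ≤ ε f`: it would blow up in finite time. -/
theorem riccati_neg_le {f g w : ℝ → ℝ} {a ε : ℝ} (hε : 0 < ε)
    (hw : ∀ t, a ≤ t → HasDerivAt w (f t * w t - g t - w t ^ 2) t)
    (hf : ∀ t, a ≤ t → 0 ≤ f t) (hg : ∀ t, a ≤ t → |g t| ≤ ε * f t) {t : ℝ} (ht : a ≤ t) :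
    -ε ≤ w t := by
  by_contra! hlt
  have hd : ∀ s, t ≤ s → w s ≤ -ε → f s * w s - g s - w s ^ 2 ≤ -w s ^ 2 := by
    intro s hs hws
    have h1 := (abs_le.1 (hg s (ht.trans hs))).1
    nlinarith [mul_nonneg (hf s (ht.trans hs)) (sub_nonneg.2 hws)]
  have hneg : ∀ s, t ≤ s → w s ≤ -ε := by
    intro s hs
    have := le_of_deriv_pos_on_level (w := fun s => -w s) (K := ε) hs
      (fun x hx => (hw x (ht.trans hx)).neg) (by linarith)
      (fun x hx hxe => by
        have h := hd x hx (by linarith)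
        have : w x = -ε := by linarith
        rw [this] at h ⊢
        nlinarith)
    linarith
  have hcmp := le_of_hasDerivAt_nonneg_Ici (h := fun s => (w s)⁻¹ - s)
    (a := t) (b := t - (w t)⁻¹) (by
      have : (w t)⁻¹ < 0 := inv_lt_zero.2 (by linarith)
      linarith)
    (fun s hs => ((hw s (ht.trans hs)).inv (by linarith [hneg s hs])).sub (hasDerivAt_id s))
    (fun s hs => by
      have hpos : 0 < w s ^ 2 := by nlinarith [hneg s hs]
      have := hd s hs (hneg s hs)
      rw [sub_nonneg, le_div_iff₀ hpos]
      linarith)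
  have hlast := hneg (t - (w t)⁻¹) (by
    have : (w t)⁻¹ < 0 := inv_lt_zero.2 (by linarith)
    linarith)
  have : (w (t - (w t)⁻¹))⁻¹ < 0 := inv_lt_zero.2 (by linarith)
  linarith

/-- A solution of the Riccati equation `w' = f w - g - w²` which reaches `ε` eventually stays
above any given level `K`, provided `f` is large and `g` is small relative to `f`. -/
theorem riccati_exists_forall_ge {f g w : ℝ → ℝ} {a ε K : ℝ} (hε : 0 < ε) (hεK : ε ≤ K)
    (hw : ∀ t, a ≤ t → HasDerivAt w (f t * w t - g t - w t ^ 2) t)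
    (hf : ∀ t, a ≤ t → 2 * (K ^ 2 + 1) ≤ ε * f t) (hg : ∀ t, a ≤ t → |g t| ≤ ε / 2 * f t)
    (ha : ε ≤ w a) : ∃ b, a ≤ b ∧ ∀ t, b ≤ t → K ≤ w t := by
  have hd : ∀ s, a ≤ s → ε ≤ w s → w s ≤ K → 1 ≤ f s * w s - g s - w s ^ 2 := by
    intro s hs h1 h2
    have h3 := (abs_le.1 (hg s hs)).2
    have h4 : 0 ≤ f s := by
      have := hf s hs
      by_contra! hneg
      nlinarith [sq_nonneg K]
    nlinarith [mul_nonneg h4 (sub_nonneg.2 h1), hf s hs]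
  have hge : ∀ s, a ≤ s → ε ≤ w s := fun s hs =>
    le_of_deriv_pos_on_level hs hw ha
      (fun x hx hxe => by linarith [hd x hx hxe.ge (hxe.le.trans hεK)])
  obtain ⟨b, hb, hKb⟩ : ∃ b, a ≤ b ∧ K ≤ w b := by
    by_contra! hlt
    have hcmp := le_of_hasDerivAt_nonneg_Ici (h := fun s => w s - s)
      (a := a) (b := a + K) (by linarith)
      (fun s hs => (hw s hs).sub (hasDerivAt_id s))
      (fun s hs => by linarith [hd s hs (hge s hs) (hlt s hs).le])
    have := hlt (a + K) (by linarith)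
    linarith
  refine ⟨b, hb, fun t hbt => le_of_deriv_pos_on_level hbt
    (fun x hx => hw x (hb.trans hx)) hKb fun x hx hxe => ?_⟩
  linarith [hd x (hb.trans hx) (hge x (hb.trans hx)) hxe.le]

theorem hasDerivAt_integral_of_continuousOn_Ici {f : ℝ → ℝ} {a t : ℝ}
    (hf : ContinuousOn f (Set.Ici a)) (ht : a < t) :
    HasDerivAt (fun x => ∫ s in a..x, f s) (f t) t := by
  refine intervalIntegral.integral_hasDerivAt_right ?_ ?_ (hf.continuousAt (Ici_mem_nhds ht))
  · refine (hf.mono ?_).intervalIntegrable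
    rw [Set.uIcc_of_le ht.le]
    exact Set.Icc_subset_Ici_self
  · exact (hf.mono Set.Ioi_subset_Ici_self).stronglyMeasurableAtFilter isOpen_Ioi t ht

/-- If the logarithmic derivative `w` of a positive solution `u` of `-u'' + f u' = g u` satisfies
`2 g ≤ w²` on a half-line, then `u` is not square integrable with respect to the weight
`exp (-∫ f)`. -/
theorem not_integrableOn_of_riccati_large {f g u w : ℝ → ℝ} {a K : ℝ} (ha : 0 < a) (hK : 0 < K)
    (hf : ContinuousOn f (Set.Ici 0)) (hu : ∀ t, a ≤ t → 0 < u t)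
    (hud : ∀ t, a ≤ t → HasDerivAt u (w t * u t) t)
    (hw : ∀ t, a ≤ t → HasDerivAt w (f t * w t - g t - w t ^ 2) t)
    (hKw : ∀ t, a ≤ t → K ≤ w t) (hg : ∀ t, a ≤ t → 2 * g t ≤ w t ^ 2) :
    ¬ IntegrableOn
      (fun t => (u t) ^ 2 * Real.exp (-(∫ s in (0 : ℝ)..t, f s))) (Set.Ici 0) := by
  intro hL2
  set z : ℝ → ℝ := fun t => (u t) ^ 2 * Real.exp (-(∫ s in (0 : ℝ)..t, f s)) with hz
  have hzpos : ∀ t, a ≤ t → 0 < z t := fun t ht => by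
    have := hu t ht
    positivity
  have hznn : ∀ t, 0 ≤ z t := fun t => by positivity
  have hzd : ∀ t, a ≤ t → HasDerivAt z ((2 * w t - f t) * z t) t := by
    intro t ht
    have h1 := ((hud t ht).pow 2).mul
      (hasDerivAt_integral_of_continuousOn_Ici hf (ha.trans_le ht)).neg.exp
    refine h1.congr_deriv ?_
    simp only [hz, Pi.pow_apply, Pi.neg_apply, Nat.cast_ofNat]
    ring
  have hAd : ∀ t, a ≤ t → HasDerivAt (fun t => z t * w t) (z t * (w t ^ 2 - g t)) t := by
    intro t ht
    refine ((hzd t ht).mul (hw t ht)).congr_deriv ?_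
    ring
  have hzc : ContinuousOn z (Set.Ici a) :=
    fun t ht => (hzd t ht).continuousAt.continuousWithinAt
  set I := ∫ t in Set.Ici 0, z t with hI
  have hbound : ∀ b, a + 1 ≤ b → ∫ s in a..b, z s ≤ I := by
    intro b hb
    rw [intervalIntegral.integral_of_le (by linarith)]
    refine setIntegral_mono_set hL2 (Filter.Eventually.of_forall hznn) ?_
    exact Filter.Eventually.of_forall fun x hx => (ha.trans hx.1).le
  have hwpos : ∀ t, a ≤ t → 0 < w t := fun t ht => hK.trans_le (hKw t ht)
  have hmain : ∀ b, a + 1 ≤ b →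
      -(z (a + 1) * w (a + 1))⁻¹ - (a + 1) ≤ I - b := by
    intro b hb
    have h := le_of_hasDerivAt_nonneg_Ici
      (h := fun t => (∫ s in a..t, z s) - (z t * w t)⁻¹ - t) hb
      (fun t ht => ((hasDerivAt_integral_of_continuousOn_Ici hzc (by linarith)).sub
        ((hAd t (by linarith)).inv
          (mul_pos (hzpos t (by linarith)) (hwpos t (by linarith))).ne')).sub (hasDerivAt_id t))
      (fun t ht => by
        have hat : a ≤ t := by linarith
        have hzt := hzpos t hat
        have hwt := hwpos t hat
        have h1 : (2 * z t)⁻¹ ≤ z t * (w t ^ 2 - g t) / (z t * w t) ^ 2 := by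
          rw [inv_eq_one_div, div_le_div_iff₀ (by positivity) (by positivity)]
          nlinarith [mul_nonneg (sq_nonneg (z t)) (sub_nonneg.2 (hg t hat))]
        have h2 : 1 ≤ z t + (2 * z t)⁻¹ := by
          have : z t + (2 * z t)⁻¹ - 1 = ((2 * z t - 1) ^ 2 + 1) / (4 * z t) := by
            field_simp
            ring
          have : 0 ≤ z t + (2 * z t)⁻¹ - 1 := by rw [this]; positivity
          linarith
        rw [neg_div]
        linarith)
    have h1 : 0 ≤ ∫ s in a..(a + 1), z s :=
      intervalIntegral.integral_nonneg (by linarith) fun s _ => hznn s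
    have h2 : 0 < (z b * w b)⁻¹ :=
      inv_pos.2 (mul_pos (hzpos b (by linarith)) (hwpos b (by linarith)))
    have h3 := hbound b hb
    linarith
  have hinv : 0 < (z (a + 1) * w (a + 1))⁻¹ :=
    inv_pos.2 (mul_pos (hzpos _ (by linarith)) (hwpos _ (by linarith)))
  have hInn : 0 ≤ I := integral_nonneg hznn
  have := hmain (a + 1 + I + (z (a + 1) * w (a + 1))⁻¹ + 1) (by linarith)
  linarith

/-- **Convergence of the angle for L²-solutions.**  Under the barrier
hypotheses, if `u` solves `−u'' + f·u' = g·u`, never vanishes together with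
`u'`, and satisfies `∫_0^∞ u(t)²·exp(−∫_0^t f) dt < ∞`, then the angular
component `θ` of the polar decomposition `(u,u') = r·(cos θ, sin θ)` tends to
`0` at infinity. -/
theorem stmt9 (f g : ℝ → ℝ) (T : ℝ) (hT : 0 < T)
    (hf : ContinuousOn f (Set.Ici 0)) (hg : ContinuousOn g (Set.Ici 0))
    (hfg : ∀ t, (0 : ℝ) ≤ t → 4 * g t ≤ (f t) ^ 2)
    (hftop : Tendsto f atTop atTop)
    (hgf : Tendsto (fun t => g t / f t) atTop (nhds 0))
    (hint : IntegrableOn (fun t => g t / f t) (Set.Ici T))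
    (hbdd : ∃ M : ℝ, ∀ t, T ≤ t → |g t| ≤ M)
    (u u' u'' : ℝ → ℝ)
    (hu1 : ∀ t, (0 : ℝ) ≤ t → HasDerivAt u (u' t) t)
    (hu2 : ∀ t, (0 : ℝ) ≤ t → HasDerivAt u' (u'' t) t)
    (hu2c : ContinuousOn u'' (Set.Ici 0))
    (hode : ∀ t, (0 : ℝ) ≤ t → -u'' t + f t * u' t = g t * u t)
    (hne : ∀ t, (0 : ℝ) ≤ t → u t ≠ 0 ∨ u' t ≠ 0)
    (hL2 : IntegrableOn
      (fun t => (u t) ^ 2 * Real.exp (-(∫ s in (0 : ℝ)..t, f s))) (Set.Ici 0))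
    (r rd θ θd : ℝ → ℝ)
    (hrpos : ∀ t, (0 : ℝ) ≤ t → 0 < r t)
    (hr : ∀ t, (0 : ℝ) ≤ t → HasDerivAt r (rd t) t)
    (hrc : ContinuousOn rd (Set.Ici 0))
    (hθ : ∀ t, (0 : ℝ) ≤ t → HasDerivAt θ (θd t) t)
    (hθc : ContinuousOn θd (Set.Ici 0))
    (hpolar1 : ∀ t, (0 : ℝ) ≤ t → u t = r t * Real.cos (θ t))
    (hpolar2 : ∀ t, (0 : ℝ) ≤ t → u' t = r t * Real.sin (θ t))
    (hrange : ∃ T₁ : ℝ, ∀ t, T₁ ≤ t → θ t ∈ Set.Icc (-(π / 2)) (π / 2)) :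
    Tendsto θ atTop (nhds 0) := by
  obtain ⟨T₁, hT₁⟩ := hrange
  obtain ⟨M, hM⟩ := hbdd
  have hcosnn : ∀ t, T₁ ≤ t → 0 ≤ Real.cos (θ t) := fun t ht =>
    Real.cos_nonneg_of_mem_Icc (hT₁ t ht)
  have hcos : ∀ t, max T₁ 0 < t → 0 < Real.cos (θ t) := by
    intro t ht
    have ht1 : T₁ < t := (le_max_left _ _).trans_lt ht
    have ht0 : 0 < t := (le_max_right _ _).trans_lt ht
    refine (hcosnn t ht1.le).lt_of_ne' fun h0 => ?_
    have hut : u t = 0 := by rw [hpolar1 t ht0.le, h0, mul_zero]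
    have hmin : IsLocalMin u t := by
      filter_upwards [Ioi_mem_nhds ht] with s hs
      have hs0 : 0 ≤ s := ((le_max_right _ _).trans_lt hs).le
      rw [hut, hpolar1 s hs0]
      exact mul_nonneg (hrpos s hs0).le (hcosnn s ((le_max_left _ _).trans_lt hs).le)
    exact (hne t ht0.le).elim (fun h => h hut)
      fun h => h (hmin.hasDerivAt_eq_zero (hu1 t ht0.le))
  set S := max (max T₁ 0) T + 1 with hS
  have hSm : max T₁ 0 < S := by linarith [le_max_left (max T₁ 0) T]
  have hST : T < S := by linarith [le_max_right (max T₁ 0) T]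
  have hS0 : 0 < S := hT.trans hST
  have hupos : ∀ t, S ≤ t → 0 < u t := fun t ht => by
    rw [hpolar1 t (hS0.le.trans ht)]
    exact mul_pos (hrpos t (hS0.le.trans ht)) (hcos t (hSm.trans_le ht))
  set w : ℝ → ℝ := fun t => u' t / u t with hwdef
  have hud : ∀ t, S ≤ t → HasDerivAt u (w t * u t) t := fun t ht =>
    (hu1 t (hS0.le.trans ht)).congr_deriv (div_mul_cancel₀ _ (hupos t ht).ne').symm
  have hw : ∀ t, S ≤ t → HasDerivAt w (f t * w t - g t - w t ^ 2) t := by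
    intro t ht
    have h0 := hS0.le.trans ht
    have hut := (hupos t ht).ne'
    refine ((hu2 t h0).div (hu1 t h0) hut).congr_deriv ?_
    have : u'' t = f t * u' t - g t * u t := by linarith [hode t h0]
    simp only [hwdef, this]
    field_simp
  have hgsmall : ∀ ε, 0 < ε → ∀ᶠ t in atTop, |g t| ≤ ε * f t := by
    intro ε hε
    filter_upwards [hgf.eventually (Metric.ball_mem_nhds 0 hε), hftop.eventually_gt_atTop 0]
      with t h1 h2
    have h3 : |g t| / |f t| < ε := by simpa using h1
    rw [abs_of_pos h2, div_lt_iff₀ h2] at h3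
    exact h3.le
  have hlow : ∀ ε, 0 < ε → ∀ᶠ t in atTop, -ε ≤ w t := by
    intro ε hε
    obtain ⟨a, ha⟩ := eventually_atTop.1
      ((hgsmall ε hε).and ((hftop.eventually_ge_atTop 0).and (eventually_ge_atTop S)))
    filter_upwards [eventually_ge_atTop a] with t ht
    exact riccati_neg_le hε (fun s hs => hw s (ha s hs).2.2) (fun s hs => (ha s hs).2.1)
      (fun s hs => (ha s hs).1) ht
  have hup : ∀ ε, 0 < ε → ∀ᶠ t in atTop, w t < ε := by
    intro ε hε
    have hM0 : 0 ≤ M := (abs_nonneg _).trans (hM T le_rfl)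
    set K := ε + 2 * M + 1 with hK
    have hK0 : 0 < K := by positivity
    obtain ⟨a, ha⟩ := eventually_atTop.1
      ((hgsmall (ε / 2) (half_pos hε)).and
        ((hftop.eventually_ge_atTop (2 * (K ^ 2 + 1) / ε)).and (eventually_ge_atTop S)))
    filter_upwards [eventually_ge_atTop a] with c hc
    by_contra! hεw
    obtain ⟨b, hb, hKw⟩ := riccati_exists_forall_ge (K := K) hε (by linarith)
      (fun s hs => hw s (ha s (hc.trans hs)).2.2)
      (fun s hs => by
        have := (ha s (hc.trans hs)).2.1
        rw [div_le_iff₀ hε] at this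
        linarith)
      (fun s hs => (ha s (hc.trans hs)).1) hεw
    have hSb : S ≤ b := (ha b (hc.trans hb)).2.2
    refine not_integrableOn_of_riccati_large (hS0.trans_le hSb) hK0 hf
      (fun t ht => hupos t (hSb.trans ht)) (fun t ht => hud t (hSb.trans ht))
      (fun t ht => hw t (hSb.trans ht)) hKw (fun t ht => ?_) hL2
    have h1 := (abs_le.1 (hM t (hST.le.trans (hSb.trans ht)))).2
    have h2 := hKw t ht
    nlinarith
  have hwlim : Tendsto w atTop (nhds 0) := by
    rw [Metric.tendsto_nhds]
    intro ε hε
    filter_upwards [hlow (ε / 2) (half_pos hε), hup ε hε] with t h1 h2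
    rw [Real.dist_eq, sub_zero, abs_lt]
    exact ⟨by linarith, h2⟩
  have harctan : Tendsto (fun t => Real.arctan (w t)) atTop (nhds 0) := by
    simpa [Function.comp_def] using (Real.continuous_arctan.tendsto 0).comp hwlim
  refine harctan.congr' ?_
  filter_upwards [eventually_ge_atTop S] with t ht
  have h0 := hS0.le.trans ht
  have hc := hcos t (hSm.trans_le ht)
  have hmem := hT₁ t ((le_max_left T₁ 0).trans (hSm.trans_le ht).le)
  have hwt : w t = Real.tan (θ t) := by
    simp only [hwdef]
    rw [hpolar1 t h0, hpolar2 t h0, Real.tan_eq_sin_div_cos,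
      mul_div_mul_left _ _ (hrpos t h0).ne']
  rw [hwt]
  refine Real.arctan_tan (hmem.1.lt_of_ne fun h => ?_) (hmem.2.lt_of_ne fun h => ?_)
  · rw [← h, Real.cos_neg, Real.cos_pi_div_two] at hc
    exact hc.false
  · rw [h, Real.cos_pi_div_two] at hc
    exact hc.false
end

section
/- Fix γ>0, λ>0, f(x)=x^γ, a turning point x*>0 with f(x)²/4 − f'(x)/2 − λ ≥ 0 for all x≥x*, let (S_k) be the WKB hierarchy defined in the context, and let n be an integer with n > (1+γ)/(2γ). Let v:[x*,∞)→ℝ be twice continuously differentiable, solve v''(x) = ( f(x)²/4 − f'(x)/2 − λ )·v(x) on [x*,∞), satisfy v(x)>0 for all x≥x*, and be square integrable on [x*,∞). Then there exist constants 0 < c ≤ C < ∞ such that c ≤ v(x)·exp(−Σ_{k=0}^{n} S_k(x)) ≤ C for all x ≥ x*; equivalently, the WKB remainder R_n(x) := log v(x) − Σ_{k=0}^{n} S_k(x) is bounded on [x*,∞). -/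
open Real MeasureTheory

/-- The WKB hierarchy on `[x*,∞)` for `f(x) = x^γ` and spectral parameter `λ`:
`S₀(x) = −∫_{x*}^x f(s)/2 ds`, `S₁(x) = ∫_{x*}^x λ/f(s) ds`, and for `k ≥ 2`,
`S_k' = S_{k−1}''/f + f⁻¹·Σ_{j=1}^{k−1} S_j'·S_{k−j}'` with `S_k(x*) = 0`.
Here `S' k` and `S'' k` denote the first and second derivatives of `S k`. -/
structure WKBHierarchy (γ lam xstar : ℝ) (S S' S'' : ℕ → ℝ → ℝ) : Prop where
  deriv1 : ∀ k, ∀ x, xstar ≤ x → HasDerivAt (S k) (S' k x) x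
  deriv2 : ∀ k, ∀ x, xstar ≤ x → HasDerivAt (S' k) (S'' k x) x
  cont2 : ∀ k, ContinuousOn (S'' k) (Set.Ici xstar)
  S0_def : ∀ x, S 0 x = -(∫ s in xstar..x, s ^ γ / 2)
  S1_def : ∀ x, S 1 x = ∫ s in xstar..x, lam / s ^ γ
  recurrence : ∀ k, 2 ≤ k → ∀ x, xstar ≤ x →
    S' k x = S'' (k - 1) x / x ^ γ
      + (1 / x ^ γ) * ∑ j ∈ Finset.Ico 1 k, S' j x * S' (k - j) x
  init : ∀ k, 2 ≤ k → S k xstar = 0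

/-- `IsPowerSum b p g`: on `[b,∞)` the function `g` is a finite linear combination of powers
`x ^ (-a)` with `p ≤ a`. -/
inductive IsPowerSum (b p : ℝ) : (ℝ → ℝ) → Prop
  | monomial {g : ℝ → ℝ} (c a : ℝ) (ha : p ≤ a) (hg : ∀ x, b ≤ x → g x = c * x ^ (-a)) :
      IsPowerSum b p g
  | add {g h k : ℝ → ℝ} (hg : IsPowerSum b p g) (hh : IsPowerSum b p h)
      (hk : ∀ x, b ≤ x → k x = g x + h x) : IsPowerSum b p k

namespace IsPowerSum

variable {b p q : ℝ} {g h : ℝ → ℝ}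

theorem congr (hg : IsPowerSum b p g) (hgh : ∀ x, b ≤ x → h x = g x) : IsPowerSum b p h := by
  cases hg with
  | monomial c a ha hg => exact .monomial c a ha fun x hx => by rw [hgh x hx, hg x hx]
  | add h₁ h₂ hk => exact .add h₁ h₂ fun x hx => by rw [hgh x hx, hk x hx]

theorem mono (hg : IsPowerSum b p g) (hpq : q ≤ p) : IsPowerSum b q g := by
  induction hg with
  | monomial c a ha hg => exact .monomial c a (hpq.trans ha) hg
  | add _ _ hk ih₁ ih₂ => exact .add ih₁ ih₂ hk

theorem zero : IsPowerSum b p fun _ => 0 :=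
  .monomial 0 p le_rfl fun x _ => by simp

theorem sum {ι : Type*} (s : Finset ι) (F : ι → ℝ → ℝ) (hF : ∀ i ∈ s, IsPowerSum b p (F i)) :
    IsPowerSum b p fun x => ∑ i ∈ s, F i x := by
  classical
  induction s using Finset.induction_on with
  | empty => simpa using zero
  | insert a s ha ih =>
    refine .add (hF a (by simp)) (ih fun i hi => hF i (by simp [hi])) fun x _ => ?_
    rw [Finset.sum_insert ha]

theorem mul_monomial (hb : 0 < b) (hg : IsPowerSum b p g) (c : ℝ) {a : ℝ} (ha : q ≤ a) :
    IsPowerSum b (p + q) fun x => g x * (c * x ^ (-a)) := by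
  induction hg with
  | monomial c' a' ha' hg =>
    refine .monomial (c' * c) (a' + a) (add_le_add ha' ha) fun x hx => ?_
    rw [hg x hx, neg_add, rpow_add (hb.trans_le hx)]
    ring
  | add _ _ hk ih₁ ih₂ => exact .add ih₁ ih₂ fun x hx => by rw [hk x hx]; ring

theorem mul (hb : 0 < b) (hg : IsPowerSum b p g) (hh : IsPowerSum b q h) :
    IsPowerSum b (p + q) fun x => g x * h x := by
  induction hh with
  | monomial c a ha hh => exact (mul_monomial hb hg c ha).congr fun x hx => by rw [hh x hx]
  | add _ _ hk ih₁ ih₂ => exact .add ih₁ ih₂ fun x hx => by rw [hk x hx]; ring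

theorem exists_hasDerivWithinAt (hb : 0 < b) (hg : IsPowerSum b p g) :
    ∃ g' : ℝ → ℝ, IsPowerSum b (p + 1) g' ∧
      ∀ x, b ≤ x → HasDerivWithinAt g (g' x) (Set.Ici b) x := by
  induction hg with
  | monomial c a ha hg =>
    refine ⟨fun x => c * -a * x ^ (-(a + 1)), .monomial (c * -a) (a + 1) (by linarith)
      fun x _ => rfl, fun x hx => ?_⟩
    have h1 := ((hasDerivAt_rpow_const (p := -a)
      (Or.inl (hb.trans_le hx).ne')).const_mul c).hasDerivWithinAt (s := Set.Ici b)
    refine (h1.congr (fun y hy => hg y hy) (hg x hx)).congr_deriv ?_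
    rw [show -a - 1 = -(a + 1) by ring]
    ring
  | add _ _ hk ih₁ ih₂ =>
    obtain ⟨g₁, hg₁, hd₁⟩ := ih₁
    obtain ⟨g₂, hg₂, hd₂⟩ := ih₂
    exact ⟨fun x => g₁ x + g₂ x, .add hg₁ hg₂ fun x _ => rfl, fun x hx =>
      ((hd₁ x hx).add (hd₂ x hx)).congr (fun y hy => hk y hy) (hk x hx)⟩

theorem of_hasDerivAt (hb : 0 < b) (hg : IsPowerSum b p g) {g' : ℝ → ℝ}
    (hd : ∀ x, b ≤ x → HasDerivAt g (g' x) x) : IsPowerSum b (p + 1) g' := by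
  obtain ⟨k, hk, hkd⟩ := hg.exists_hasDerivWithinAt hb
  exact hk.congr fun x hx =>
    (uniqueDiffOn_Ici b x hx).eq_deriv _ (hd x hx).hasDerivWithinAt (hkd x hx)

theorem exists_bound (hb : 0 < b) (hg : IsPowerSum b p g) :
    ∃ C, 0 ≤ C ∧ ∀ x, b ≤ x → |g x| ≤ C * x ^ (-p) := by
  induction hg with
  | monomial c a ha hg =>
    refine ⟨|c| * b ^ (-(a - p)), by positivity, fun x hx => ?_⟩
    have hx0 := hb.trans_le hx
    rw [hg x hx, abs_mul, abs_of_pos (rpow_pos_of_pos hx0 _),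
      show -a = -(a - p) + -p by ring, rpow_add hx0, ← mul_assoc]
    have := rpow_le_rpow_of_nonpos hb hx (show -(a - p) ≤ 0 by linarith)
    gcongr
  | add _ _ hk ih₁ ih₂ =>
    obtain ⟨C₁, h0₁, hC₁⟩ := ih₁
    obtain ⟨C₂, h0₂, hC₂⟩ := ih₂
    refine ⟨C₁ + C₂, add_nonneg h0₁ h0₂, fun x hx => ?_⟩
    rw [hk x hx, add_mul]
    exact (abs_add_le _ _).trans (add_le_add (hC₁ x hx) (hC₂ x hx))

end IsPowerSum

theorem sum_Icc_sq_eq_cauchy_add_tail (a : ℕ → ℝ) (n : ℕ) :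
    (∑ k ∈ Finset.Icc 1 n, a k) ^ 2 =
      (∑ k ∈ Finset.Icc 1 n, ∑ j ∈ Finset.Ico 1 k, a j * a (k - j)) +
      ∑ z ∈ (Finset.Icc 1 n ×ˢ Finset.Icc 1 n).filter (fun z => n < z.1 + z.2),
        a z.1 * a z.2 := by
  rw [sq, Finset.sum_mul_sum, ← Finset.sum_product',
    ← Finset.sum_filter_add_sum_filter_not _ (fun z : ℕ × ℕ => n < z.1 + z.2), add_comm,
    Finset.sum_sigma']
  congr 1
  refine Finset.sum_nbij' (fun z => ⟨z.1 + z.2, z.1⟩) (fun z => (z.2, z.1 - z.2)) ?_ ?_ ?_ ?_ ?_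
  · rintro ⟨i, j⟩ h
    simp at h ⊢
    omega
  · rintro ⟨i, j⟩ h
    simp at h ⊢
    omega
  · rintro ⟨i, j⟩ h
    simp
  · rintro ⟨i, j⟩ h
    simp at h ⊢
    omega
  · rintro ⟨i, j⟩ h
    simp

namespace WKBHierarchy

variable {γ lam b : ℝ} {S S' S'' : ℕ → ℝ → ℝ}

theorem S'_zero (hS : WKBHierarchy γ lam b S S' S'') (hγ : 0 < γ) {x : ℝ} (hx : b ≤ x) :
    S' 0 x = -(x ^ γ / 2) := by
  have hc : Continuous fun s : ℝ => s ^ γ / 2 :=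
    (continuous_id.rpow_const fun _ => Or.inr hγ.le).div_const 2
  have h1 := (hc.integral_hasStrictDerivAt b x).hasDerivAt.neg
  refine (hS.deriv1 0 x hx).unique (h1.congr_of_eventuallyEq ?_)
  exact Filter.Eventually.of_forall fun y => hS.S0_def y

theorem S'_one (hS : WKBHierarchy γ lam b S S' S'') (hb : 0 < b) {x : ℝ} (hx : b ≤ x) :
    S' 1 x = lam * x ^ (-γ) := by
  have hx0 := hb.trans_le hx
  have hc : ContinuousOn (fun s : ℝ => lam / s ^ γ) (Set.Ioi 0) := fun s hs =>
    (continuousAt_const.div (continuousAt_rpow_const s γ (Or.inl (ne_of_gt hs)))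
      (rpow_pos_of_pos hs γ).ne').continuousWithinAt
  have h1 : HasDerivAt (fun y => ∫ s in b..y, lam / s ^ γ) (lam / x ^ γ) x := by
    refine intervalIntegral.integral_hasDerivAt_right ?_ ?_ ?_
    · refine (hc.mono fun y hy => ?_).intervalIntegrable
      rw [Set.uIcc_of_le hx] at hy
      exact hb.trans_le hy.1
    · exact hc.stronglyMeasurableAtFilter isOpen_Ioi x hx0
    · exact hc.continuousAt (Ioi_mem_nhds hx0)
  rw [(hS.deriv1 1 x hx).unique (h1.congr_of_eventuallyEq
    (Filter.Eventually.of_forall fun y => hS.S1_def y)), rpow_neg hx0.le, div_eq_mul_inv]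

theorem S''_zero (hS : WKBHierarchy γ lam b S S' S'') (hγ : 0 < γ) (hb : 0 < b) {x : ℝ}
    (hx : b ≤ x) : S'' 0 x = -(γ * x ^ (γ - 1) / 2) := by
  have h1 := ((hasDerivAt_rpow_const (p := γ) (Or.inl (hb.trans_le hx).ne')).div_const
    2).neg.hasDerivWithinAt (s := Set.Ici b)
  exact (uniqueDiffOn_Ici b x hx).eq_deriv _ (hS.deriv2 0 x hx).hasDerivWithinAt
    (h1.congr (fun y hy => hS.S'_zero hγ hy) (hS.S'_zero hγ hx))

theorem isPowerSum_S' (hS : WKBHierarchy γ lam b S S' S'') (hb : 0 < b) {q : ℝ}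
    (hq₁ : q ≤ 2 * γ) (hq₂ : q ≤ 1 + γ) (k : ℕ) :
    IsPowerSum b (γ + k * q) (S' (k + 1)) := by
  induction k using Nat.strong_induction_on with
  | _ k ih =>
    rcases k with _ | k
    · exact .monomial lam γ (by simp) fun x hx => hS.S'_one hb hx
    · have hinv : IsPowerSum b γ fun x => x ^ (-γ) :=
        .monomial 1 γ le_rfl fun x _ => by simp
      have h1 := ((ih k (by omega)).of_hasDerivAt hb (hS.deriv2 (k + 1))).mul hb hinv
      have h2 : IsPowerSum b (2 * γ + k * q)
          fun x => ∑ j ∈ Finset.Ico 1 (k + 2), S' j x * S' (k + 2 - j) x := by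
        refine IsPowerSum.sum _ _ fun j hj => ?_
        rw [Finset.mem_Ico] at hj
        obtain ⟨i, rfl⟩ : ∃ i, j = i + 1 := ⟨j - 1, by omega⟩
        obtain ⟨l, rfl⟩ : ∃ l, k = i + l := ⟨k - i, by omega⟩
        rw [show i + l + 2 - (i + 1) = l + 1 by omega]
        refine ((ih i (by omega)).mul hb (ih l (by omega))).mono ?_
        push_cast
        linarith
      refine .add (h1.mono ?_) ((h2.mul hb hinv).mono ?_) fun x hx => ?_
      · push_cast
        linarith
      · push_cast
        linarith
      · rw [hS.recurrence (k + 2) (by omega) x hx, rpow_neg (hb.trans_le hx).le]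
        simp only [show k + 2 - 1 = k + 1 by omega]
        ring

/-- The residual of the truncated WKB ansatz in the Riccati equation `T' + T² = Q`. -/
theorem residual_eq (hS : WKBHierarchy γ lam b S S' S'') (hγ : 0 < γ) (hb : 0 < b) (n : ℕ)
    {x : ℝ} (hx : b ≤ x) :
    (∑ k ∈ Finset.range (n + 2), S'' k x) + (∑ k ∈ Finset.range (n + 2), S' k x) ^ 2
      - ((x ^ γ) ^ 2 / 4 - (γ * x ^ (γ - 1)) / 2 - lam) =
    S'' (n + 1) x + ∑ z ∈ (Finset.Icc 1 (n + 1) ×ˢ Finset.Icc 1 (n + 1)).filter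
      (fun z => n + 1 < z.1 + z.2), S' z.1 x * S' z.2 x := by
  have hf : x ^ γ ≠ 0 := (rpow_pos_of_pos (hb.trans_le hx) γ).ne'
  have hr : ∀ F : ℕ → ℝ, ∑ k ∈ Finset.range (n + 2), F k =
      F 0 + ∑ k ∈ Finset.Icc 1 (n + 1), F k := fun F => by
    rw [Finset.range_eq_Ico, Finset.sum_eq_sum_Ico_succ_bot (by omega)]
    rfl
  have key : x ^ γ * ∑ k ∈ Finset.Icc 1 (n + 1), S' k x + S'' (n + 1) x =
      lam + (∑ k ∈ Finset.Icc 1 (n + 1), S'' k x) +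
        ∑ k ∈ Finset.Icc 1 (n + 1), ∑ j ∈ Finset.Ico 1 k, S' j x * S' (k - j) x := by
    induction n with
    | zero =>
      simp only [zero_add, Finset.Icc_self, Finset.sum_singleton, Finset.Ico_self,
        Finset.sum_empty, hS.S'_one hb hx, rpow_neg (hb.trans_le hx).le]
      field_simp
      ring
    | succ m ih =>
      have ih := ih fun F => by
        rw [Finset.range_eq_Ico, Finset.sum_eq_sum_Ico_succ_bot (by omega)]
        rfl
      have h2 := hS.recurrence (m + 2) (by omega) x hx
      simp only [show m + 2 - 1 = m + 1 by omega] at h2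
      have h3 : x ^ γ * S' (m + 2) x = S'' (m + 1) x +
          ∑ j ∈ Finset.Ico 1 (m + 2), S' j x * S' (m + 2 - j) x := by
        rw [h2]
        field_simp
      simp only [Finset.sum_Icc_succ_top (show 1 ≤ m + 1 + 1 by omega)]
      linear_combination ih + h3
  rw [hr, hr, hS.S'_zero hγ hx, hS.S''_zero hγ hb hx]
  linear_combination sum_Icc_sq_eq_cauchy_add_tail (fun k => S' k x) (n + 1) - key

theorem residual_bound (hS : WKBHierarchy γ lam b S S' S'') (hγ : 0 < γ) (hb : 0 < b) (n : ℕ)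
    {q : ℝ} (hq : 0 ≤ q) (hq₁ : q ≤ 2 * γ) (hq₂ : q ≤ 1 + γ) :
    ∃ C, 0 ≤ C ∧ ∀ x, b ≤ x →
      |(∑ k ∈ Finset.range (n + 2), S'' k x) + (∑ k ∈ Finset.range (n + 2), S' k x) ^ 2
      - ((x ^ γ) ^ 2 / 4 - (γ * x ^ (γ - 1)) / 2 - lam)| ≤ C * x ^ (-((n + 1) * q)) := by
  refine IsPowerSum.exists_bound (b := b) hb (.add (g := S'' (n + 1)) ?_ ?_
    fun x hx => hS.residual_eq hγ hb n hx)
  · refine ((hS.isPowerSum_S' hb hq₁ hq₂ n).of_hasDerivAt hb (hS.deriv2 (n + 1))).mono ?_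
    linarith
  · refine IsPowerSum.sum _ (fun z : ℕ × ℕ => fun x => S' z.1 x * S' z.2 x) fun z hz => ?_
    simp only [Finset.mem_filter, Finset.mem_product, Finset.mem_Icc] at hz
    obtain ⟨i, j⟩ := z
    obtain ⟨i, rfl⟩ : ∃ l, i = l + 1 := ⟨i - 1, by omega⟩
    obtain ⟨j, rfl⟩ : ∃ l, j = l + 1 := ⟨j - 1, by omega⟩
    refine ((hS.isPowerSum_S' hb hq₁ hq₂ i).mul hb (hS.isPowerSum_S' hb hq₁ hq₂ j)).mono ?_
    have hij : (n : ℝ) ≤ i + j := by exact_mod_cast (by simp at hz; omega : n ≤ i + j)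
    nlinarith [mul_le_mul_of_nonneg_right hij hq]

end WKBHierarchy

theorem monotoneOn_Ici_of_hasDerivAt_nonneg {a : ℝ} {F F' : ℝ → ℝ}
    (hF : ∀ x, a ≤ x → HasDerivAt F (F' x) x) (hF' : ∀ x, a ≤ x → 0 ≤ F' x) :
    MonotoneOn F (Set.Ici a) :=
  monotoneOn_of_hasDerivWithinAt_nonneg (convex_Ici a)
    (fun x hx => (hF x hx).continuousAt.continuousWithinAt)
    (fun x hx => (hF x (interior_subset hx)).hasDerivWithinAt)
    fun x hx => hF' x (interior_subset hx)

theorem antitoneOn_Ici_of_hasDerivAt_nonpos {a : ℝ} {F F' : ℝ → ℝ}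
    (hF : ∀ x, a ≤ x → HasDerivAt F (F' x) x) (hF' : ∀ x, a ≤ x → F' x ≤ 0) :
    AntitoneOn F (Set.Ici a) :=
  antitoneOn_of_hasDerivWithinAt_nonpos (convex_Ici a)
    (fun x hx => (hF x hx).continuousAt.continuousWithinAt)
    (fun x hx => (hF x (interior_subset hx)).hasDerivWithinAt)
    fun x hx => hF' x (interior_subset hx)

theorem deriv_nonpos_of_convex_of_sq_integrable {b : ℝ} {v v' v'' : ℝ → ℝ}
    (hv : ∀ x, b ≤ x → HasDerivAt v (v' x) x) (hv' : ∀ x, b ≤ x → HasDerivAt v' (v'' x) x)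
    (hconv : ∀ x, b ≤ x → 0 ≤ v'' x) (hpos : ∀ x, b ≤ x → 0 < v x)
    (hint : IntegrableOn (fun x => (v x) ^ 2) (Set.Ici b)) :
    ∀ x, b ≤ x → v' x ≤ 0 := by
  intro a ha
  by_contra! hva
  have hmono' := monotoneOn_Ici_of_hasDerivAt_nonneg hv' hconv
  have hmono : MonotoneOn v (Set.Ici a) :=
    monotoneOn_Ici_of_hasDerivAt_nonneg (fun x hx => hv x (ha.trans hx)) fun x hx =>
      hva.le.trans (hmono' ha (ha.trans hx) hx)
  have hconst : IntegrableOn (fun _ : ℝ => (v a) ^ 2) (Set.Ici a) := by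
    refine (hint.mono_set (Set.Ici_subset_Ici.2 ha)).mono'
      aestronglyMeasurable_const ((ae_restrict_mem measurableSet_Ici).mono fun x hx => ?_)
    rw [Real.norm_of_nonneg (sq_nonneg _)]
    exact pow_le_pow_left₀ (hpos a ha).le (hmono Set.self_mem_Ici hx hx) 2
  rw [integrableOn_const_iff] at hconst
  simp [(hpos a ha).ne'] at hconst

section Riccati

variable {X γ C : ℝ} {L T T₁ v v' e e' G Q : ℝ → ℝ}

/-- A decreasing positive solution of `v'' = Q v` has logarithmic derivative at most `T + e`
when `T` solves the Riccati equation up to a residual controlled by `e`. -/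
theorem deriv_sub_mul_le (hX : 0 < X)
    (hL : ∀ x, X ≤ x → HasDerivAt L (T x) x) (hT : ∀ x, X ≤ x → HasDerivAt T (T₁ x) x)
    (hv : ∀ x, X ≤ x → HasDerivAt v (v' x) x) (hv' : ∀ x, X ≤ x → HasDerivAt v' (Q x * v x) x)
    (he : ∀ x, X ≤ x → HasDerivAt e (e' x) x) (hG : ∀ x, X ≤ x → HasDerivAt G (e x) x)
    (hpos : ∀ x, X ≤ x → 0 < v x) (hdec : ∀ x, X ≤ x → v' x ≤ 0)
    (he0 : ∀ x, X ≤ x → 0 ≤ e x) (he' : ∀ x, X ≤ x → e' x ≤ 0)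
    (hres : ∀ x, X ≤ x → |T₁ x + T x ^ 2 - Q x| ≤ e x * (-T x - e x))
    (hgrow : ∀ x, X ≤ x → (γ + 1) / x ≤ -T x - e x)
    (hTle : ∀ x, X ≤ x → -T x ≤ C * x ^ γ) (hγ : 0 ≤ γ + 1) :
    ∀ x, X ≤ x → v' x - T x * v x ≤ e x * v x := by
  intro a ha
  by_contra! hlt
  have hm : ∀ x, X ≤ x → 0 ≤ -T x - e x := fun x hx =>
    (div_nonneg hγ (hX.trans_le hx).le).trans (hgrow x hx)
  let Z : ℝ → ℝ := fun x => v' x - T x * v x - e x * v x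
  let Z' : ℝ → ℝ := fun x =>
    Q x * v x - (T₁ x * v x + T x * v' x) - (e' x * v x + e x * v' x)
  have hZ : ∀ x, X ≤ x → HasDerivAt Z (Z' x) x := fun x hx =>
    ((hv' x hx).sub ((hT x hx).mul (hv x hx))).sub ((he x hx).mul (hv x hx))
  have hZ' : ∀ x, X ≤ x → (-T x - e x) * Z x ≤ Z' x := fun x hx => by
    have h1 := (le_abs_self _).trans (hres x hx)
    have h2 := mul_nonneg (he0 x hx) (hm x hx)
    have h3 := mul_nonneg (he0 x hx) (he0 x hx)
    have h4 : 0 ≤ -(T₁ x + T x ^ 2 - Q x) + e x * (-T x - e x) + e x * (-T x - e x)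
      + e x * e x - e' x := by linarith [he' x hx]
    have h5 := mul_nonneg h4 (hpos x hx).le
    simp only [Z, Z']
    linarith
  have hZpos : ∀ x, a ≤ x → 0 < Z x := by
    intro x hx
    have hmono : MonotoneOn (fun x => Z x * exp (L x + G x)) (Set.Ici a) :=
      monotoneOn_Ici_of_hasDerivAt_nonneg (fun x hx => (hZ x (ha.trans hx)).mul
        ((hL x (ha.trans hx)).add (hG x (ha.trans hx))).exp) fun x hx => by
          have := mul_nonneg (sub_nonneg.2 (hZ' x (ha.trans hx))) (exp_pos (L x + G x)).le
          simp only [Pi.add_apply]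
          linarith
    have h1 : Z a * exp (L a + G a) ≤ Z x * exp (L x + G x) := hmono Set.self_mem_Ici hx hx
    have h2 : 0 < Z a * exp (L a + G a) := mul_pos (sub_pos.2 hlt) (exp_pos _)
    exact pos_of_mul_pos_left (h2.trans_le h1) (exp_pos _).le
  have ha0 : 0 < a := hX.trans_le ha
  have hmono : MonotoneOn (fun x => Z x * x ^ (-(γ + 1))) (Set.Ici a) :=
    monotoneOn_Ici_of_hasDerivAt_nonneg (fun x hx => (hZ x (ha.trans hx)).mul
      (hasDerivAt_rpow_const (Or.inl (ha0.trans_le hx).ne'))) fun x hx => by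
        have hx0 := ha0.trans_le hx
        have h1 := mul_nonneg (sub_nonneg.2 (hgrow x (ha.trans hx))) (hZpos x hx).le
        have h2 : 0 ≤ Z' x - (γ + 1) / x * Z x := by linarith [hZ' x (ha.trans hx)]
        have h3 := mul_nonneg h2 (rpow_nonneg hx0.le (-(γ + 1)))
        rw [rpow_sub_one hx0.ne']
        refine h3.trans_eq ?_
        field_simp
        ring
  have hvle : AntitoneOn v (Set.Ici X) := antitoneOn_Ici_of_hasDerivAt_nonpos hv hdec
  set δ := Z a * a ^ (-(γ + 1))
  have hδ0 : 0 < δ := mul_pos (hZpos a le_rfl) (rpow_pos_of_pos ha0 _)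
  have hbound : ∀ x, a ≤ x → δ * x ≤ C * v X := fun x hx => by
    have hx0 := ha0.trans_le hx
    have hxX := ha.trans hx
    have h1 : δ ≤ Z x * x ^ (-(γ + 1)) := hmono Set.self_mem_Ici hx hx
    have hT0 : 0 ≤ -T x := by linarith [hm x hxX, he0 x hxX]
    have h2 : Z x ≤ C * x ^ γ * v X :=
      calc Z x ≤ -T x * v x := by
            simp only [Z]
            linarith [hdec x hxX, mul_nonneg (he0 x hxX) (hpos x hxX).le]
        _ ≤ -T x * v X := mul_le_mul_of_nonneg_left (hvle Set.self_mem_Ici hxX hxX) hT0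
        _ ≤ C * x ^ γ * v X := mul_le_mul_of_nonneg_right (hTle x hxX) (hpos X le_rfl).le
    calc δ * x ≤ C * x ^ γ * v X * x ^ (-(γ + 1)) * x :=
          mul_le_mul_of_nonneg_right (h1.trans (mul_le_mul_of_nonneg_right h2
            (rpow_nonneg hx0.le _))) hx0.le
      _ = C * v X := by
        rw [rpow_neg hx0.le, rpow_add_one hx0.ne']
        have := (rpow_pos_of_pos hx0 γ).ne'
        field_simp
  have h1 := hbound (max a (C * v X / δ + 1)) (le_max_left _ _)
  have h2 := mul_le_mul_of_nonneg_left (le_max_right a (C * v X / δ + 1)) hδ0.le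
  have h3 : δ * (C * v X / δ + 1) = C * v X + δ := by field_simp
  linarith

/-- A positive solution of `v'' = Q v` has logarithmic derivative at least `T - e` when `T` solves
the Riccati equation up to a residual controlled by `e`. -/
theorem neg_mul_le_deriv_sub
    (hL : ∀ x, X ≤ x → HasDerivAt L (T x) x) (hT : ∀ x, X ≤ x → HasDerivAt T (T₁ x) x)
    (hv : ∀ x, X ≤ x → HasDerivAt v (v' x) x) (hv' : ∀ x, X ≤ x → HasDerivAt v' (Q x * v x) x)
    (he : ∀ x, X ≤ x → HasDerivAt e (e' x) x) (hG : ∀ x, X ≤ x → HasDerivAt G (e x) x)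
    (hpos : ∀ x, X ≤ x → 0 < v x)
    (he0 : ∀ x, X ≤ x → 0 ≤ e x) (he' : ∀ x, X ≤ x → e' x ≤ 0)
    (hres : ∀ x, X ≤ x → |T₁ x + T x ^ 2 - Q x| ≤ e x * (-T x - e x))
    (hm : ∀ x, X ≤ x → 0 ≤ -T x - e x) :
    ∀ x, X ≤ x → -(e x * v x) ≤ v' x - T x * v x := by
  intro a ha
  by_contra! hlt
  let Y : ℝ → ℝ := fun x => v' x - T x * v x + e x * v x
  let Y' : ℝ → ℝ := fun x =>
    Q x * v x - (T₁ x * v x + T x * v' x) + (e' x * v x + e x * v' x)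
  have hY : ∀ x, X ≤ x → HasDerivAt Y (Y' x) x := fun x hx =>
    ((hv' x hx).sub ((hT x hx).mul (hv x hx))).add ((he x hx).mul (hv x hx))
  have hY' : ∀ x, X ≤ x → Y' x ≤ (-T x + e x) * Y x := fun x hx => by
    have h1 := (neg_abs_le _).trans' (neg_le_neg (hres x hx))
    have h2 := mul_nonneg (he0 x hx) (hm x hx)
    have h3 := mul_nonneg (he0 x hx) (he0 x hx)
    have h4 : 0 ≤ (T₁ x + T x ^ 2 - Q x) + e x * (-T x - e x) + e x * (-T x - e x)
      + 3 * (e x * e x) - e' x := by linarith [he' x hx]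
    have h5 := mul_nonneg h4 (hpos x hx).le
    simp only [Y, Y']
    linarith
  have hYneg : ∀ x, a ≤ x → Y x < 0 := by
    intro x hx
    have hanti : AntitoneOn (fun x => Y x * exp (L x - G x)) (Set.Ici a) :=
      antitoneOn_Ici_of_hasDerivAt_nonpos (fun x hx => (hY x (ha.trans hx)).mul
        ((hL x (ha.trans hx)).sub (hG x (ha.trans hx))).exp) fun x hx => by
          have := mul_nonneg (sub_nonneg.2 (hY' x (ha.trans hx))) (exp_pos (L x - G x)).le
          simp only [Pi.sub_apply]
          linarith
    have h1 : Y x * exp (L x - G x) ≤ Y a * exp (L a - G a) := hanti Set.self_mem_Ici hx hx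
    have h2 : Y a * exp (L a - G a) < 0 :=
      mul_neg_of_neg_of_pos (show v' a - T a * v a + e a * v a < 0 by linarith) (exp_pos _)
    exact neg_of_mul_neg_left (h1.trans_lt h2) (exp_pos _).le
  have hanti : AntitoneOn (fun x => Y x * exp (-L x)) (Set.Ici a) :=
    antitoneOn_Ici_of_hasDerivAt_nonpos (fun x hx => (hY x (ha.trans hx)).mul
      (hL x (ha.trans hx)).neg.exp) fun x hx => by
        have hxX := ha.trans hx
        have h1 : 0 ≤ (-T x + e x + -T x) * -Y x :=
          mul_nonneg (by linarith [hm x hxX, he0 x hxX]) (neg_nonneg.2 (hYneg x hx).le)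
        have h2 : 0 ≤ -(Y' x + Y x * -T x) := by linarith [hY' x hxX]
        have := mul_nonneg h2 (exp_pos (-L x)).le
        simp only [Pi.neg_apply]
        linarith
  set δ := -(Y a * exp (-L a)) with hδ
  have hδ0 : 0 < δ := neg_pos.2 (mul_neg_of_neg_of_pos (hYneg a le_rfl) (exp_pos _))
  have hu : AntitoneOn (fun x => v x * exp (-L x) + δ * x) (Set.Ici a) :=
    antitoneOn_Ici_of_hasDerivAt_nonpos (fun x hx => ((hv x (ha.trans hx)).mul
      (hL x (ha.trans hx)).neg.exp).add ((hasDerivAt_id x).const_mul δ)) fun x hx => by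
        have hxX := ha.trans hx
        have h1 : Y x * exp (-L x) ≤ Y a * exp (-L a) := hanti Set.self_mem_Ici hx hx
        have h2 := mul_nonneg (mul_nonneg (he0 x hxX) (hpos x hxX).le) (exp_pos (-L x)).le
        simp only [Y, Pi.neg_apply] at h1 h2 hδ ⊢
        linarith
  have hlong : a ≤ a + v a * exp (-L a) / δ :=
    le_add_of_nonneg_right (div_nonneg (mul_pos (hpos a ha) (exp_pos _)).le hδ0.le)
  have h1 := hu Set.self_mem_Ici hlong hlong
  have h2 := mul_pos (hpos _ (ha.trans hlong)) (exp_pos (-L (a + v a * exp (-L a) / δ)))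
  have h3 : δ * (a + v a * exp (-L a) / δ) = δ * a + v a * exp (-L a) := by field_simp
  simp only at h1
  linarith

/-- If `T = L'` solves the Riccati equation up to a residual controlled by an `e` with bounded
antiderivative, then a decreasing positive solution of `v'' = Q v` is comparable to `exp L`. -/
theorem bounded_mul_exp_neg {B : ℝ} (hX : 0 < X)
    (hL : ∀ x, X ≤ x → HasDerivAt L (T x) x) (hT : ∀ x, X ≤ x → HasDerivAt T (T₁ x) x)
    (hv : ∀ x, X ≤ x → HasDerivAt v (v' x) x) (hv' : ∀ x, X ≤ x → HasDerivAt v' (Q x * v x) x)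
    (he : ∀ x, X ≤ x → HasDerivAt e (e' x) x) (hG : ∀ x, X ≤ x → HasDerivAt G (e x) x)
    (hpos : ∀ x, X ≤ x → 0 < v x) (hdec : ∀ x, X ≤ x → v' x ≤ 0)
    (he0 : ∀ x, X ≤ x → 0 ≤ e x) (he' : ∀ x, X ≤ x → e' x ≤ 0)
    (hres : ∀ x, X ≤ x → |T₁ x + T x ^ 2 - Q x| ≤ e x * (-T x - e x))
    (hgrow : ∀ x, X ≤ x → (γ + 1) / x ≤ -T x - e x)
    (hTle : ∀ x, X ≤ x → -T x ≤ C * x ^ γ) (hGB : ∀ x, X ≤ x → |G x| ≤ B) (hγ : 0 ≤ γ + 1) :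
    ∃ c D : ℝ, 0 < c ∧ ∀ x, X ≤ x → c ≤ v x * exp (-L x) ∧ v x * exp (-L x) ≤ D := by
  have hm : ∀ x, X ≤ x → 0 ≤ -T x - e x := fun x hx =>
    (div_nonneg hγ (hX.trans_le hx).le).trans (hgrow x hx)
  have hup := deriv_sub_mul_le hX hL hT hv hv' he hG hpos hdec he0 he' hres hgrow hTle hγ
  have hlow := neg_mul_le_deriv_sub hL hT hv hv' he hG hpos he0 he' hres hm
  have hmono : MonotoneOn (fun x => v x * exp (-L x + G x)) (Set.Ici X) :=
    monotoneOn_Ici_of_hasDerivAt_nonneg (fun x hx => (hv x hx).mul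
      ((hL x hx).neg.add (hG x hx)).exp) fun x hx => by
        have := mul_nonneg (sub_nonneg.2 (hlow x hx)) (exp_pos (-L x + G x)).le
        simp only [Pi.add_apply, Pi.neg_apply]
        linarith
  have hanti : AntitoneOn (fun x => v x * exp (-L x - G x)) (Set.Ici X) :=
    antitoneOn_Ici_of_hasDerivAt_nonpos (fun x hx => (hv x hx).mul
      ((hL x hx).neg.sub (hG x hx)).exp) fun x hx => by
        have := mul_nonneg (sub_nonneg.2 (hup x hx)) (exp_pos (-L x - G x)).le
        simp only [Pi.sub_apply, Pi.neg_apply]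
        linarith
  refine ⟨v X * exp (-L X + G X) * exp (-B), v X * exp (-L X - G X) * exp B,
    mul_pos (mul_pos (hpos X le_rfl) (exp_pos _)) (exp_pos _), fun x hx => ⟨?_, ?_⟩⟩
  · calc v X * exp (-L X + G X) * exp (-B) ≤ v x * exp (-L x + G x) * exp (-G x) :=
          mul_le_mul (hmono Set.self_mem_Ici hx hx)
            (exp_le_exp.2 (neg_le_neg ((le_abs_self _).trans (hGB x hx)))) (exp_pos _).le
            (mul_pos (hpos x hx) (exp_pos _)).le
      _ = v x * exp (-L x) := by rw [mul_assoc, ← exp_add]; congr 2; ring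
  · calc v x * exp (-L x) = v x * exp (-L x - G x) * exp (G x) := by
          rw [mul_assoc, ← exp_add]; congr 2; ring
      _ ≤ v X * exp (-L X - G X) * exp B :=
          mul_le_mul (hanti Set.self_mem_Ici hx hx)
            (exp_le_exp.2 ((le_abs_self _).trans (hGB x hx))) (exp_pos _).le
            (mul_pos (hpos X le_rfl) (exp_pos _)).le

end Riccati

/-- **Boundedness of the WKB remainder.**  If `n > (1+γ)/(2γ)` and `v > 0` is a
square-integrable solution of the Schrödinger equation
`v'' = (f²/4 − f'/2 − λ)·v` on `[x*,∞)` with `f(x) = x^γ`, then there are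
`0 < c ≤ C` with `c ≤ v(x)·exp(−Σ_{k=0}^n S_k(x)) ≤ C` on `[x*,∞)`, i.e. the
WKB remainder `R_n = log v − Σ_{k=0}^n S_k` is bounded. -/
theorem stmt10 (γ lam xstar : ℝ) (hγ : 0 < γ) (hlam : 0 < lam) (hx : 0 < xstar)
    (hturn : ∀ x, xstar ≤ x → 0 ≤ (x ^ γ) ^ 2 / 4 - (γ * x ^ (γ - 1)) / 2 - lam)
    (S S' S'' : ℕ → ℝ → ℝ) (hS : WKBHierarchy γ lam xstar S S' S'')
    (n : ℕ) (hn : (1 + γ) / (2 * γ) < (n : ℝ))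
    (v v' v'' : ℝ → ℝ)
    (hv1 : ∀ x, xstar ≤ x → HasDerivAt v (v' x) x)
    (hv2 : ∀ x, xstar ≤ x → HasDerivAt v' (v'' x) x)
    (hv2c : ContinuousOn v'' (Set.Ici xstar))
    (hode : ∀ x, xstar ≤ x →
      v'' x = ((x ^ γ) ^ 2 / 4 - (γ * x ^ (γ - 1)) / 2 - lam) * v x)
    (hvpos : ∀ x, xstar ≤ x → 0 < v x)
    (hvL2 : IntegrableOn (fun x => (v x) ^ 2) (Set.Ici xstar)) :
    ∃ c C : ℝ, 0 < c ∧ c ≤ C ∧ ∀ x, xstar ≤ x →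
      c ≤ v x * Real.exp (-(∑ k ∈ Finset.range (n + 1), S k x)) ∧
      v x * Real.exp (-(∑ k ∈ Finset.range (n + 1), S k x)) ≤ C := by
  obtain ⟨n, rfl⟩ : ∃ m, n = m + 1 := by
    refine ⟨n - 1, ?_⟩
    have : (0 : ℝ) < n := lt_trans (by positivity) hn
    have : 0 < n := by exact_mod_cast this
    omega
  rw [div_lt_iff₀ (by positivity)] at hn
  push_cast at hn
  set q : ℝ := min (2 * γ) (1 + γ) with hq
  have hq0 : 0 ≤ q := le_min (by linarith) (by linarith)
  have hq₁ : q ≤ 2 * γ := min_le_left _ _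
  have hq₂ : q ≤ 1 + γ := min_le_right _ _
  set p : ℝ := γ + (n + 1) * q with hp
  have hp1 : 1 < p := by
    have hn0 : (0 : ℝ) ≤ n := n.cast_nonneg
    rcases min_choice (2 * γ) (1 + γ) with h | h <;> rw [hp, hq, h] <;> nlinarith
  obtain ⟨C₁, hC₁0, hC₁⟩ := hS.residual_bound hγ hx n hq0 hq₁ hq₂
  obtain ⟨C₂, hC₂0, hC₂⟩ : ∃ C, 0 ≤ C ∧ ∀ x, xstar ≤ x →
      |∑ k ∈ Finset.range (n + 1), S' (k + 1) x| ≤ C * x ^ (-γ) :=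
    (IsPowerSum.sum _ (fun k => S' (k + 1)) fun k _ =>
      (hS.isPowerSum_S' hx hq₁ hq₂ k).mono
        (le_add_of_nonneg_right (by positivity))).exists_bound hx
  set K : ℝ := 4 * C₁ with hK
  have hK0 : 0 ≤ K := by positivity
  set L : ℝ → ℝ := fun x => ∑ k ∈ Finset.range (n + 1 + 1), S k x with hL
  set T : ℝ → ℝ := fun x => ∑ k ∈ Finset.range (n + 1 + 1), S' k x with hT
  obtain ⟨X, hX⟩ : ∃ X, ∀ x, X ≤ x → xstar ≤ x ∧ 1 ≤ x ∧ 4 * (C₂ + K + γ + 1) ≤ x ^ γ :=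
    Filter.eventually_atTop.1 ((Filter.eventually_ge_atTop xstar).and
      ((Filter.eventually_ge_atTop 1).and
        ((tendsto_rpow_atTop hγ).eventually_ge_atTop _)))
  have hX1 : 1 ≤ X := (hX X le_rfl).2.1
  have hX0 : 0 < X := by linarith
  have hpow : ∀ x, X ≤ x → |T x + x ^ γ / 2| + K * x ^ (-p) ≤ C₂ + K := fun x hxX => by
    obtain ⟨hxs, hx1, -⟩ := hX x hxX
    have hTx : T x + x ^ γ / 2 = ∑ k ∈ Finset.range (n + 1), S' (k + 1) x := by
      simp only [hT]
      rw [Finset.sum_range_succ', hS.S'_zero hγ hxs]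
      ring
    rw [hTx]
    have h1 := rpow_le_one_of_one_le_of_nonpos hx1 (neg_nonpos.2 hγ.le)
    have h2 := rpow_le_one_of_one_le_of_nonpos hx1 (show -p ≤ 0 by linarith)
    have h3 := mul_le_of_le_one_right hC₂0 h1
    have h4 := mul_le_of_le_one_right hK0 h2
    linarith [hC₂ x hxs]
  have hLd : ∀ x, xstar ≤ x → HasDerivAt L (T x) x := fun x hxs =>
    HasDerivAt.fun_sum fun k _ => hS.deriv1 k x hxs
  have hTd : ∀ x, xstar ≤ x →
      HasDerivAt T (∑ k ∈ Finset.range (n + 1 + 1), S'' k x) x := fun x hxs =>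
    HasDerivAt.fun_sum fun k _ => hS.deriv2 k x hxs
  have hv'le := deriv_nonpos_of_convex_of_sq_integrable hv1 hv2
    (fun x hxs => by rw [hode x hxs]; exact mul_nonneg (hturn x hxs) (hvpos x hxs).le)
    hvpos hvL2
  have hpd : ∀ (c r x : ℝ), X ≤ x → HasDerivAt (fun y => c * y ^ r) (c * (r * x ^ (r - 1))) x :=
    fun c r x hxX => (hasDerivAt_rpow_const (Or.inl (hX0.trans_le hxX).ne')).const_mul c
  have htail := bounded_mul_exp_neg (X := X) (γ := γ) (C := 1)
    (B := K / (p - 1)) (L := L) (T := T) (v := v) (v' := v') (e := fun x => K * x ^ (-p))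
    (G := fun x => K / (1 - p) * x ^ (1 - p)) (Q := fun x => (x ^ γ) ^ 2 / 4
      - (γ * x ^ (γ - 1)) / 2 - lam) hX0 (fun x h => hLd x (hX x h).1)
    (fun x h => hTd x (hX x h).1) (fun x h => hv1 x (hX x h).1)
    (fun x h => (hv2 x (hX x h).1).congr_deriv (hode x (hX x h).1))
    (fun x h => hpd K (-p) x h)
    (fun x h => (hpd (K / (1 - p)) (1 - p) x h).congr_deriv ?_)
    (fun x h => hvpos x (hX x h).1) (fun x h => hv'le x (hX x h).1)
    (fun x h => mul_nonneg hK0 (rpow_nonneg (hX0.trans_le h).le _)) (fun x h => ?_)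
    (fun x h => ?_) (fun x h => ?_) (fun x h => ?_) (fun x h => ?_) (by linarith)
  · obtain ⟨c₁, D₁, hc₁, hcD₁⟩ := htail
    have hcont : ContinuousOn (fun x => v x * Real.exp (-L x)) (Set.Icc xstar X) := fun x h =>
      ((hv1 x h.1).continuousAt.mul (hLd x h.1).continuousAt.neg.rexp).continuousWithinAt
    have hne : (Set.Icc xstar X).Nonempty := Set.nonempty_Icc.2 (hX X le_rfl).1
    obtain ⟨a, ha, hamin⟩ := isCompact_Icc.exists_isMinOn hne hcont
    obtain ⟨d, hd, hdmax⟩ := isCompact_Icc.exists_isMaxOn hne hcont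
    have hcD := hcD₁ X le_rfl
    refine ⟨min c₁ (v a * Real.exp (-L a)), max D₁ (v d * Real.exp (-L d)),
      lt_min hc₁ (mul_pos (hvpos a ha.1) (Real.exp_pos _)),
      (min_le_left _ _).trans ((hcD.1.trans hcD.2).trans (le_max_left _ _)), fun x hxs => ?_⟩
    rcases le_total X x with h | h
    · exact ⟨(min_le_left _ _).trans (hcD₁ x h).1, (hcD₁ x h).2.trans (le_max_left _ _)⟩
    · exact ⟨(min_le_right _ _).trans (hamin ⟨hxs, h⟩), (hdmax ⟨hxs, h⟩).trans (le_max_right _ _)⟩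
  · rw [show 1 - p - 1 = -p by ring, ← mul_assoc, div_mul_cancel₀ _ (by linarith : 1 - p ≠ 0)]
  · have := rpow_nonneg (hX0.trans_le h).le (-p - 1)
    nlinarith [mul_nonneg hK0 this]
  · have h0 := hX0.trans_le h
    have h1 := hpow x h
    have h2 : x ^ γ / 4 ≤ -T x - K * x ^ (-p) := by
      linarith [(hX x h).2.2, le_abs_self (T x + x ^ γ / 2)]
    refine (hC₁ x (hX x h).1).trans (le_trans (le_of_eq ?_) (mul_le_mul_of_nonneg_left h2
      (mul_nonneg hK0 (rpow_nonneg h0.le _))))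
    rw [hK, show -((n + 1) * q) = -p + γ by rw [hp]; ring, rpow_add h0]
    ring
  · have h1 := hpow x h
    have h2 : (γ + 1) / x ≤ γ + 1 := div_le_self (by linarith) (hX x h).2.1
    linarith [(hX x h).2.2, le_abs_self (T x + x ^ γ / 2)]
  · have h1 := hpow x h
    have h2 := mul_nonneg hK0 (rpow_nonneg (hX0.trans_le h).le (-p))
    linarith [(hX x h).2.2, neg_abs_le (T x + x ^ γ / 2)]
  · have h1 := rpow_le_one_of_one_le_of_nonpos (hX x h).2.1 (show 1 - p ≤ 0 by linarith)
    have h2 := rpow_nonneg (hX0.trans_le h).le (1 - p)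
    rw [abs_mul, abs_of_nonneg h2, abs_div, abs_of_nonneg hK0, abs_sub_comm,
      abs_of_pos (by linarith : 0 < p - 1)]
    exact mul_le_of_le_one_right (div_nonneg hK0 (by linarith)) h1
end

section
/- Let γ>0, V(x)=|x|^{γ+1}/(γ+1), and λ>0. Let u:ℝ→ℝ be twice continuously differentiable, not identically zero, solve −u''(x) + V'(x)·u'(x) = λ·u(x) for all x∈ℝ, and satisfy ∫_ℝ u(x)² e^{−V(x)} dx < ∞. Let x*>0 be a turning point, i.e. V'(x)²/4 − V''(x)/2 − λ ≥ 0 for all x ≥ x*, and assume u(x*) ≥ 0. Let n be an integer with n > (1+γ)/(2γ) and let (S_k) be the WKB hierarchy of the context (with f = V' on [x*,∞), where V'(x)=x^γ). Then there exists C ≥ 1 such that C^{−1}·exp(Σ_{i=1}^{n} S_i(x)) ≤ u(x) ≤ C·exp(Σ_{i=1}^{n} S_i(x)) for all x ≥ x*. Moreover, if 1/γ is not an odd integer (so that γ≠1 and 1−(2i−1)γ ≠ 0 for all 2 ≤ i ≤ n), there exist constants C₂,…,C_n ∈ ℝ and C' ≥ 1 such that for all x ≥ x*: C'^{−1}·E(x)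 ≤ u(x) ≤ C'·E(x), where E(x) = exp( λ·x^{1−γ}/(1−γ) + Σ_{i=2}^{n} C_i·x^{1−(2i−1)γ} ). -/
open Real MeasureTheory

/-- The monomial convex potential `V(x) = |x|^(γ+1)/(γ+1)`. -/
noncomputable def Vpot (γ x : ℝ) : ℝ := |x| ^ (γ + 1) / (γ + 1)

/-- The derivative of the potential, `V'(x) = sign(x)·|x|^γ`. -/
noncomputable def Vp (γ x : ℝ) : ℝ := Real.sign x * |x| ^ γ

open Set Filter Topology

/-- A function which, on `[a, ∞)`, is a finite sum of monomials `c * x ^ (-s)` with `e ≤ s`. -/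
inductive PowSum (a e : ℝ) : (ℝ → ℝ) → Prop
  | monomial (c : ℝ) {s : ℝ} : e ≤ s → PowSum a e (fun x => c * x ^ (-s))
  | add {g h : ℝ → ℝ} : PowSum a e g → PowSum a e h → PowSum a e (fun x => g x + h x)
  | congr {g h : ℝ → ℝ} : PowSum a e g → (∀ x, a ≤ x → h x = g x) → PowSum a e h

namespace PowSum

variable {a e e' : ℝ} {g h : ℝ → ℝ}

lemma mono (hg : PowSum a e g) (hle : e' ≤ e) : PowSum a e' g := by
  induction hg with
  | monomial c hs => exact .monomial c (hle.trans hs)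
  | add _ _ ih₁ ih₂ => exact ih₁.add ih₂
  | congr _ heq ih => exact ih.congr heq

lemma zero : PowSum a e (fun _ => 0) :=
  (PowSum.monomial 0 le_rfl).congr (fun x _ => by simp)

lemma sum {ι : Type*} (s : Finset ι) {F : ι → ℝ → ℝ} (hF : ∀ i ∈ s, PowSum a e (F i)) :
    PowSum a e (fun x => ∑ i ∈ s, F i x) := by
  classical
  induction s using Finset.induction_on with
  | empty => simpa using PowSum.zero
  | insert i s hi ih =>
    refine ((hF i (Finset.mem_insert_self i s)).add
      (ih fun j hj => hF j (Finset.mem_insert_of_mem hj))).congr fun x _ => ?_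
    rw [Finset.sum_insert hi]

lemma mul (ha : 0 < a) (hg : PowSum a e g) (hh : PowSum a e' h) :
    PowSum a (e + e') (fun x => g x * h x) := by
  induction hg with
  | @monomial c s hs =>
    induction hh with
    | @monomial d t ht =>
      refine (PowSum.monomial (c * d) (add_le_add hs ht)).congr fun x hx => ?_
      rw [neg_add, Real.rpow_add (ha.trans_le hx)]
      ring
    | add _ _ ih₁ ih₂ => exact (ih₁.add ih₂).congr fun x _ => by ring
    | congr _ heq ih => exact ih.congr fun x hx => by rw [heq x hx]
  | add _ _ ih₁ ih₂ => exact (ih₁.add ih₂).congr fun x _ => by ring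
  | congr _ heq ih => exact ih.congr fun x hx => by rw [heq x hx]

lemma exists_hasDerivWithinAt (ha : 0 < a) (hg : PowSum a e g) :
    ∃ g' : ℝ → ℝ, PowSum a (e + 1) g' ∧ ∀ x, a ≤ x → HasDerivWithinAt g (g' x) (Ici a) x := by
  induction hg with
  | @monomial c s hs =>
    refine ⟨fun x => (c * -s) * x ^ (-(s + 1)), .monomial _ (by linarith), fun x hx => ?_⟩
    have h := ((Real.hasDerivAt_rpow_const (p := -s) (Or.inl (ha.trans_le hx).ne')).const_mul
      c).hasDerivWithinAt (s := Ici a)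
    refine h.congr_deriv ?_
    simp only [neg_add', mul_assoc]
  | add _ _ ih₁ ih₂ =>
    obtain ⟨g₁, h₁, h₁'⟩ := ih₁
    obtain ⟨g₂, h₂, h₂'⟩ := ih₂
    exact ⟨_, h₁.add h₂, fun x hx => (h₁' x hx).add (h₂' x hx)⟩
  | congr _ heq ih =>
    obtain ⟨g', h₁, h₂⟩ := ih
    exact ⟨g', h₁, fun x hx => (h₂ x hx).congr (fun y hy => heq y hy) (heq x hx)⟩

lemma of_hasDerivAt {g' : ℝ → ℝ} (ha : 0 < a) (hg : PowSum a e g)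
    (hd : ∀ x, a ≤ x → HasDerivAt g (g' x) x) : PowSum a (e + 1) g' := by
  obtain ⟨k, hk, hk'⟩ := hg.exists_hasDerivWithinAt ha
  exact hk.congr fun x hx =>
    (uniqueDiffOn_Ici a x hx).eq_deriv _ (hd x hx).hasDerivWithinAt (hk' x hx)

lemma exists_bound (ha : 0 < a) (hg : PowSum a e g) :
    ∃ K : ℝ, 0 ≤ K ∧ ∀ x, a ≤ x → |g x| ≤ K * x ^ (-e) := by
  induction hg with
  | @monomial c s hs =>
    refine ⟨|c| * a ^ (-(s - e)), by positivity, fun x hx => ?_⟩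
    have hx0 := ha.trans_le hx
    rw [abs_mul, abs_of_pos (Real.rpow_pos_of_pos hx0 _), mul_assoc]
    gcongr
    have h₁ : x ^ (-s) = x ^ (-(s - e)) * x ^ (-e) := by
      rw [← Real.rpow_add hx0]; congr 1; ring
    rw [h₁]
    gcongr ?_ * _
    exact Real.rpow_le_rpow_of_nonpos ha hx (by linarith)
  | add _ _ ih₁ ih₂ =>
    obtain ⟨K₁, h₁, h₁'⟩ := ih₁
    obtain ⟨K₂, h₂, h₂'⟩ := ih₂
    refine ⟨K₁ + K₂, by positivity, fun x hx => (abs_add_le _ _).trans ?_⟩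
    rw [add_mul]
    exact add_le_add (h₁' x hx) (h₂' x hx)
  | congr _ heq ih =>
    obtain ⟨K, hK, h⟩ := ih
    exact ⟨K, hK, fun x hx => by rw [heq x hx]; exact h x hx⟩

end PowSum

lemma monotoneOn_of_hasDerivAt_nonneg {s : Set ℝ} (hs : Convex ℝ s) {g g' : ℝ → ℝ}
    (hd : ∀ x ∈ s, HasDerivAt g (g' x) x) (hg : ∀ x ∈ s, 0 ≤ g' x) : MonotoneOn g s :=
  monotoneOn_of_hasDerivWithinAt_nonneg hs (fun x hx => (hd x hx).continuousAt.continuousWithinAt)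
    (fun x hx => (hd x (interior_subset hx)).hasDerivWithinAt)
    (fun x hx => hg x (interior_subset hx))

lemma exists_upper_bound_of_deriv_le_rpow {g g' : ℝ → ℝ} {a K m : ℝ} (ha : 0 < a) (hm : 1 < m)
    (hK : 0 ≤ K) (hd : ∀ x, a ≤ x → HasDerivAt g (g' x) x)
    (hb : ∀ x, a ≤ x → g' x ≤ K * x ^ (-m)) : ∃ B : ℝ, ∀ x, a ≤ x → g x ≤ B := by
  have hmono : MonotoneOn (fun x => K / (1 - m) * x ^ (1 - m) - g x) (Ici a) := by
    refine monotoneOn_of_hasDerivAt_nonneg (convex_Ici a) (fun x hx =>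
      ((Real.hasDerivAt_rpow_const (p := 1 - m)
        (Or.inl (ha.trans_le hx).ne')).const_mul _).sub (hd x hx)) fun x hx => ?_
    have h := hb x hx
    have h₁ : K / (1 - m) * ((1 - m) * x ^ (1 - m - 1)) = K * x ^ (-m) := by
      have : 1 - m ≠ 0 := by linarith
      rw [show 1 - m - 1 = -m by ring]
      field_simp
    simp only [h₁]
    linarith
  refine ⟨g a - K / (1 - m) * a ^ (1 - m), fun x hx => ?_⟩
  have h := hmono (mem_Ici.2 le_rfl) (mem_Ici.2 hx) hx
  have h₂ : K / (1 - m) * x ^ (1 - m) ≤ 0 :=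
    mul_nonpos_of_nonpos_of_nonneg (div_nonpos_of_nonneg_of_nonpos hK (by linarith))
      (Real.rpow_nonneg (ha.le.trans hx) _)
  simp only at h
  linarith

lemma exists_bound_of_abs_deriv_le_rpow {g g' : ℝ → ℝ} {a K m : ℝ} (ha : 0 < a) (hm : 1 < m)
    (hK : 0 ≤ K) (hd : ∀ x, a ≤ x → HasDerivAt g (g' x) x)
    (hb : ∀ x, a ≤ x → |g' x| ≤ K * x ^ (-m)) : ∃ B : ℝ, ∀ x, a ≤ x → |g x| ≤ B := by
  obtain ⟨B₁, h₁⟩ := exists_upper_bound_of_deriv_le_rpow ha hm hK hd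
    fun x hx => (le_abs_self _).trans (hb x hx)
  obtain ⟨B₂, h₂⟩ := exists_upper_bound_of_deriv_le_rpow ha hm hK (fun x hx => (hd x hx).neg)
    fun x hx => (neg_le_abs _).trans (hb x hx)
  refine ⟨max B₁ B₂, fun x hx => abs_le'.2 ⟨?_, ?_⟩⟩
  · exact (h₁ x hx).trans (le_max_left _ _)
  · exact (h₂ x hx).trans (le_max_right _ _)

/-- A function satisfying `g' ≥ A g` with `A ≥ 1` either stays nonpositive or grows at least
exponentially. Here `m` is an integrating factor for `A`. -/
lemma nonpos_of_deriv_ge_mul {g g' m A : ℝ → ℝ} {a s : ℝ}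
    (hm : ∀ x, a ≤ x → 0 < m x) (hm' : ∀ x, a ≤ x → HasDerivAt m (-A x * m x) x)
    (hA : ∀ x, a ≤ x → 1 ≤ A x) (hg : ∀ x, a ≤ x → HasDerivAt g (g' x) x)
    (hle : ∀ x, a ≤ x → A x * g x ≤ g' x) (hgrow : ∀ x, a ≤ x → g x ≤ x ^ s) :
    ∀ x, a ≤ x → g x ≤ 0 := by
  intro y hy
  by_contra! hpos
  have hya : ∀ x ∈ Ici y, a ≤ x := fun x hx => hy.trans hx
  have hmon : MonotoneOn (fun x => g x * m x) (Ici y) := by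
    refine monotoneOn_of_hasDerivAt_nonneg (convex_Ici y)
      (fun x hx => (hg x (hya x hx)).mul (hm' x (hya x hx))) fun x hx => ?_
    have h := mul_nonneg (sub_nonneg.2 (hle x (hya x hx))) (hm x (hya x hx)).le
    linarith
  have hgpos : ∀ x ∈ Ici y, 0 < g x := by
    intro x hx
    have h := hmon (mem_Ici.2 le_rfl) hx hx
    have h₁ := mul_pos hpos (hm y hy)
    exact pos_of_mul_pos_left (h₁.trans_le h) (hm x (hya x hx)).le
  have hmon₂ : MonotoneOn (fun x => g x * Real.exp (-x)) (Ici y) := by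
    refine monotoneOn_of_hasDerivAt_nonneg (convex_Ici y)
      (fun x hx => (hg x (hya x hx)).mul (hasDerivAt_neg x).exp) fun x hx => ?_
    have h₁ := hle x (hya x hx)
    have h₂ := mul_le_mul_of_nonneg_right (hA x (hya x hx)) (hgpos x hx).le
    have h := mul_nonneg (sub_nonneg.2 (h₂.trans h₁)) (Real.exp_pos (-x)).le
    linarith
  have hlim := tendsto_rpow_mul_exp_neg_mul_atTop_nhds_zero s 1 one_pos
  have hev := hlim.eventually (gt_mem_nhds (mul_pos hpos (Real.exp_pos (-y))))
  obtain ⟨x, hx, hxy⟩ := (hev.and (eventually_ge_atTop y)).exists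
  have h := hmon₂ (mem_Ici.2 le_rfl) (mem_Ici.2 hxy) hxy
  have h₁ := mul_le_mul_of_nonneg_right (hgrow x (hya x hxy)) (Real.exp_pos (-x)).le
  simp only [neg_mul, one_mul] at hx
  simp only at h
  linarith

lemma eq_zero_of_eq_zero_right {γ lam : ℝ} (hγ : 0 < γ) {u : ℝ → ℝ} (hu : ContDiff ℝ 2 u)
    (hode : ∀ x : ℝ, -(deriv (deriv u) x) + Vp γ x * deriv u x = lam * u x)
    {x₀ : ℝ} (h₀ : u x₀ = 0) (h₁ : deriv u x₀ = 0) : ∀ y, y ≤ x₀ → u y = 0 := by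
  intro y hy
  have hu1 : ∀ x, HasDerivAt u (deriv u x) x := fun x =>
    (hu.differentiable (by norm_num) x).hasDerivAt
  have hu2 : ∀ x, HasDerivAt (deriv u) (deriv (deriv u) x) x := fun x =>
    ((contDiff_succ_iff_deriv (n := 1).1 hu).2.2.differentiable (by norm_num) x).hasDerivAt
  set M := |y| + |x₀|
  set K := |1 - lam| + 2 * M ^ γ with hK
  have hmon : MonotoneOn (fun x => (u x ^ 2 + deriv u x ^ 2) * Real.exp (K * x)) (Icc y x₀) := by
    refine monotoneOn_of_hasDerivAt_nonneg (convex_Icc y x₀)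
      (fun x _ => (((hu1 x).pow 2).add ((hu2 x).pow 2)).mul
        (((hasDerivAt_id x).const_mul K).exp)) fun x hx => ?_
    have hV : |Vp γ x| ≤ M ^ γ := by
      have hxM : |x| ≤ M := by
        rw [abs_le]
        constructor
        · linarith [hx.1, neg_abs_le y, abs_nonneg x₀]
        · linarith [hx.2, le_abs_self x₀, abs_nonneg y]
      have hs : |Real.sign x| ≤ 1 := by
        rcases Real.sign_apply_eq x with h | h | h <;> simp [h]
      rw [Vp, abs_mul, abs_of_nonneg (Real.rpow_nonneg (abs_nonneg x) γ)]
      calc _ ≤ 1 * |x| ^ γ := by gcongr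
        _ ≤ M ^ γ := by rw [one_mul]; exact Real.rpow_le_rpow (abs_nonneg x) hxM hγ.le
    have hode' : deriv (deriv u) x = Vp γ x * deriv u x - lam * u x := by linarith [hode x]
    have hV' := (abs_le.1 hV).1
    have h1 := (abs_le.1 (le_refl |1 - lam|))
    have hMnn : 0 ≤ M ^ γ := (abs_nonneg _).trans hV
    have key : 0 ≤ K * (u x ^ 2 + deriv u x ^ 2) + 2 * u x * deriv u x
        + 2 * deriv u x * deriv (deriv u) x := by
      rw [hode', hK]
      have e1 : 0 ≤ 2 * (M ^ γ + Vp γ x) * deriv u x ^ 2 := by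
        have : 0 ≤ M ^ γ + Vp γ x := by linarith
        positivity
      have e2 : 0 ≤ 2 * M ^ γ * u x ^ 2 := by positivity
      have e3 : 0 ≤ (|1 - lam| + (1 - lam)) * (u x + deriv u x) ^ 2 := by
        have : 0 ≤ |1 - lam| + (1 - lam) := by linarith
        positivity
      have e4 : 0 ≤ (|1 - lam| - (1 - lam)) * (u x - deriv u x) ^ 2 := by
        have : 0 ≤ |1 - lam| - (1 - lam) := by linarith
        positivity
      nlinarith
    have := mul_nonneg key (Real.exp_pos (K * x)).le
    refine this.trans_eq ?_
    simp only [Pi.add_apply, Pi.pow_apply, Nat.cast_ofNat, id]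
    ring
  have h := hmon (left_mem_Icc.2 hy) (right_mem_Icc.2 hy) hy
  simp only [h₀, h₁] at h
  have hE : 0 ≤ u y ^ 2 + deriv u y ^ 2 := by positivity
  have h' : (u y ^ 2 + deriv u y ^ 2) * Real.exp (K * y) ≤ 0 := by simpa using h
  have h'' : u y ^ 2 + deriv u y ^ 2 ≤ 0 := nonpos_of_mul_nonpos_left h' (Real.exp_pos _)
  have : u y ^ 2 = 0 := by nlinarith [sq_nonneg (u y), sq_nonneg (deriv u y)]
  exact pow_eq_zero_iff (two_ne_zero) |>.1 this

lemma hasDerivAt_Vpot {γ x : ℝ} (hγ : 0 < γ) (hx : 0 < x) : HasDerivAt (Vpot γ) (x ^ γ) x := by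
  have h : HasDerivAt (fun x : ℝ => x ^ (γ + 1) / (γ + 1)) (x ^ γ) x := by
    refine ((Real.hasDerivAt_rpow_const (p := γ + 1) (Or.inl hx.ne')).div_const _).congr_deriv ?_
    rw [add_sub_cancel_right]
    field_simp
  refine h.congr_of_eventuallyEq ?_
  filter_upwards [lt_mem_nhds hx] with y hy
  rw [Vpot, abs_of_pos hy]

lemma Vp_of_pos {γ x : ℝ} (hx : 0 < x) : Vp γ x = x ^ γ := by
  rw [Vp, Real.sign_of_pos hx, abs_of_pos hx, one_mul]

lemma eq_zero_of_monotoneOn_of_integrable {g : ℝ → ℝ} {a : ℝ} (hg : MonotoneOn g (Ici a))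
    (h0 : ∀ x, 0 ≤ g x) (hint : Integrable g) : ∀ x, a ≤ x → g x = 0 := by
  intro x hx
  have h : IntegrableOn (fun _ => g x) (Ioi x) := by
    refine Integrable.mono' hint.integrableOn aestronglyMeasurable_const ?_
    filter_upwards [ae_restrict_mem measurableSet_Ioi] with y hy
    rw [Real.norm_of_nonneg (h0 x)]
    exact hg hx (hx.trans (le_of_lt hy)) (le_of_lt hy)
  rw [integrableOn_const_iff (by simp)] at h
  simpa using h

section Eigenfunction

variable {γ lam xstar : ℝ} {u : ℝ → ℝ}

/-- With `φ = u exp (-V/2)`, this says that `φ φ' < 0` beyond the turning point. -/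
lemma mul_deriv_sub_neg (hγ : 0 < γ) (hx : 0 < xstar) (hu : ContDiff ℝ 2 u)
    (hune : ∃ x, u x ≠ 0)
    (hode : ∀ x : ℝ, -(deriv (deriv u) x) + Vp γ x * deriv u x = lam * u x)
    (huL2 : Integrable (fun x => (u x) ^ 2 * Real.exp (-(Vpot γ x))))
    (hturn : ∀ x, xstar ≤ x → 0 ≤ (x ^ γ) ^ 2 / 4 - (γ * x ^ (γ - 1)) / 2 - lam) :
    ∀ x, xstar ≤ x → u x * (deriv u x - x ^ γ / 2 * u x) < 0 := by
  intro x₀ hx₀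
  by_contra! hcon
  have hu1 : ∀ x, HasDerivAt u (deriv u x) x := fun x =>
    (hu.differentiable (by norm_num) x).hasDerivAt
  have hu2 : ∀ x, HasDerivAt (deriv u) (deriv (deriv u) x) x := fun x =>
    ((contDiff_succ_iff_deriv (n := 1).1 hu).2.2.differentiable (by norm_num) x).hasDerivAt
  have hge : ∀ x ∈ Ici x₀, xstar ≤ x := fun x h => hx₀.trans h
  have hpos : ∀ x ∈ Ici x₀, 0 < x := fun x h => hx.trans_le (hge x h)
  have hmon₁ : MonotoneOn (fun x => u x * (deriv u x - x ^ γ / 2 * u x) * Real.exp (-Vpot γ x))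
      (Ici x₀) := by
    refine monotoneOn_of_hasDerivAt_nonneg (convex_Ici x₀) (fun x h =>
      ((hu1 x).mul ((hu2 x).sub ((((Real.hasDerivAt_rpow_const (p := γ)
        (Or.inl (hpos x h).ne')).div_const 2)).mul (hu1 x)))).mul
        (hasDerivAt_Vpot hγ (hpos x h)).neg.exp) fun x h => ?_
    have ht := hturn x (hge x h)
    have ho := hode x
    rw [Vp_of_pos (hpos x h)] at ho
    have hode' : deriv (deriv u) x = x ^ γ * deriv u x - lam * u x := by linarith
    have key : 0 ≤ ((deriv u x - x ^ γ / 2 * u x) ^ 2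
        + ((x ^ γ) ^ 2 / 4 - (γ * x ^ (γ - 1)) / 2 - lam) * u x ^ 2)
        * Real.exp (-Vpot γ x) := by positivity
    refine key.trans_eq ?_
    simp only [hode', Pi.neg_apply, Pi.mul_apply, Pi.sub_apply]
    ring
  have hmon₂ : MonotoneOn (fun x => (u x) ^ 2 * Real.exp (-(Vpot γ x))) (Ici x₀) := by
    refine monotoneOn_of_hasDerivAt_nonneg (convex_Ici x₀) (fun x h =>
      ((hu1 x).pow 2).mul (hasDerivAt_Vpot hγ (hpos x h)).neg.exp) fun x h => ?_
    have h₁ := hmon₁ (mem_Ici.2 le_rfl) h h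
    have h₂ := mul_nonneg hcon (Real.exp_pos (-Vpot γ x₀)).le
    have h₃ : 0 ≤ 2 * (u x * (deriv u x - x ^ γ / 2 * u x) * Real.exp (-Vpot γ x)) := by
      simp only at h₁
      linarith
    refine h₃.trans_eq ?_
    simp only [Pi.neg_apply, Pi.pow_apply, Nat.cast_ofNat]
    ring
  have hz : ∀ x, x₀ ≤ x → u x = 0 := by
    intro x h
    have := eq_zero_of_monotoneOn_of_integrable hmon₂ (fun x => by positivity) huL2 x h
    simpa [(Real.exp_pos _).ne'] using this
  have hz' : deriv u (x₀ + 1) = 0 := by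
    have : u =ᶠ[𝓝 (x₀ + 1)] fun _ => (0 : ℝ) := by
      filter_upwards [lt_mem_nhds (lt_add_one x₀)] with y hy using hz y hy.le
    rw [this.deriv_eq]
    simp
  obtain ⟨y, hy⟩ := hune
  refine hy ?_
  rcases le_total y (x₀ + 1) with h | h
  · exact eq_zero_of_eq_zero_right hγ hu hode (hz _ (by linarith)) hz' y h
  · exact hz y (by linarith)

lemma pos_of_mul_deriv_sub_neg {x₀ : ℝ} (hu : Continuous u) (hux : 0 ≤ u x₀)
    (hneg : ∀ x, x₀ ≤ x → u x * (deriv u x - x ^ γ / 2 * u x) < 0) :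
    ∀ x, x₀ ≤ x → 0 < u x := by
  have hne : ∀ x, x₀ ≤ x → u x ≠ 0 := fun x h h0 => by
    have := hneg x h
    simp [h0] at this
  intro x h
  by_contra! hle
  obtain ⟨y, hy, hy0⟩ := intermediate_value_Icc' h hu.continuousOn ⟨hle, hux⟩
  exact hne y hy.1 hy0

lemma deriv_pos_of_pos (hγ : 0 < γ) (hlam : 0 < lam) (hx : 0 < xstar) (hu : ContDiff ℝ 2 u)
    (hode : ∀ x : ℝ, -(deriv (deriv u) x) + Vp γ x * deriv u x = lam * u x)
    (hpos : ∀ x, xstar ≤ x → 0 < u x) : ∀ x, xstar ≤ x → 0 < deriv u x := by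
  intro x₀ hx₀
  by_contra! hcon
  have hu1 : ∀ x, HasDerivAt u (deriv u x) x := fun x =>
    (hu.differentiable (by norm_num) x).hasDerivAt
  have hu2 : ∀ x, HasDerivAt (deriv u) (deriv (deriv u) x) x := fun x =>
    ((contDiff_succ_iff_deriv (n := 1).1 hu).2.2.differentiable (by norm_num) x).hasDerivAt
  have hge : ∀ x ∈ Ici x₀, xstar ≤ x := fun x h => hx₀.trans h
  have hpos' : ∀ x ∈ Ici x₀, 0 < x := fun x h => hx.trans_le (hge x h)
  have hode' : ∀ x ∈ Ici x₀, deriv (deriv u) x = x ^ γ * deriv u x - lam * u x := by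
    intro x h
    have ho := hode x
    rw [Vp_of_pos (hpos' x h)] at ho
    linarith
  have hmon₁ : MonotoneOn (fun x => -(deriv u x * Real.exp (-Vpot γ x))) (Ici x₀) := by
    refine monotoneOn_of_hasDerivAt_nonneg (convex_Ici x₀) (fun x h =>
      ((hu2 x).mul (hasDerivAt_Vpot hγ (hpos' x h)).neg.exp).neg) fun x h => ?_
    have key : 0 ≤ lam * u x * Real.exp (-Vpot γ x) := by
      have := hpos x (hge x h)
      positivity
    refine key.trans_eq ?_
    simp only [hode' x h, Pi.neg_apply]
    ring
  have hle : ∀ x ∈ Ici x₀, deriv u x ≤ 0 := by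
    intro x h
    have h₁ := hmon₁ (mem_Ici.2 le_rfl) h h
    have h₂ := mul_nonneg (neg_nonneg.2 hcon) (Real.exp_pos (-Vpot γ x₀)).le
    have h₃ : deriv u x * Real.exp (-Vpot γ x) ≤ 0 := by
      simp only at h₁
      linarith
    exact nonpos_of_mul_nonpos_left h₃ (Real.exp_pos _)
  have hdd : ∀ x ∈ Ici x₀, deriv (deriv u) x < 0 := by
    intro x h
    rw [hode' x h]
    have h₁ := mul_nonneg (Real.rpow_nonneg (hpos' x h).le γ) (neg_nonneg.2 (hle x h))
    have h₂ := mul_pos hlam (hpos x (hge x h))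
    linarith
  have hanti : StrictAntiOn (deriv u) (Ici x₀) := by
    refine strictAntiOn_of_deriv_neg (convex_Ici x₀)
      (fun x _ => (hu2 x).continuousAt.continuousWithinAt) fun x h => hdd x (interior_subset h)
  have hd1 : deriv u (x₀ + 1) < 0 :=
    (hanti (mem_Ici.2 le_rfl) (mem_Ici.2 (by linarith)) (by linarith)).trans_le hcon
  have hmon₂ : MonotoneOn (fun x => deriv u (x₀ + 1) * x - u x) (Ici (x₀ + 1)) := by
    refine monotoneOn_of_hasDerivAt_nonneg (convex_Ici _) (fun x _ =>
      ((hasDerivAt_id x).const_mul _).sub (hu1 x)) fun x h => ?_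
    have h' : x₀ + 1 ≤ x := h
    have := hanti.antitoneOn (mem_Ici.2 (by linarith)) (mem_Ici.2 (by linarith)) h'
    linarith
  set d := deriv u (x₀ + 1)
  have hu0 := hpos (x₀ + 1) (by linarith)
  have hstep : 0 ≤ u (x₀ + 1) / -d := div_nonneg hu0.le (by linarith)
  have hle' : x₀ + 1 ≤ x₀ + 1 + u (x₀ + 1) / -d := by linarith
  have h := hmon₂ (mem_Ici.2 le_rfl) (mem_Ici.2 hle') hle'
  have hup := hpos (x₀ + 1 + u (x₀ + 1) / -d) (by linarith)
  have hcancel : d * (u (x₀ + 1) / -d) = -u (x₀ + 1) := by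
    rw [div_neg, mul_neg, mul_div_cancel₀ _ hd1.ne]
  simp only [mul_add, hcancel] at h
  linarith

end Eigenfunction

namespace PowSum

lemma mul_sub_monomial {a r p q c d : ℝ} {g h : ℝ → ℝ} (ha : 0 < a) (hp : 0 ≤ p) (hq : 0 ≤ q)
    (hr : 0 ≤ r) (hg : PowSum a r (fun x => g x - c * x ^ (-p)))
    (hh : PowSum a r (fun x => h x - d * x ^ (-q))) :
    PowSum a r (fun x => g x * h x - c * d * x ^ (-(p + q))) := by
  have h₁ := ((PowSum.monomial c hp).mul ha hh).mono (e' := r) (by linarith)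
  have h₂ := (hg.mul ha hh).mono (e' := r) (by linarith)
  have h₃ := (hg.mul ha (PowSum.monomial d hq)).mono (e' := r) (by linarith)
  refine ((h₁.add h₂).add h₃).congr fun x hx => ?_
  rw [neg_add, Real.rpow_add (ha.trans_le hx)]
  ring

lemma of_sub_monomial {a r e p c : ℝ} {g : ℝ → ℝ}
    (hg : PowSum a r (fun x => g x - c * x ^ (-p))) (hr : e ≤ r) (hp : e ≤ p) :
    PowSum a e g :=
  ((hg.mono hr).add (PowSum.monomial c hp)).congr fun x _ => by ring

end PowSum

lemma sum_Icc_sum_Ico_eq_sum_Icc_sum_Icc (n : ℕ) (G : ℕ → ℕ → ℝ) :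
    ∑ k ∈ Finset.Icc 2 n, ∑ j ∈ Finset.Ico 1 k, G j (k - j)
      = ∑ i ∈ Finset.Icc 1 n, ∑ j ∈ Finset.Icc 1 n, if n < i + j then 0 else G i j := by
  have h : ∀ i ∈ Finset.Icc 1 n, (∑ j ∈ Finset.Icc 1 n, if n < i + j then 0 else G i j)
      = ∑ j ∈ (Finset.Icc 1 n).filter (fun j => i + j ≤ n), G i j := by
    intro i _
    rw [Finset.sum_filter]
    refine Finset.sum_congr rfl fun j _ => ?_
    by_cases hij : n < i + j
    · simp [hij]
    · simp [hij, not_lt.1 hij]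
  rw [Finset.sum_congr rfl h, Finset.sum_sigma', Finset.sum_sigma']
  refine Finset.sum_nbij' (fun p => ⟨p.2, p.1 - p.2⟩) (fun p => ⟨p.1 + p.2, p.1⟩) ?_ ?_ ?_ ?_ ?_
  · rintro ⟨k, j⟩ hp
    simp only [Finset.mem_sigma, Finset.mem_Icc, Finset.mem_Ico, Finset.mem_filter] at hp ⊢
    omega
  · rintro ⟨k, j⟩ hp
    simp only [Finset.mem_sigma, Finset.mem_Icc, Finset.mem_Ico, Finset.mem_filter] at hp ⊢
    omega
  · rintro ⟨k, j⟩ hp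
    simp only [Finset.mem_sigma, Finset.mem_Icc, Finset.mem_Ico] at hp
    simp only [Sigma.mk.injEq, heq_eq_eq, and_true]
    omega
  · rintro ⟨k, j⟩ hp
    simp
  · rintro ⟨k, j⟩ hp
    rfl

lemma truncated_riccati_eq {n : ℕ} (hn : 1 ≤ n) {F lam : ℝ} {s t : ℕ → ℝ} (h₁ : F * s 1 = lam)
    (hrec : ∀ k, 2 ≤ k → F * s k = t (k - 1) + ∑ j ∈ Finset.Ico 1 k, s j * s (k - j)) :
    (∑ i ∈ Finset.Icc 1 n, t i) + (∑ i ∈ Finset.Icc 1 n, s i) ^ 2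
        - F * (∑ i ∈ Finset.Icc 1 n, s i) + lam
      = t n + ∑ i ∈ Finset.Icc 1 n, ∑ j ∈ Finset.Icc 1 n, if n < i + j then s i * s j else 0 := by
  have hF : F * (∑ i ∈ Finset.Icc 1 n, s i) = lam + ((∑ i ∈ Finset.Icc 1 n, t i) - t n)
      + ∑ k ∈ Finset.Icc 2 n, ∑ j ∈ Finset.Ico 1 k, s j * s (k - j) := by
    induction n, hn using Nat.le_induction with
    | base => simp [h₁]
    | succ m hm ih =>
      rw [Finset.sum_Icc_succ_top (by omega), mul_add, ih, hrec (m + 1) (by omega),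
        Finset.sum_Icc_succ_top (by omega), Finset.sum_Icc_succ_top (by omega)]
      simp only [Nat.add_sub_cancel]
      ring
  rw [hF, sum_Icc_sum_Ico_eq_sum_Icc_sum_Icc n fun i j => s i * s j]
  have hsq : (∑ i ∈ Finset.Icc 1 n, s i) ^ 2
      = (∑ i ∈ Finset.Icc 1 n, ∑ j ∈ Finset.Icc 1 n, if n < i + j then s i * s j else 0)
      + ∑ i ∈ Finset.Icc 1 n, ∑ j ∈ Finset.Icc 1 n, if n < i + j then 0 else s i * s j := by
    rw [sq, Finset.sum_mul_sum, ← Finset.sum_add_distrib]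
    refine Finset.sum_congr rfl fun i _ => ?_
    rw [← Finset.sum_add_distrib]
    refine Finset.sum_congr rfl fun j _ => ?_
    split_ifs <;> simp
  rw [hsq]
  ring

namespace WKBHierarchy

variable {γ lam xstar : ℝ} {S S' S'' : ℕ → ℝ → ℝ}

lemma deriv_one (hS : WKBHierarchy γ lam xstar S S' S'') (hx : 0 < xstar) :
    ∀ x, xstar ≤ x → S' 1 x = lam / x ^ γ := by
  intro x hxx
  have hcont : ContinuousOn (fun s : ℝ => lam / s ^ γ) (Ioi 0) := fun y hy =>
    (continuousAt_const.div (Real.continuousAt_rpow_const y γ (Or.inl (ne_of_gt hy)))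
      (Real.rpow_pos_of_pos hy γ).ne').continuousWithinAt
  have hsub : uIcc xstar x ⊆ Ioi 0 := by
    rw [uIcc_of_le hxx]
    exact fun y hy => hx.trans_le hy.1
  have h := intervalIntegral.integral_hasDerivAt_right
    (hcont.mono hsub).intervalIntegrable
    (hcont.stronglyMeasurableAtFilter isOpen_Ioi x (hx.trans_le hxx))
    (hcont.continuousAt (Ioi_mem_nhds (hx.trans_le hxx)))
  have hS1 : S 1 = fun x => ∫ s in xstar..x, lam / s ^ γ := funext hS.S1_def
  exact (hS.deriv1 1 x hxx).unique (hS1 ▸ h)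

lemma exists_leading (hS : WKBHierarchy γ lam xstar S S' S'') (hγ : 0 < γ) (hx : 0 < xstar) :
    ∀ k : ℕ, 1 ≤ k →
      ∃ c : ℝ, PowSum xstar (1 + 2 * γ) (fun x => S' k x - c * x ^ (-((2 * (k : ℝ) - 1) * γ))) := by
  intro k
  induction k using Nat.strong_induction_on with
  | _ k ih =>
    intro hk
    have hcast : ∀ j : ℕ, 1 ≤ j → (1 : ℝ) ≤ j := fun j hj => by exact_mod_cast hj
    rcases hk.eq_or_lt with rfl | hk2
    · refine ⟨lam, PowSum.zero.congr fun x hxx => ?_⟩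
      rw [hS.deriv_one hx x hxx, div_eq_mul_inv, ← Real.rpow_neg (hx.le.trans hxx)]
      norm_num
    · have hterm : ∀ j ∈ Finset.Ico 1 k, ∃ c : ℝ, PowSum xstar (1 + 2 * γ)
          (fun x => S' j x * S' (k - j) x - c * x ^ (-((2 * (k : ℝ) - 2) * γ))) := by
        intro j hj
        rw [Finset.mem_Ico] at hj
        obtain ⟨c, hc⟩ := ih j hj.2 hj.1
        obtain ⟨d, hd⟩ := ih (k - j) (by omega) (by omega)
        have h₁ := hcast j hj.1
        have h₂ := hcast (k - j) (by omega)
        have h := PowSum.mul_sub_monomial hx (mul_nonneg (by linarith) hγ.le)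
          (mul_nonneg (by linarith) hγ.le) (by positivity) hc hd
        refine ⟨c * d, h.congr fun x _ => ?_⟩
        rw [Nat.cast_sub hj.2.le]
        congr 4
        ring
      choose! c hc using hterm
      have hprev : PowSum xstar (γ + 1) (S'' (k - 1)) := by
        obtain ⟨d, hd⟩ := ih (k - 1) (by omega) (by omega)
        have h₂ := hcast (k - 1) (by omega)
        exact (hd.of_sub_monomial (by linarith) (by nlinarith)).of_hasDerivAt hx
          (hS.deriv2 (k - 1))
      have hf : PowSum xstar γ (fun x => 1 * x ^ (-γ)) := .monomial 1 le_rfl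
      refine ⟨∑ j ∈ Finset.Ico 1 k, c j, (((hprev.mul hx hf).mono (by linarith)).add
        (((PowSum.sum _ hc).mul hx hf).mono (by linarith))).congr fun x hxx => ?_⟩
      have hx0 := hx.trans_le hxx
      rw [hS.recurrence k hk2 x hxx, Finset.sum_sub_distrib, ← Finset.sum_mul,
        Real.rpow_neg hx0.le γ, show -((2 * (k : ℝ) - 1) * γ) = -((2 * (k : ℝ) - 2) * γ) + -γ by ring,
        Real.rpow_add hx0, Real.rpow_neg hx0.le γ]
      ring

lemma powSum_deriv (hS : WKBHierarchy γ lam xstar S S' S'') (hγ : 0 < γ) (hx : 0 < xstar)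
    {k : ℕ} (hk : 1 ≤ k) : PowSum xstar γ (S' k) := by
  obtain ⟨c, hc⟩ := hS.exists_leading hγ hx k hk
  have : (1 : ℝ) ≤ k := by exact_mod_cast hk
  exact hc.of_sub_monomial (by linarith) (by nlinarith)

lemma exists_residual (hS : WKBHierarchy γ lam xstar S S' S'') (hγ : 0 < γ) (hx : 0 < xstar)
    {n : ℕ} (hn : (1 + γ) / (2 * γ) < (n : ℝ)) :
    ∃ r : ℝ → ℝ, PowSum xstar (1 + γ) r ∧ ∀ x, xstar ≤ x →
      (∑ i ∈ Finset.Icc 1 n, S'' i x) + (∑ i ∈ Finset.Icc 1 n, S' i x) ^ 2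
        - x ^ γ * (∑ i ∈ Finset.Icc 1 n, S' i x) + lam = r x := by
  have hn1 : 1 ≤ n := by
    have : (0 : ℝ) < n := lt_of_le_of_lt (by positivity) hn
    exact_mod_cast this
  refine ⟨fun x => S'' n x
    + ∑ i ∈ Finset.Icc 1 n, ∑ j ∈ Finset.Icc 1 n, if n < i + j then S' i x * S' j x else 0,
    ?_, fun x hxx => ?_⟩
  · refine (((hS.powSum_deriv hγ hx hn1).of_hasDerivAt hx (hS.deriv2 n)).mono (by linarith)).add
      (PowSum.sum _ fun i hi => PowSum.sum _ fun j hj => ?_)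
    by_cases hij : n < i + j
    · simp only [hij, if_true]
      rw [Finset.mem_Icc] at hi hj
      obtain ⟨c, hc⟩ := hS.exists_leading hγ hx i hi.1
      obtain ⟨d, hd⟩ := hS.exists_leading hγ hx j hj.1
      have hi' : (1 : ℝ) ≤ i := by exact_mod_cast hi.1
      have hj' : (1 : ℝ) ≤ j := by exact_mod_cast hj.1
      have hij' : (n : ℝ) + 1 ≤ i + j := by exact_mod_cast hij
      have h := PowSum.mul_sub_monomial hx (mul_nonneg (by linarith) hγ.le)
        (mul_nonneg (by linarith) hγ.le) (by positivity) hc hd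
      refine h.of_sub_monomial (by linarith) ?_
      rw [div_lt_iff₀ (by positivity)] at hn
      nlinarith
    · simp only [hij, if_false]
      exact PowSum.zero
  · have hf : x ^ γ ≠ 0 := (Real.rpow_pos_of_pos (hx.trans_le hxx) γ).ne'
    refine truncated_riccati_eq hn1 (s := fun i => S' i x) (t := fun i => S'' i x) ?_ ?_
    · simp only [hS.deriv_one hx x hxx]
      field_simp
    · intro k hk
      simp only [hS.recurrence k hk x hxx]
      field_simp

end WKBHierarchy

lemma exp_two_sided_of_abs_log_sub_le {u T : ℝ → ℝ} {a B : ℝ} (hpos : ∀ x, a ≤ x → 0 < u x)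
    (hB : ∀ x, a ≤ x → |Real.log (u x) - T x| ≤ B) :
    ∃ C : ℝ, 1 ≤ C ∧ ∀ x, a ≤ x → C⁻¹ * Real.exp (T x) ≤ u x ∧ u x ≤ C * Real.exp (T x) := by
  refine ⟨Real.exp B, Real.one_le_exp ((abs_nonneg _).trans (hB a le_rfl)), fun x hx => ?_⟩
  have h := abs_le.1 (hB x hx)
  rw [← Real.exp_neg, ← Real.exp_add, ← Real.exp_add]
  constructor
  · rw [← Real.le_log_iff_exp_le (hpos x hx)]
    linarith
  · rw [← Real.log_le_iff_le_exp (hpos x hx)]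
    linarith

namespace WKBHierarchy

variable {γ lam xstar : ℝ} {S S' S'' : ℕ → ℝ → ℝ}

lemma exists_bound_sub_monomial (hS : WKBHierarchy γ lam xstar S S' S'') (hγ : 0 < γ)
    (hx : 0 < xstar) {k : ℕ} {c : ℝ} (hk : 1 - (2 * (k : ℝ) - 1) * γ ≠ 0)
    (hc : PowSum xstar (1 + 2 * γ) (fun x => S' k x - c * x ^ (-((2 * (k : ℝ) - 1) * γ)))) :
    ∃ B : ℝ, ∀ x, xstar ≤ x →
      |S k x - c / (1 - (2 * (k : ℝ) - 1) * γ) * x ^ (1 - (2 * (k : ℝ) - 1) * γ)| ≤ B := by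
  obtain ⟨K, hK, hb⟩ := hc.exists_bound hx
  refine exists_bound_of_abs_deriv_le_rpow hx (by linarith) hK (fun x hxx => ?_) hb
  refine ((hS.deriv1 k x hxx).sub ((Real.hasDerivAt_rpow_const
    (p := 1 - (2 * (k : ℝ) - 1) * γ) (Or.inl (hx.trans_le hxx).ne')).const_mul _)).congr_deriv ?_
  rw [← mul_assoc, div_mul_cancel₀ _ hk]
  congr 3
  ring

lemma exists_bound_sum_sub (hS : WKBHierarchy γ lam xstar S S' S'') (hγ : 0 < γ)
    (hx : 0 < xstar) {n : ℕ} (hn : 1 ≤ n) (hodd : ¬ ∃ m : ℕ, (1 : ℝ) / γ = 2 * (m : ℝ) + 1) :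
    ∃ (Cc : ℕ → ℝ) (B : ℝ), ∀ x, xstar ≤ x →
      |(∑ i ∈ Finset.Icc 1 n, S i x) - (lam * x ^ (1 - γ) / (1 - γ)
        + ∑ i ∈ Finset.Icc 2 n, Cc i * x ^ (1 - (2 * (i : ℝ) - 1) * γ))| ≤ B := by
  have hne : ∀ i : ℕ, 1 ≤ i → 1 - (2 * (i : ℝ) - 1) * γ ≠ 0 := by
    intro i hi h
    refine hodd ⟨i - 1, ?_⟩
    rw [Nat.cast_sub hi, div_eq_iff hγ.ne']
    push_cast
    linarith
  have hlead : ∀ i : ℕ, ∃ c : ℝ, 1 ≤ i → PowSum xstar (1 + 2 * γ)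
      (fun x => S' i x - c * x ^ (-((2 * (i : ℝ) - 1) * γ))) := by
    intro i
    by_cases hi : 1 ≤ i
    · obtain ⟨c, hc⟩ := hS.exists_leading hγ hx i hi
      exact ⟨c, fun _ => hc⟩
    · exact ⟨0, fun h => absurd h hi⟩
  choose c hc using hlead
  have hbd : ∀ i : ℕ, ∃ B : ℝ, 1 ≤ i → ∀ x, xstar ≤ x →
      |S i x - c i / (1 - (2 * (i : ℝ) - 1) * γ) * x ^ (1 - (2 * (i : ℝ) - 1) * γ)| ≤ B := by
    intro i
    by_cases hi : 1 ≤ i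
    · obtain ⟨B, hB⟩ := hS.exists_bound_sub_monomial hγ hx (hne i hi) (hc i hi)
      exact ⟨B, fun _ => hB⟩
    · exact ⟨0, fun h => absurd h hi⟩
  choose B hB using hbd
  have hone : PowSum xstar (1 + 2 * γ)
      (fun x => S' 1 x - lam * x ^ (-((2 * ((1 : ℕ) : ℝ) - 1) * γ))) :=
    PowSum.zero.congr fun x hxx => by
      rw [hS.deriv_one hx x hxx, div_eq_mul_inv, ← Real.rpow_neg (hx.le.trans hxx)]
      norm_num
  obtain ⟨B₁, hB₁⟩ := hS.exists_bound_sub_monomial hγ hx (hne 1 le_rfl) hone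
  refine ⟨fun i => c i / (1 - (2 * (i : ℝ) - 1) * γ), B₁ + ∑ i ∈ Finset.Icc 2 n, B i,
    fun x hxx => ?_⟩
  have hIcc : Finset.Icc 1 n = insert 1 (Finset.Icc 2 n) := by
    ext i
    simp only [Finset.mem_Icc, Finset.mem_insert]
    omega
  rw [hIcc, Finset.sum_insert (by simp), add_sub_add_comm, ← Finset.sum_sub_distrib]
  refine (abs_add_le _ _).trans (add_le_add ?_ ((Finset.abs_sum_le_sum_abs _ _).trans
    (Finset.sum_le_sum fun i hi => hB i (by rw [Finset.mem_Icc] at hi; omega) x hxx)))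
  have h := hB₁ x hxx
  rw [Nat.cast_one, show (1 : ℝ) - (2 * 1 - 1) * γ = 1 - γ by ring, div_mul_eq_mul_div] at h
  exact h

/-- The logarithm of a positive solution with `0 < u' / u < V' / 2` differs from the truncated
WKB expansion by a bounded amount. -/
lemma exists_bound_log_sub (hS : WKBHierarchy γ lam xstar S S' S'') (hγ : 0 < γ)
    (hx : 0 < xstar) {n : ℕ} (hn : (1 + γ) / (2 * γ) < (n : ℝ)) {u : ℝ → ℝ}
    (hu : ContDiff ℝ 2 u)
    (hode : ∀ x : ℝ, -(deriv (deriv u) x) + Vp γ x * deriv u x = lam * u x)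
    (hpos : ∀ x, xstar ≤ x → 0 < u x) (hpos' : ∀ x, xstar ≤ x → 0 < deriv u x)
    (hlt : ∀ x, xstar ≤ x → deriv u x / u x < x ^ γ / 2) :
    ∃ B : ℝ, ∀ x, xstar ≤ x → |Real.log (u x) - ∑ i ∈ Finset.Icc 1 n, S i x| ≤ B := by
  have hu1 : ∀ x, HasDerivAt u (deriv u x) x := fun x =>
    (hu.differentiable (by norm_num) x).hasDerivAt
  have hu2 : ∀ x, HasDerivAt (deriv u) (deriv (deriv u) x) x := fun x =>
    ((contDiff_succ_iff_deriv (n := 1).1 hu).2.2.differentiable (by norm_num) x).hasDerivAt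
  obtain ⟨r, hr, hres⟩ := hS.exists_residual hγ hx hn
  obtain ⟨K, hK, hrb⟩ := hr.exists_bound hx
  set q : ℝ → ℝ := fun x => ∑ i ∈ Finset.Icc 1 n, S' i x with hq
  set p : ℝ → ℝ := fun x => deriv u x / u x with hp
  have hqP : PowSum xstar 0 q := (PowSum.sum _ fun i hi =>
    hS.powSum_deriv hγ hx (Finset.mem_Icc.1 hi).1).mono hγ.le
  obtain ⟨Q, hQ, hqb⟩ := hqP.exists_bound hx
  replace hqb : ∀ x, xstar ≤ x → |q x| ≤ Q := fun x hxx => by simpa using hqb x hxx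
  obtain ⟨x₁, hx₁⟩ := eventually_atTop.1
    (((tendsto_rpow_atTop hγ).eventually_ge_atTop (4 * (Q + 1))).and
      (eventually_ge_atTop xstar))
  have hge : ∀ x, x₁ ≤ x → xstar ≤ x := fun x h => (hx₁ x h).2
  have hlarge : ∀ x, x₁ ≤ x → 4 * (Q + 1) ≤ x ^ γ := fun x h => (hx₁ x h).1
  have hx₁0 : 0 < x₁ := hx.trans_le (hge x₁ le_rfl)
  have hA : ∀ x, x₁ ≤ x → x ^ γ / 4 + 1 ≤ x ^ γ - p x - q x := fun x h => by
    have h₁ := hlt x (hge x h)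
    have h₂ := (abs_le.1 (hqb x (hge x h))).2
    have h₃ := hlarge x h
    simp only [hp]
    linarith
  have hT : ∀ x, xstar ≤ x → HasDerivAt (fun x => ∑ i ∈ Finset.Icc 1 n, S i x) (q x) x :=
    fun x h => HasDerivAt.fun_sum fun i _ => hS.deriv1 i x h
  have hd : ∀ x, xstar ≤ x →
      HasDerivAt (fun x => p x - q x) ((x ^ γ - p x - q x) * (p x - q x) - r x) x := by
    intro x h
    have hq' : HasDerivAt q (∑ i ∈ Finset.Icc 1 n, S'' i x) x :=
      HasDerivAt.fun_sum fun i _ => hS.deriv2 i x h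
    refine (((hu2 x).div (hu1 x) (hpos x h).ne').sub hq').congr_deriv ?_
    have ho := hode x
    rw [Vp_of_pos (hx.trans_le h)] at ho
    have ho' : deriv (deriv u) x = x ^ γ * deriv u x - lam * u x := by linarith
    have hres' : (∑ i ∈ Finset.Icc 1 n, S'' i x) = r x - q x ^ 2 + x ^ γ * q x - lam := by
      linarith [hres x h]
    have hune := (hpos x h).ne'
    rw [hres', ho']
    simp only [hp]
    field_simp
    ring
  have hcomp : ∀ σ : ℝ, |σ| = 1 → (∀ x, x₁ ≤ x → σ * (p x - q x) ≤ x ^ γ) →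
      ∀ x, x₁ ≤ x → σ * (p x - q x) ≤ 4 * K * x ^ (-(1 + 2 * γ)) := by
    intro σ hσ hgrow x h
    have hh : ∀ y, x₁ ≤ y → 0 ≤ 4 * K * y ^ (-(1 + 2 * γ)) := fun y hy =>
      mul_nonneg (by positivity) (Real.rpow_nonneg (hx₁0.le.trans hy) _)
    have hfin := nonpos_of_deriv_ge_mul (s := γ) (a := x₁)
      (m := fun x => u x * Real.exp (∑ i ∈ Finset.Icc 1 n, S i x) * Real.exp (-Vpot γ x))
      (A := fun x => x ^ γ - p x - q x)
      (g := fun x => σ * (p x - q x) - 4 * K * x ^ (-(1 + 2 * γ)))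
      (g' := fun x => σ * ((x ^ γ - p x - q x) * (p x - q x) - r x)
        - 4 * K * (-(1 + 2 * γ) * x ^ (-(1 + 2 * γ) - 1))) ?_ ?_ ?_ ?_ ?_ ?_ x h
    · simpa using hfin
    · intro y hy
      have := hpos y (hge y hy)
      positivity
    · intro y hy
      refine (((hu1 y).mul (hT y (hge y hy)).exp).mul
        (hasDerivAt_Vpot hγ (hx₁0.trans_le hy)).neg.exp).congr_deriv ?_
      have hune := (hpos y (hge y hy)).ne'
      simp only [hp, Pi.mul_apply, Pi.neg_apply]
      field_simp
      ring
    · intro y hy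
      have := hA y hy
      have h₂ := hlarge y hy
      linarith
    · intro y hy
      exact ((hd y (hge y hy)).const_mul σ).sub ((Real.hasDerivAt_rpow_const
        (Or.inl (hx₁0.trans_le hy).ne')).const_mul _)
    · intro y hy
      have hy0 := hx₁0.trans_le hy
      have h₁ : σ * r y ≤ K * y ^ (-(1 + γ)) := by
        refine ((le_abs_self _).trans ?_).trans (hrb y (hge y hy))
        rw [abs_mul, hσ, one_mul]
      have h₂ : K * y ^ (-(1 + γ)) ≤ (y ^ γ - p y - q y) * (4 * K * y ^ (-(1 + 2 * γ))) := by
        have h₃ := mul_le_mul_of_nonneg_right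
          ((le_add_of_nonneg_right zero_le_one).trans (hA y hy)) (hh y hy)
        refine le_trans (le_of_eq ?_) h₃
        rw [show -(1 + γ) = γ + -(1 + 2 * γ) by ring, Real.rpow_add hy0]
        ring
      have h₄ : 0 ≤ 4 * K * ((1 + 2 * γ) * y ^ (-(1 + 2 * γ) - 1)) := by positivity
      linarith
    · intro y hy
      have := hgrow y hy
      have := hh y hy
      linarith
  have hdb : ∀ x, x₁ ≤ x → |p x - q x| ≤ 4 * K * x ^ (-(1 + 2 * γ)) := by
    intro x h
    refine abs_le'.2 ⟨?_, ?_⟩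
    · refine (one_mul (p x - q x)).symm.trans_le (hcomp 1 (by simp) (fun y hy => ?_) x h)
      have h₁ := hlt y (hge y hy)
      have h₂ := (abs_le.1 (hqb y (hge y hy))).1
      have h₃ := hlarge y hy
      simp only [hp]
      linarith
    · refine (neg_one_mul (p x - q x)).symm.trans_le (hcomp (-1) (by simp) (fun y hy => ?_) x h)
      have h₁ : 0 < p y := div_pos (hpos' y (hge y hy)) (hpos y (hge y hy))
      have h₂ := (abs_le.1 (hqb y (hge y hy))).2
      have h₃ := hlarge y hy
      linarith
  have hlog : ∀ x, xstar ≤ x →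
      HasDerivAt (fun x => Real.log (u x) - ∑ i ∈ Finset.Icc 1 n, S i x) (p x - q x) x :=
    fun x h => ((hu1 x).log (hpos x h).ne').sub (hT x h)
  obtain ⟨B₁, hB₁⟩ := exists_bound_of_abs_deriv_le_rpow hx₁0 (by linarith) (by positivity)
    (fun x h => hlog x (hge x h)) hdb
  obtain ⟨B₂, hB₂⟩ := (isCompact_Icc (a := xstar) (b := x₁)).exists_bound_of_continuousOn
    fun x h => (hlog x h.1).continuousAt.continuousWithinAt
  refine ⟨max B₁ B₂, fun x h => ?_⟩
  rcases le_total x₁ x with h' | h'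
  · exact (hB₁ x h').trans (le_max_left _ _)
  · exact (hB₂ x ⟨h, h'⟩).trans (le_max_right _ _)

end WKBHierarchy

/-- **Growth of the eigenfunctions (ε = 1, γ > 0).**  A nonzero weighted-L²
eigenfunction `u` of `−L₁` with eigenvalue `λ > 0` and `u(x*) ≥ 0` satisfies
`u(x) ≍ exp(Σ_{i=1}^n S_i(x))` on `[x*,∞)` for any `n > (1+γ)/(2γ)`; moreover,
if `1/γ` is not an odd integer, `u(x) ≍ exp(λ·x^{1−γ}/(1−γ) +
Σ_{i=2}^n C_i·x^{1−(2i−1)γ})` for suitable constants `C_i`. -/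
theorem stmt11 (γ lam xstar : ℝ) (hγ : 0 < γ) (hlam : 0 < lam) (hx : 0 < xstar)
    (u : ℝ → ℝ) (hu : ContDiff ℝ 2 u) (hune : ∃ x, u x ≠ 0)
    (hode : ∀ x : ℝ,
      -(deriv (deriv u) x) + Vp γ x * deriv u x = lam * u x)
    (huL2 : Integrable (fun x => (u x) ^ 2 * Real.exp (-(Vpot γ x))))
    (hturn : ∀ x, xstar ≤ x → 0 ≤ (x ^ γ) ^ 2 / 4 - (γ * x ^ (γ - 1)) / 2 - lam)
    (hux : 0 ≤ u xstar)
    (n : ℕ) (hn : (1 + γ) / (2 * γ) < (n : ℝ))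
    (S S' S'' : ℕ → ℝ → ℝ) (hS : WKBHierarchy γ lam xstar S S' S'') :
    (∃ C : ℝ, 1 ≤ C ∧ ∀ x, xstar ≤ x →
      C⁻¹ * Real.exp (∑ i ∈ Finset.Icc 1 n, S i x) ≤ u x ∧
      u x ≤ C * Real.exp (∑ i ∈ Finset.Icc 1 n, S i x)) ∧
    ((¬ ∃ m : ℕ, (1 : ℝ) / γ = 2 * (m : ℝ) + 1) →
      ∃ Cc : ℕ → ℝ, ∃ C' : ℝ, 1 ≤ C' ∧ ∀ x, xstar ≤ x →
        C'⁻¹ * Real.exp (lam * x ^ (1 - γ) / (1 - γ)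
            + ∑ i ∈ Finset.Icc 2 n, Cc i * x ^ (1 - (2 * (i : ℝ) - 1) * γ)) ≤ u x ∧
        u x ≤ C' * Real.exp (lam * x ^ (1 - γ) / (1 - γ)
            + ∑ i ∈ Finset.Icc 2 n, Cc i * x ^ (1 - (2 * (i : ℝ) - 1) * γ))) := by
  have hneg := mul_deriv_sub_neg hγ hx hu hune hode huL2 hturn
  have hpos := pos_of_mul_deriv_sub_neg hu.continuous hux hneg
  have hpos' := deriv_pos_of_pos hγ hlam hx hu hode hpos
  have hlt : ∀ x, xstar ≤ x → deriv u x / u x < x ^ γ / 2 := fun x h => by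
    rw [div_lt_iff₀ (hpos x h)]
    exact sub_neg.1 (neg_of_mul_neg_right (hneg x h) (hpos x h).le)
  obtain ⟨B, hB⟩ := hS.exists_bound_log_sub hγ hx hn hu hode hpos hpos' hlt
  refine ⟨exp_two_sided_of_abs_log_sub_le hpos hB, fun hodd => ?_⟩
  have hn1 : 1 ≤ n := by
    have : (0 : ℝ) < n := lt_of_le_of_lt (by positivity) hn
    exact_mod_cast this
  obtain ⟨Cc, B', hB'⟩ := hS.exists_bound_sum_sub hγ hx hn1 hodd
  exact ⟨Cc, exp_two_sided_of_abs_log_sub_le hpos fun x h =>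
    (abs_sub_le _ _ _).trans (add_le_add (hB x h) (hB' x h))⟩
end

section
/- Let γ>1, V(x)=|x|^{γ+1}/(γ+1), and λ>0. Let u:ℝ→ℝ be twice continuously differentiable, solve −u''(x) + V'(x)·u'(x) = λ·u(x) for all x∈ℝ, and satisfy ∫_ℝ u(x)² e^{−V(x)} dx < ∞. Then u is bounded on ℝ, i.e. sup_{x∈ℝ} |u(x)| < ∞. -/
open Real MeasureTheory

open Set

/-- On a convex set, a differentiable function with nonnegative derivative in the interior is
monotone. -/
lemma monotoneOn_of_hasDerivAt_nonneg_s12 {D : Set ℝ} (hD : Convex ℝ D) {f f' : ℝ → ℝ}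
    (hf : ∀ x ∈ D, HasDerivAt f (f' x) x) (hf' : ∀ x ∈ interior D, 0 ≤ f' x) :
    MonotoneOn f D :=
  monotoneOn_of_deriv_nonneg hD (fun x hx => (hf x hx).continuousAt.continuousWithinAt)
    (fun x hx => (hf x (interior_subset hx)).differentiableAt.differentiableWithinAt)
    (fun x hx => by rw [(hf x (interior_subset hx)).deriv]; exact hf' x hx)

lemma hasDerivAt_rpow_add_one_div {γ x : ℝ} (hγ : 1 < γ) (hx : 0 < x) :
    HasDerivAt (fun x : ℝ => x ^ (γ + 1) / (γ + 1)) (x ^ γ) x := by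
  have h := (Real.hasDerivAt_rpow_const (x := x) (p := γ + 1) (Or.inl hx.ne')).div_const (γ + 1)
  refine h.congr_deriv ?_
  rw [add_sub_cancel_right]
  field_simp

/-- The region `u > 0`, `u' ≥ ρ u` is forward invariant for `u'' = x ^ γ u' - lam u`. -/
lemma pos_and_slope_of_pos {γ lam ρ x₁ : ℝ} {u v : ℝ → ℝ} (hγ : 1 < γ) (hx₁ : 0 < x₁)
    (hρ : 0 < ρ) (hρ₁ : ρ ≤ x₁ ^ γ / 2) (hρ₂ : lam ≤ ρ * (x₁ ^ γ / 2))
    (hu : ∀ x, 0 < x → HasDerivAt u (v x) x)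
    (hv : ∀ x, 0 < x → HasDerivAt v (x ^ γ * v x - lam * u x) x)
    (h₁ : 0 < u x₁) (h₂ : ρ * u x₁ ≤ v x₁) {x : ℝ} (hx : x₁ ≤ x) :
    0 < u x ∧ ρ * u x ≤ v x := by
  have slope : ∀ z, x₁ ≤ z → (∀ t ∈ Ioo x₁ z, 0 < u t) →
      ∀ t ∈ Icc x₁ z, ρ * u t ≤ v t := by
    intro z hz hpos t ht
    have mono : MonotoneOn (fun x => (v x - ρ * u x) * exp (ρ * x - x ^ (γ + 1) / (γ + 1)))
        (Icc x₁ z) := by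
      refine monotoneOn_of_hasDerivAt_nonneg_s12 (convex_Icc _ _)
        (f' := fun x => (ρ * (x ^ γ - ρ) - lam) * u x *
          exp (ρ * x - x ^ (γ + 1) / (γ + 1))) ?_ ?_
      · intro x hx
        have hx0 : 0 < x := hx₁.trans_le hx.1
        have h := ((hv x hx0).sub ((hu x hx0).const_mul ρ)).mul
          ((((hasDerivAt_id x).const_mul ρ).sub (hasDerivAt_rpow_add_one_div hγ hx0)).exp)
        refine h.congr_deriv ?_
        simp only [id, Pi.sub_apply]
        ring
      · intro x hx
        rw [interior_Icc] at hx
        have hp : x₁ ^ γ ≤ x ^ γ := rpow_le_rpow hx₁.le hx.1.le (by linarith)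
        have hc : 0 ≤ ρ * (x ^ γ - ρ) - lam := by nlinarith
        have := hpos x hx
        positivity
    have h := mono (left_mem_Icc.2 hz) ht ht.1
    have h' : 0 ≤ (v t - ρ * u t) * exp (ρ * t - t ^ (γ + 1) / (γ + 1)) :=
      le_trans (mul_nonneg (by linarith) (exp_pos _).le) h
    have := nonneg_of_mul_nonneg_left h' (exp_pos _)
    linarith
  have pos : ∀ y, x₁ ≤ y → 0 < u y := by
    by_contra! hcon
    obtain ⟨y, hy, huy⟩ := hcon
    have hcont : ContinuousOn u (Icc x₁ y) := fun t ht =>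
      (hu t (hx₁.trans_le ht.1)).continuousAt.continuousWithinAt
    have hK : IsCompact (Icc x₁ y ∩ u ⁻¹' Iic 0) :=
      isCompact_Icc.of_isClosed_subset
        (hcont.preimage_isClosed_of_isClosed isClosed_Icc isClosed_Iic) inter_subset_left
    obtain ⟨z, ⟨hz, huz⟩, hleast⟩ := hK.exists_isLeast ⟨y, ⟨hy, le_rfl⟩, huy⟩
    have hpos : ∀ t ∈ Ioo x₁ z, 0 < u t := by
      intro t ht
      by_contra! hut
      exact absurd (hleast ⟨⟨ht.1.le, ht.2.le.trans hz.2⟩, hut⟩) (not_le.2 ht.2)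
    have mono : MonotoneOn u (Icc x₁ z) := by
      refine monotoneOn_of_hasDerivAt_nonneg_s12 (convex_Icc _ _)
        (fun t ht => hu t (hx₁.trans_le ht.1)) ?_
      intro t ht
      have h := slope z hz.1 hpos t (interior_subset ht)
      rw [interior_Icc] at ht
      exact (mul_pos hρ (hpos t ht)).le.trans h
    have h := mono (left_mem_Icc.2 hz.1) (right_mem_Icc.2 hz.1) hz.1
    have : u z ≤ 0 := huz
    linarith
  exact ⟨pos x hx, slope x hx (fun t ht => pos t ht.1.le) x (right_mem_Icc.2 hx)⟩

/-- A function bounded below by a positive constant near infinity is not integrable. -/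
lemma not_integrableOn_of_le {f : ℝ → ℝ} {a c : ℝ} (hc : 0 < c) (h : ∀ x, a ≤ x → c ≤ f x) :
    ¬ IntegrableOn f (Ioi a) := by
  intro hf
  have hconst : IntegrableOn (fun _ : ℝ => c) (Ioi a) := by
    refine Integrable.mono' hf aestronglyMeasurable_const ?_
    filter_upwards [ae_restrict_mem measurableSet_Ioi] with x hx
    rw [norm_of_nonneg hc.le]
    exact h x (le_of_lt hx)
  rw [integrableOn_const_iff] at hconst
  simp [hc.ne'] at hconst

/-- A solution with `u' ≥ ρ u > 0` at a far away point is not square integrable. -/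
lemma not_integrableOn_of_slope {γ lam ρ x₁ : ℝ} {u v : ℝ → ℝ} (hγ : 1 < γ) (hlam : 0 < lam)
    (hx₁ : 0 < x₁)
    (hρ : 0 < ρ) (hρ₁ : ρ ≤ x₁ ^ γ / 2) (hρ₂ : lam ≤ ρ * (x₁ ^ γ / 2))
    (hu : ∀ x, 0 < x → HasDerivAt u (v x) x)
    (hv : ∀ x, 0 < x → HasDerivAt v (x ^ γ * v x - lam * u x) x)
    (h₁ : 0 < u x₁) (h₂ : ρ * u x₁ ≤ v x₁) :
    ¬ IntegrableOn (fun x => u x ^ 2 * exp (-(x ^ (γ + 1) / (γ + 1)))) (Ioi 0) := by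
  have key : ∀ x, x₁ ≤ x → 0 < u x ∧ ρ * u x ≤ v x := fun x hx =>
    pos_and_slope_of_pos hγ hx₁ hρ hρ₁ hρ₂ hu hv h₁ h₂ hx
  have hmono : MonotoneOn u (Ici x₁) := by
    refine monotoneOn_of_hasDerivAt_nonneg_s12 (convex_Ici _)
      (fun t ht => hu t (hx₁.trans_le ht)) fun t ht => ?_
    obtain ⟨a, b⟩ := key t (interior_subset ht)
    exact (mul_pos hρ a).le.trans b
  set C := lam / ρ with hC
  have hC0 : 0 < C := div_pos hlam hρ
  obtain ⟨x₂, hx₂₁, hx₂one, hx₂C, hx₂ρ⟩ : ∃ x₂, x₁ ≤ x₂ ∧ 1 ≤ x₂ ∧ 4 * (C + 1) ≤ x₂ ∧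
      2 * γ / ρ ≤ x₂ :=
    ⟨x₁ + 1 + 4 * (C + 1) + 2 * γ / ρ, by
      have : 0 < 2 * γ / ρ := by positivity
      refine ⟨?_, ?_, ?_, ?_⟩ <;> linarith⟩
  set q : ℝ → ℝ := fun x => v x - x ^ γ / 2 * u x with hq
  have hqd : ∀ x, 0 < x → HasDerivAt q
      (x ^ γ * v x - lam * u x - (γ * x ^ (γ - 1) / 2 * u x + x ^ γ / 2 * v x)) x := by
    intro x hx
    exact (hv x hx).sub
      (((Real.hasDerivAt_rpow_const (p := γ) (Or.inl hx.ne')).div_const 2).mul (hu x hx))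
  have hq' : ∀ x, x₂ ≤ x →
      ρ * u x₁ ≤ x ^ γ * v x - lam * u x - (γ * x ^ (γ - 1) / 2 * u x + x ^ γ / 2 * v x) := by
    intro x hx
    have hx1 : x₁ ≤ x := hx₂₁.trans hx
    have hx0 : 0 < x := hx₁.trans_le hx1
    obtain ⟨hup, hvp⟩ := key x hx1
    have hv0 : 0 < v x := (mul_pos hρ hup).trans_le hvp
    have hux : u x ≤ v x / ρ := by rw [le_div_iff₀ hρ]; linarith
    have hxg : x ≤ x ^ γ := by
      simpa using rpow_le_rpow_of_exponent_le (hx₂one.trans hx) hγ.le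
    have e1 : lam * u x ≤ C * v x := by
      calc lam * u x ≤ lam * (v x / ρ) := by gcongr
        _ = C * v x := by rw [hC]; ring
    have e2 : γ * x ^ (γ - 1) / 2 * u x ≤ x ^ γ / 4 * v x := by
      have hg : γ / ρ ≤ x / 2 := by
        have := hx₂ρ.trans hx
        rw [mul_div_assoc] at this
        linarith
      calc γ * x ^ (γ - 1) / 2 * u x ≤ γ * x ^ (γ - 1) / 2 * (v x / ρ) := by gcongr
        _ = γ / ρ * (x ^ (γ - 1) / 2 * v x) := by ring
        _ ≤ x / 2 * (x ^ (γ - 1) / 2 * v x) := by gcongr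
        _ = (x ^ (γ - 1) * x) / 4 * v x := by ring
        _ = x ^ γ / 4 * v x := by rw [← rpow_add_one hx0.ne', sub_add_cancel]
    have e3 : 1 ≤ x ^ γ / 4 - C := by linarith
    have e4 : ρ * u x₁ ≤ v x :=
      (mul_le_mul_of_nonneg_left (hmono self_mem_Ici hx1 hx1) hρ.le).trans hvp
    nlinarith
  have hc : 0 < ρ * u x₁ := mul_pos hρ h₁
  have hqlin : MonotoneOn (fun x => q x - ρ * u x₁ * x) (Ici x₂) := by
    refine monotoneOn_of_hasDerivAt_nonneg_s12 (convex_Ici _) (fun t ht =>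
      (hqd t (hx₁.trans_le (hx₂₁.trans ht))).sub ((hasDerivAt_id t).const_mul (ρ * u x₁))) ?_
    intro t ht
    have := hq' t (interior_subset ht)
    linarith
  obtain ⟨x₃, hx₃, hq₃⟩ : ∃ x₃, x₂ ≤ x₃ ∧ ∀ x, x₃ ≤ x → 0 ≤ q x := by
    refine ⟨x₂ + |q x₂| / (ρ * u x₁), by linarith [div_nonneg (abs_nonneg (q x₂)) hc.le], ?_⟩
    intro x hx
    have hx2 : x₂ ≤ x := by linarith [div_nonneg (abs_nonneg (q x₂)) hc.le]
    have h := hqlin self_mem_Ici hx2 hx2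
    have h' : |q x₂| ≤ (x - x₂) * (ρ * u x₁) := by
      rw [← div_le_iff₀ hc]; linarith
    simp only at h
    linarith [neg_abs_le (q x₂)]
  have hx₃₁ : x₁ ≤ x₃ := hx₂₁.trans hx₃
  have hfin : MonotoneOn (fun x => u x ^ 2 * exp (-(x ^ (γ + 1) / (γ + 1)))) (Ici x₃) := by
    refine monotoneOn_of_hasDerivAt_nonneg_s12 (convex_Ici _)
      (f' := fun x => 2 * u x * q x * exp (-(x ^ (γ + 1) / (γ + 1)))) ?_ ?_
    · intro x hx
      have hx0 : 0 < x := hx₁.trans_le (hx₃₁.trans hx)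
      have h := ((hu x hx0).pow 2).mul (hasDerivAt_rpow_add_one_div hγ hx0).neg.exp
      refine h.congr_deriv ?_
      simp only [hq, Pi.pow_apply, Pi.neg_apply]
      ring
    · intro x hx
      have hx3 : x₃ ≤ x := interior_subset hx
      have := hq₃ x hx3
      have := (key x (hx₃₁.trans hx3)).1
      positivity
  intro hint
  refine not_integrableOn_of_le (a := x₃)
    (mul_pos (pow_pos (key x₃ hx₃₁).1 2) (exp_pos (-(x₃ ^ (γ + 1) / (γ + 1)))))
    (fun x hx => hfin self_mem_Ici hx hx)
    (hint.mono_set (Ioi_subset_Ioi (hx₁.le.trans hx₃₁)))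

/-- Square integrable solutions satisfy `(u ^ 2)' ≤ 4 lam x ^ (-γ) u ^ 2` far away. -/
lemma mul_deriv_le {γ lam x : ℝ} {u v : ℝ → ℝ} (hγ : 1 < γ) (hlam : 0 < lam)
    (hu : ∀ x, 0 < x → HasDerivAt u (v x) x)
    (hv : ∀ x, 0 < x → HasDerivAt v (x ^ γ * v x - lam * u x) x)
    (hint : IntegrableOn (fun x => u x ^ 2 * exp (-(x ^ (γ + 1) / (γ + 1)))) (Ioi 0))
    (hx : 4 * lam + 1 ≤ x) :
    u x * v x ≤ 2 * lam * x ^ (-γ) * u x ^ 2 := by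
  have hx0 : 0 < x := by linarith
  have hxg0 : 0 < x ^ γ := rpow_pos_of_pos hx0 γ
  have hxg : x ≤ x ^ γ := by
    simpa using rpow_le_rpow_of_exponent_le (by linarith : 1 ≤ x) hγ.le
  have aux : ∀ u v : ℝ → ℝ, (∀ x, 0 < x → HasDerivAt u (v x) x) →
      (∀ x, 0 < x → HasDerivAt v (x ^ γ * v x - lam * u x) x) →
      IntegrableOn (fun x => u x ^ 2 * exp (-(x ^ (γ + 1) / (γ + 1)))) (Ioi 0) →
      0 < u x → u x * v x ≤ 2 * lam * x ^ (-γ) * u x ^ 2 := by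
    intro u v hu hv hint hpos
    by_contra! hcon
    have hr : 2 * lam * x ^ (-γ) < v x / u x := by
      rw [lt_div_iff₀ hpos]
      nlinarith
    rw [rpow_neg hx0.le, ← div_eq_mul_inv, div_lt_iff₀ hxg0] at hr
    have hr0 : 0 < v x / u x := by
      by_contra! h
      nlinarith
    refine not_integrableOn_of_slope (ρ := min (v x / u x) (x ^ γ / 2)) hγ hlam hx0
      (lt_min hr0 (by positivity)) (min_le_right _ _) ?_ hu hv hpos ?_ hint
    · rcases min_choice (v x / u x) (x ^ γ / 2) with h | h <;> rw [h]
      · linarith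
      · nlinarith
    · rw [← le_div_iff₀ hpos]
      exact min_le_left _ _
  rcases lt_trichotomy (u x) 0 with h | h | h
  · have := aux (fun x => -u x) (fun x => -v x) (fun x hx => (hu x hx).neg)
      (fun x hx => by exact (hv x hx).neg.congr_deriv (by ring)) (by simpa using hint) (by simpa using h)
    simpa using this
  · simp [h]
  · exact aux u v hu hv hint h

/-- Square integrable solutions are bounded on the positive half-line. -/
lemma bounded_on_nonneg {γ lam : ℝ} {u v : ℝ → ℝ} (hγ : 1 < γ) (hlam : 0 < lam)
    (hcont : Continuous u)
    (hu : ∀ x, 0 < x → HasDerivAt u (v x) x)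
    (hv : ∀ x, 0 < x → HasDerivAt v (x ^ γ * v x - lam * u x) x)
    (hint : IntegrableOn (fun x => u x ^ 2 * exp (-(x ^ (γ + 1) / (γ + 1)))) (Ioi 0)) :
    ∃ M, ∀ x, 0 ≤ x → |u x| ≤ M := by
  set X := 4 * lam + 1 with hX
  have hX0 : 0 < X := by positivity
  obtain ⟨M₁, hM₁⟩ := (isCompact_Icc (a := 0) (b := X)).exists_bound_of_continuousOn
    hcont.continuousOn
  set g : ℝ → ℝ := fun x => 4 * lam * (x ^ (1 - γ) / (γ - 1)) with hg
  have hγ1 : 0 < γ - 1 := by linarith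
  have hgd : ∀ x, 0 < x → HasDerivAt g (-(4 * lam * x ^ (-γ))) x := by
    intro x hx
    have h := ((Real.hasDerivAt_rpow_const (x := x) (p := 1 - γ)
      (Or.inl hx.ne')).div_const (γ - 1)).const_mul (4 * lam)
    refine h.congr_deriv ?_
    rw [show 1 - γ - 1 = -γ by ring, show 1 - γ = -(γ - 1) by ring]
    field_simp
  have hanti : MonotoneOn (fun x => -(u x ^ 2 * exp (g x))) (Ici X) := by
    refine monotoneOn_of_hasDerivAt_nonneg_s12 (convex_Ici _)
      (f' := fun x => 2 * (2 * lam * x ^ (-γ) * u x ^ 2 - u x * v x) * exp (g x)) ?_ ?_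
    · intro x hx
      have hx0 : 0 < x := hX0.trans_le hx
      refine (((hu x hx0).pow 2).mul (hgd x hx0).exp).neg.congr_deriv ?_
      simp only [Pi.pow_apply]
      ring
    · intro x hx
      have := sub_nonneg.2 (mul_deriv_le hγ hlam hu hv hint (interior_subset hx))
      positivity
  refine ⟨max M₁ (√(u X ^ 2 * exp (g X))), fun x hx => ?_⟩
  rcases le_total x X with h | h
  · exact (hM₁ x ⟨hx, h⟩).trans (le_max_left _ _)
  · refine le_trans (abs_le_sqrt ?_) (le_max_right _ _)
    have h1 := hanti self_mem_Ici h h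
    have h2 : 1 ≤ exp (g x) := one_le_exp (by positivity)
    have h3 := sq_nonneg (u x)
    simp only at h1
    nlinarith

/-- **Boundedness of eigenfunctions for γ > 1.**  Any twice continuously
differentiable solution of `−u'' + V'·u' = λ·u` on `ℝ` with
`∫ u² e^{−V} < ∞` is bounded on `ℝ`. -/
theorem stmt12 (γ lam : ℝ) (hγ : 1 < γ) (hlam : 0 < lam)
    (u : ℝ → ℝ) (hu : ContDiff ℝ 2 u)
    (hode : ∀ x : ℝ,
      -(deriv (deriv u) x) + Vp γ x * deriv u x = lam * u x)
    (huL2 : Integrable (fun x => (u x) ^ 2 * Real.exp (-(Vpot γ x)))) :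
    ∃ M : ℝ, ∀ x : ℝ, |u x| ≤ M := by
  have hd : ∀ x, HasDerivAt u (deriv u x) x := fun x =>
    (hu.differentiable (by norm_num) x).hasDerivAt
  have hdd : ∀ x, HasDerivAt (deriv u) (Vp γ x * deriv u x - lam * u x) x := by
    intro x
    have h2 : ContDiff ℝ 1 (deriv u) := by
      have : ContDiff ℝ (1 + 1) u := by simpa [one_add_one_eq_two] using hu
      exact (contDiff_succ_iff_deriv.1 this).2.2
    refine (h2.differentiable (by norm_num) x).hasDerivAt.congr_deriv ?_
    linarith [hode x]
  obtain ⟨M₁, hM₁⟩ := bounded_on_nonneg (u := u) (v := deriv u) hγ hlam hu.continuous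
    (fun x _ => hd x)
    (fun x hx => by
      refine (hdd x).congr_deriv ?_
      simp [Vp, Real.sign_of_pos hx, abs_of_pos hx])
    (huL2.integrableOn.congr_fun (fun x hx => by simp [Vpot, abs_of_pos (mem_Ioi.1 hx)])
      measurableSet_Ioi)
  obtain ⟨M₂, hM₂⟩ := bounded_on_nonneg (u := fun x => u (-x)) (v := fun x => -deriv u (-x))
    hγ hlam (hu.continuous.comp continuous_neg)
    (fun x _ => ((hd (-x)).scomp x (hasDerivAt_neg x)).congr_deriv (by simp))
    (fun x hx => by
      refine ((hdd (-x)).scomp x (hasDerivAt_neg x)).neg.congr_deriv ?_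
      simp [Vp, Real.sign_of_neg (neg_neg_of_pos hx), abs_of_pos hx]
      ring)
    (huL2.comp_neg.integrableOn.congr_fun
      (fun x hx => by simp [Vpot, abs_of_pos (mem_Ioi.1 hx)]) measurableSet_Ioi)
  refine ⟨max M₁ M₂, fun x => ?_⟩
  rcases le_total 0 x with h | h
  · exact (hM₁ x h).trans (le_max_left _ _)
  · have := hM₂ (-x) (neg_nonneg.2 h)
    rw [neg_neg] at this
    exact this.trans (le_max_right _ _)
end

section
/- Let γ∈(1/3,1), V(x)=|x|^{γ+1}/(γ+1), x₀≠0, δ(ε)=ε^{(1−γ)/(1+γ)}, n ≥ 1 an integer, and w_ε := ε^{(1−γ)/(1+γ)}. Suppose 0 < λ₁ < λ₂ < … < λ_n are reals and ψ₁,…,ψ_n:ℝ→ℝ are twice continuously differentiable functions, none identically zero, with −ψ_k'' + V'ψ_k' = λ_k ψ_k on ℝ and ∫_ℝ ψ_k(x)² e^{−V(x)} dx < ∞ for each k. For ε∈(0,1] set λ_{k,ε} := λ_k·ε^{(γ−1)/(γ+1)}, ψ_{k,ε}(x) := ψ_k(x·ε^{−1/(1+γ)}), c_{k,ε} := (1/(2δ(ε)))·∫_{x₀−δ(ε)}^{x₀+δ(ε)}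 ψ_{k,ε}(x) dx, and d_{n,ε}(t) := ( Σ_{k=1}^{n} e^{−2λ_{k,ε} t}·c_{k,ε}² )^{1/2}. Then for all sufficiently small ε one has |c_{1,ε}| > 1, so that t_ε := λ_{1,ε}^{−1}·log|c_{1,ε}| is well-defined and positive (equivalently d_{1,ε}(t_ε)=1), and the truncated distance exhibits window cut-off at time t_ε with window w_ε: for every r∈ℝ, the quantities 𝔭₊(r) := limsup_{ε→0} d_{n,ε}(t_ε + r·w_ε) and 𝔭₋(r) := liminf_{ε→0} d_{n,ε}(t_ε + r·w_ε) satisfy 0 < 𝔭₋(r) ≤ 𝔭₊(r) < ∞, 𝔭₋(r) → ∞ as r → −∞, and 𝔭₊(r) → 0 as r → +∞. -/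
open Real Filter MeasureTheory

/-- The spatial scale `δ(ε) = ε^{(1−γ)/(1+γ)}` (also the time window `w_ε`). -/
noncomputable def delta (γ ε : ℝ) : ℝ := ε ^ ((1 - γ) / (1 + γ))

/-- The Fourier coefficient `c_{k,ε} = (1/(2δ(ε)))·∫_{x₀−δ(ε)}^{x₀+δ(ε)}
ψ(x·ε^{−1/(1+γ)}) dx` of the uniform density on `B_{δ(ε)}(x₀)` against the
rescaled eigenfunction `ψ_{k,ε}(x) = ψ_k(x·ε^{−1/(1+γ)})`. -/
noncomputable def fCoeff (γ x₀ : ℝ) (ψ : ℝ → ℝ) (ε : ℝ) : ℝ :=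
  (1 / (2 * delta γ ε)) *
    ∫ x in (x₀ - delta γ ε)..(x₀ + delta γ ε), ψ (x * ε ^ (-(1 : ℝ) / (1 + γ)))

/-- The truncated χ²-distance
`d_{n,ε}(t) = (Σ_{k=1}^n e^{−2λ_{k,ε}t}·c_{k,ε}²)^{1/2}` with
`λ_{k,ε} = λ_k·ε^{(γ−1)/(γ+1)}`. -/
noncomputable def truncDist (γ : ℝ) (n : ℕ) (lam : ℕ → ℝ) (ψ : ℕ → ℝ → ℝ)
    (x₀ ε t : ℝ) : ℝ :=
  Real.sqrt (∑ k ∈ Finset.Icc 1 n,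
    Real.exp (-2 * (lam k * ε ^ ((γ - 1) / (γ + 1))) * t)
      * (fCoeff γ x₀ (ψ k) ε) ^ 2)

/-- The cut-off time `t_ε = λ_{1,ε}^{−1}·log |c_{1,ε}|` built from the mode
with eigenvalue `lam`. -/
noncomputable def cutoffTime (γ lam x₀ : ℝ) (ψ : ℝ → ℝ) (ε : ℝ) : ℝ :=
  (lam * ε ^ ((γ - 1) / (γ + 1)))⁻¹ * Real.log |fCoeff γ x₀ ψ ε|

lemma le_of_hasDerivAt_nonneg {f f' : ℝ → ℝ} {a : ℝ}
    (hf : ∀ x, a ≤ x → HasDerivAt f (f' x) x) (hf' : ∀ x, a ≤ x → 0 ≤ f' x) :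
    ∀ x, a ≤ x → f a ≤ f x := by
  intro x hx
  have : MonotoneOn f (Set.Ici a) := by
    refine monotoneOn_of_hasDerivWithinAt_nonneg (f' := f') (convex_Ici a) ?_ ?_ ?_
    · exact fun y hy => (hf y hy).continuousAt.continuousWithinAt
    · intro y hy
      rw [interior_Ici] at hy
      exact (hf y (le_of_lt hy)).hasDerivWithinAt
    · intro y hy
      rw [interior_Ici] at hy
      exact hf' y (le_of_lt hy)
  exact this (Set.mem_Ici.2 le_rfl) hx hx

lemma ge_of_hasDerivAt_nonpos {f f' : ℝ → ℝ} {a : ℝ}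
    (hf : ∀ x, a ≤ x → HasDerivAt f (f' x) x) (hf' : ∀ x, a ≤ x → f' x ≤ 0) :
    ∀ x, a ≤ x → f x ≤ f a := by
  intro x hx
  have := le_of_hasDerivAt_nonneg (f := fun x => -f x) (fun y hy => (hf y hy).neg)
    (fun y hy => neg_nonneg.2 (hf' y hy)) x hx
  linarith

/-- In the system `φ' = w G²`, `w' = φ E` with `E ≥ 0`, a solution starting with `φ w ≥ 0`
and `w ≠ 0` grows at least like a multiple of `G`, so `φ / G` is not square integrable. -/
lemma eq_zero_of_growing_system {φ w G G' E : ℝ → ℝ} {X x₁ : ℝ} (hx₁ : X ≤ x₁)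
    (hφ : ∀ x, X ≤ x → HasDerivAt φ (w x * G x ^ 2) x)
    (hw : ∀ x, X ≤ x → HasDerivAt w (φ x * E x) x)
    (hE : ∀ x, X ≤ x → 0 ≤ E x)
    (hG : ∀ x, X ≤ x → HasDerivAt G (G' x) x)
    (hG'0 : ∀ x, X ≤ x → 0 ≤ G' x) (hG' : ∀ x, X ≤ x → G' x ≤ G x ^ 2)
    (hGtop : Tendsto G atTop atTop)
    (hint : IntegrableOn (fun x => φ x ^ 2 / G x ^ 2) (Set.Ioi X))
    (h0 : 0 ≤ φ x₁ * w x₁) : w x₁ = 0 := by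
  by_contra hne
  have hc : 0 < w x₁ ^ 2 := by positivity
  set c := w x₁ ^ 2 with hcdef
  have hp : ∀ x, x₁ ≤ x → 0 ≤ φ x * w x := by
    intro x hx
    refine h0.trans (le_of_hasDerivAt_nonneg (f := fun x => φ x * w x)
      (fun y hy => (hφ y (hx₁.trans hy)).mul (hw y (hx₁.trans hy))) ?_ x hx)
    intro y hy
    have := hE y (hx₁.trans hy)
    have : 0 ≤ (w y * G y) ^ 2 + φ y ^ 2 * E y := by positivity
    linarith
  have hw2 : ∀ x, x₁ ≤ x → c ≤ w x ^ 2 := by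
    intro x hx
    refine le_of_hasDerivAt_nonneg (f := fun x => w x ^ 2)
      (fun y hy => (hw y (hx₁.trans hy)).pow 2) ?_ x hx
    intro y hy
    have := mul_nonneg (hp y hy) (hE y (hx₁.trans hy))
    simp
    linarith
  have hp2 : ∀ x, x₁ ≤ x → c * (G x - G x₁) ≤ φ x * w x := by
    intro x hx
    have := le_of_hasDerivAt_nonneg (f := fun x => φ x * w x - c * (G x - G x₁))
      (fun y hy => ((hφ y (hx₁.trans hy)).mul (hw y (hx₁.trans hy))).sub
        (((hG y (hx₁.trans hy)).sub_const (G x₁)).const_mul c)) ?_ x hx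
    · simp only [sub_self, mul_zero, sub_zero] at this
      linarith
    intro y hy
    have h1 := hE y (hx₁.trans hy)
    have h2 : c * G' y ≤ w y ^ 2 * G y ^ 2 :=
      mul_le_mul (hw2 y hy) (hG' y (hx₁.trans hy)) (hG'0 y (hx₁.trans hy)) (by positivity)
    have : 0 ≤ φ y ^ 2 * E y := by positivity
    linarith
  have hGm : ∀ x, x₁ ≤ x → G x₁ ≤ G x :=
    le_of_hasDerivAt_nonneg (fun y hy => hG y (hx₁.trans hy)) (fun y hy => hG'0 y (hx₁.trans hy))
  have hφ2 : ∀ x, x₁ ≤ x → c * (G x - G x₁) ^ 2 ≤ φ x ^ 2 := by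
    intro x hx
    have := le_of_hasDerivAt_nonneg (f := fun x => φ x ^ 2 - c * (G x - G x₁) ^ 2)
      (fun y hy => ((hφ y (hx₁.trans hy)).pow 2).sub
        ((((hG y (hx₁.trans hy)).sub_const (G x₁)).pow 2).const_mul c)) ?_ x hx
    · simp only [sub_self] at this
      nlinarith [sq_nonneg (φ x₁)]
    intro y hy
    have h1 : c * (G y - G x₁) * G' y ≤ φ y * w y * G y ^ 2 :=
      mul_le_mul (hp2 y hy) (hG' y (hx₁.trans hy)) (hG'0 y (hx₁.trans hy)) (hp y hy)
    simp
    linarith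
  obtain ⟨Y, hY⟩ := eventually_atTop.1 (hGtop.eventually_ge_atTop (2 * |G x₁| + 1))
  set Z := max Y x₁
  have hlow : ∀ x ∈ Set.Ioi Z, c / 4 ≤ φ x ^ 2 / G x ^ 2 := by
    intro x hx
    have hxZ : Z < x := hx
    have hx1 : x₁ ≤ x := (le_max_right _ _).trans hxZ.le
    have hg := hY x ((le_max_left _ _).trans hxZ.le)
    have habs := abs_nonneg (G x₁)
    have hGpos : 0 < G x := by linarith
    rw [le_div_iff₀ (by positivity)]
    have hhalf : G x / 2 ≤ G x - G x₁ := by linarith [le_abs_self (G x₁)]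
    have hsq : (G x / 2) ^ 2 ≤ (G x - G x₁) ^ 2 := by gcongr
    nlinarith [hφ2 x hx1, mul_le_mul_of_nonneg_left hsq hc.le]
  have hint2 : IntegrableOn (fun _ : ℝ => c / 4) (Set.Ioi Z) := by
    refine Integrable.mono' (hint.mono_set ?_) (by fun_prop) ?_
    · exact Set.Ioi_subset_Ioi (hx₁.trans (le_max_right _ _))
    · filter_upwards [ae_restrict_mem measurableSet_Ioi] with x hx
      rw [Real.norm_of_nonneg (by positivity)]
      exact hlow x hx
  rw [integrableOn_const_iff] at hint2
  simp [hc.ne'] at hint2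

/-- In the system `φ' = w G²`, `w' = -φ E` with `E ≥ 0` and `G ≥ 1`, a component `φ` that stays
positive forces `w ≥ 0`. -/
lemma nonneg_of_pos_system {φ w G E : ℝ → ℝ} {X x₁ : ℝ} (hx₁ : X ≤ x₁)
    (hφ : ∀ x, X ≤ x → HasDerivAt φ (w x * G x ^ 2) x)
    (hw : ∀ x, X ≤ x → HasDerivAt w (-(φ x * E x)) x)
    (hE : ∀ x, X ≤ x → 0 ≤ E x)
    (hG1 : ∀ x, X ≤ x → 1 ≤ G x)
    (hpos : ∀ x, X ≤ x → 0 < φ x) : 0 ≤ w x₁ := by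
  by_contra! hneg
  have hwle : ∀ x, x₁ ≤ x → w x ≤ w x₁ :=
    ge_of_hasDerivAt_nonpos (fun y hy => hw y (hx₁.trans hy)) fun y hy => by
      have := mul_nonneg (hpos y (hx₁.trans hy)).le (hE y (hx₁.trans hy))
      linarith
  have hφle : ∀ x, x₁ ≤ x → φ x - w x₁ * x ≤ φ x₁ - w x₁ * x₁ :=
    ge_of_hasDerivAt_nonpos (fun y hy => (hφ y (hx₁.trans hy)).sub ((hasDerivAt_id y).const_mul (w x₁)))
      fun y hy => by
        have h1 := hwle y hy
        have h2 := hG1 y (hx₁.trans hy)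
        have h3 : 1 ≤ G y ^ 2 := one_le_pow₀ h2
        nlinarith
  have hx2 : x₁ ≤ x₁ + φ x₁ / (-w x₁) := by
    have := div_pos (hpos x₁ hx₁) (neg_pos.2 hneg)
    linarith
  have h1 := hφle _ hx2
  have h2 := hpos _ (hx₁.trans hx2)
  have h3 : w x₁ * (φ x₁ / (-w x₁)) = -φ x₁ := by
    field_simp [hneg.ne]
  nlinarith

/-- `ψ` is a nonzero `C²` solution of `-ψ'' + V' ψ' = lam ψ` in `L²(e^{-V})`. -/
structure IsEigenfun (γ lam : ℝ) (ψ : ℝ → ℝ) : Prop where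
  smooth : ContDiff ℝ 2 ψ
  ne_zero : ∃ x, ψ x ≠ 0
  ode : ∀ x : ℝ, -(deriv (deriv ψ) x) + Vp γ x * deriv ψ x = lam * ψ x
  sq_int : Integrable (fun x => (ψ x) ^ 2 * Real.exp (-(Vpot γ x)))

namespace IsEigenfun

variable {γ lam : ℝ} {ψ : ℝ → ℝ}

lemma hasDerivAt (h : IsEigenfun γ lam ψ) (x : ℝ) : HasDerivAt ψ (deriv ψ x) x :=
  (h.smooth.differentiable (by norm_num) x).hasDerivAt

lemma hasDerivAt_deriv (h : IsEigenfun γ lam ψ) (x : ℝ) :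
    HasDerivAt (deriv ψ) (Vp γ x * deriv ψ x - lam * ψ x) x := by
  have h1 : ContDiff ℝ 1 (deriv ψ) := by
    have := h.smooth
    rw [show (2 : WithTop ℕ∞) = 1 + 1 by norm_num, contDiff_succ_iff_deriv] at this
    exact this.2.2
  have h2 := (h1.differentiable (by norm_num) x).hasDerivAt
  have h3 := h.ode x
  rwa [show deriv (deriv ψ) x = Vp γ x * deriv ψ x - lam * ψ x by linarith] at h2

lemma neg (h : IsEigenfun γ lam ψ) : IsEigenfun γ lam (fun x => -ψ x) := by
  have hd : deriv (fun x => -ψ x) = fun x => -deriv ψ x := by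
    ext x; exact (h.hasDerivAt x).neg.deriv
  refine ⟨h.smooth.neg, ?_, fun x => ?_, ?_⟩
  · obtain ⟨x, hx⟩ := h.ne_zero
    exact ⟨x, neg_ne_zero.2 hx⟩
  · rw [hd, show deriv (fun x => -deriv ψ x) x = _ from (h.hasDerivAt_deriv x).neg.deriv]
    ring
  · simpa using h.sq_int

lemma comp_neg (h : IsEigenfun γ lam ψ) : IsEigenfun γ lam (fun x => ψ (-x)) := by
  have hd : deriv (fun x => ψ (-x)) = fun x => -deriv ψ (-x) := by
    ext x; exact deriv_comp_neg ψ x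
  refine ⟨h.smooth.comp contDiff_neg, ?_, fun x => ?_, ?_⟩
  · obtain ⟨x, hx⟩ := h.ne_zero
    exact ⟨-x, by simpa using hx⟩
  · have h2 : deriv (fun x => -deriv ψ (-x)) x = deriv (deriv ψ) (-x) := by
      rw [deriv.fun_neg, deriv_comp_neg, neg_neg]
    have h3 := h.ode (-x)
    have h4 : Vp γ (-x) = -Vp γ x := by simp [Vp, Real.sign_neg]
    rw [hd, h2]
    rw [h4] at h3
    linarith
  · have := h.sq_int.comp_neg
    simpa [Vpot] using this

/-- A solution with vanishing Cauchy data at a point vanishes to its right. -/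
lemma eq_zero_right (h : IsEigenfun γ lam ψ) (hγ : 0 < γ) {a : ℝ} (h0 : ψ a = 0)
    (h1 : deriv ψ a = 0) (b : ℝ) (hab : a ≤ b) : ψ b = 0 := by
  set R := max |a| |b|
  set K := 1 + |lam| + 2 * R ^ γ with hK
  have hR0 : 0 ≤ R := (abs_nonneg a).trans (le_max_left _ _)
  have hmono : AntitoneOn (fun x => (ψ x ^ 2 + deriv ψ x ^ 2) * Real.exp (-K * x))
      (Set.Icc a b) := by
    have hd : ∀ x, HasDerivAt (fun x => (ψ x ^ 2 + deriv ψ x ^ 2) * Real.exp (-K * x))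
        ((2 * ψ x * deriv ψ x + 2 * deriv ψ x * (Vp γ x * deriv ψ x - lam * ψ x)
          - K * (ψ x ^ 2 + deriv ψ x ^ 2)) * Real.exp (-K * x)) x := by
      intro x
      have := (((h.hasDerivAt x).pow 2).add ((h.hasDerivAt_deriv x).pow 2)).mul
        (((hasDerivAt_id x).const_mul (-K)).exp)
      refine this.congr_deriv ?_
      simp
      ring
    refine antitoneOn_of_hasDerivWithinAt_nonpos (convex_Icc a b)
      (fun x _ => (hd x).continuousAt.continuousWithinAt)
      (fun x _ => (hd x).hasDerivWithinAt) fun x hx => ?_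
    rw [interior_Icc] at hx
    refine mul_nonpos_of_nonpos_of_nonneg ?_ (Real.exp_pos _).le
    have hxR : |x| ≤ R := abs_le_max_abs_abs hx.1.le hx.2.le
    have hV : Vp γ x ≤ R ^ γ := by
      have h2 : |x| ^ γ ≤ R ^ γ := Real.rpow_le_rpow (abs_nonneg _) hxR hγ.le
      have h3 : 0 ≤ |x| ^ γ := by positivity
      have h4 : Real.sign x ≤ 1 := by
        rcases Real.sign_apply_eq x with h | h | h <;> rw [h] <;> norm_num
      unfold Vp
      nlinarith
    have hR' : 0 ≤ R ^ γ := by positivity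
    have e1 : deriv ψ x ^ 2 * Vp γ x ≤ deriv ψ x ^ 2 * R ^ γ :=
      mul_le_mul_of_nonneg_left hV (sq_nonneg _)
    have e2 : 2 * ψ x * deriv ψ x ≤ ψ x ^ 2 + deriv ψ x ^ 2 := two_mul_le_add_sq _ _
    have e3 : -(lam * (2 * ψ x * deriv ψ x)) ≤ |lam| * (ψ x ^ 2 + deriv ψ x ^ 2) := by
      have e4 : |2 * ψ x * deriv ψ x| ≤ ψ x ^ 2 + deriv ψ x ^ 2 :=
        abs_le.2 ⟨by nlinarith [sq_nonneg (ψ x + deriv ψ x)], e2⟩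
      calc -(lam * (2 * ψ x * deriv ψ x)) ≤ |lam * (2 * ψ x * deriv ψ x)| := neg_le_abs _
        _ = |lam| * |2 * ψ x * deriv ψ x| := abs_mul _ _
        _ ≤ _ := by gcongr
    have e5 : 0 ≤ 2 * R ^ γ * ψ x ^ 2 := by positivity
    rw [hK]
    nlinarith
  have := hmono (Set.left_mem_Icc.2 hab) (Set.right_mem_Icc.2 hab) hab
  simp only [h0, h1] at this
  have h2 : ψ b ^ 2 + deriv ψ b ^ 2 ≤ 0 := by
    by_contra! hc
    have := mul_pos hc (Real.exp_pos (-K * b))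
    norm_num at *
    linarith
  have h3 : ψ b ^ 2 = 0 := by nlinarith [sq_nonneg (ψ b), sq_nonneg (deriv ψ b)]
  exact pow_eq_zero_iff (two_ne_zero) |>.1 h3

lemma deriv_ne_zero_of_eq_zero (h : IsEigenfun γ lam ψ) (hγ : 0 < γ) {a : ℝ} (h0 : ψ a = 0) :
    deriv ψ a ≠ 0 := by
  intro h1
  obtain ⟨b, hb⟩ := h.ne_zero
  rcases le_total a b with hab | hab
  · exact hb (h.eq_zero_right hγ h0 h1 b hab)
  · have := h.comp_neg.eq_zero_right hγ (a := -a) (by simpa using h0)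
      (by rw [deriv_comp_neg]; simpa using h1) (-b) (by linarith)
    exact hb (by simpa using this)

end IsEigenfun

namespace IsEigenfun

variable {γ lam : ℝ} {ψ : ℝ → ℝ}

lemma Vp_of_pos (γ : ℝ) {x : ℝ} (hx : 0 < x) : Vp γ x = x ^ γ := by
  simp [Vp, Real.sign_of_pos hx, abs_of_pos hx]

lemma Vpot_hasDerivAt (hγ : 0 < γ) {x : ℝ} (hx : 0 < x) : HasDerivAt (Vpot γ) (Vp γ x) x := by
  have h1 : HasDerivAt (fun x : ℝ => x ^ (γ + 1) / (γ + 1)) (Vp γ x) x := by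
    refine ((Real.hasDerivAt_rpow_const (p := γ + 1) (Or.inl hx.ne')).div_const _).congr_deriv ?_
    rw [Vp_of_pos γ hx, add_sub_cancel_right]
    field_simp
  refine h1.congr_of_eventuallyEq ?_
  filter_upwards [lt_mem_nhds hx] with y hy
  simp [Vpot, abs_of_pos hy]

/-- First equation of the first-order system for `ψ e^{-B}` and `(ψ' - b ψ) e^{B - V}`, `b = B'`. -/
lemma hasDerivAt_fst (h : IsEigenfun γ lam ψ) {B b : ℝ → ℝ} {x : ℝ}
    (hB : HasDerivAt B (b x) x) :
    HasDerivAt (fun x => ψ x * Real.exp (-B x))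
      ((deriv ψ x - b x * ψ x) * Real.exp (B x - Vpot γ x)
        * Real.exp (Vpot γ x / 2 - B x) ^ 2) x := by
  refine ((h.hasDerivAt x).mul hB.neg.exp).congr_deriv ?_
  have : Real.exp (B x - Vpot γ x) * Real.exp (Vpot γ x / 2 - B x) ^ 2 = Real.exp (-B x) := by
    rw [← Real.exp_nat_mul, ← Real.exp_add]
    congr 1
    push_cast
    ring
  rw [mul_assoc, this]
  simp only [Pi.neg_apply]
  ring

/-- Second equation of the first-order system for `ψ e^{-B}` and `(ψ' - b ψ) e^{B - V}`. -/
lemma hasDerivAt_snd (h : IsEigenfun γ lam ψ) (hγ : 0 < γ) {B b : ℝ → ℝ} {b' x : ℝ} (hx : 0 < x)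
    (hB : HasDerivAt B (b x) x) (hb : HasDerivAt b b' x) :
    HasDerivAt (fun x => (deriv ψ x - b x * ψ x) * Real.exp (B x - Vpot γ x))
      (ψ x * Real.exp (-B x)
        * ((b x * Vp γ x - b x ^ 2 - b' - lam) * Real.exp (2 * B x - Vpot γ x))) x := by
  refine (((h.hasDerivAt_deriv x).sub (hb.mul (h.hasDerivAt x))).mul
    (hB.sub (Vpot_hasDerivAt hγ hx)).exp).congr_deriv ?_
  have : Real.exp (B x - Vpot γ x) = Real.exp (-B x) * Real.exp (2 * B x - Vpot γ x) := by
    rw [← Real.exp_add]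
    congr 1
    ring
  simp only [Pi.sub_apply, Pi.mul_apply]
  rw [this]
  ring

lemma hasDerivAt_exp_half {B b : ℝ → ℝ} {x : ℝ} (hγ : 0 < γ) (hx : 0 < x)
    (hB : HasDerivAt B (b x) x) :
    HasDerivAt (fun x => Real.exp (Vpot γ x / 2 - B x))
      ((Vp γ x / 2 - b x) * Real.exp (Vpot γ x / 2 - B x)) x := by
  refine (((Vpot_hasDerivAt hγ hx).div_const 2).sub hB).exp.congr_deriv ?_
  simp only [Pi.sub_apply]
  ring

lemma sq_div_sq_eq (B : ℝ → ℝ) (x : ℝ) :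
    (ψ x * Real.exp (-B x)) ^ 2 / Real.exp (Vpot γ x / 2 - B x) ^ 2
      = ψ x ^ 2 * Real.exp (-(Vpot γ x)) := by
  rw [div_eq_iff (by positivity), mul_pow, mul_assoc]
  congr 1
  rw [← Real.exp_nat_mul, ← Real.exp_nat_mul, ← Real.exp_add]
  congr 1
  push_cast
  ring

/-- The leading part of `log ψ` at infinity. -/
noncomputable def slowExp (γ lam x : ℝ) : ℝ := lam * x ^ (1 - γ) / (1 - γ)

lemma slowExp_hasDerivAt (hγ : γ < 1) {x : ℝ} (hx : 0 < x) :
    HasDerivAt (slowExp γ lam) (lam * x ^ (-γ)) x := by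
  have := ((Real.hasDerivAt_rpow_const (p := 1 - γ) (Or.inl hx.ne')).const_mul lam).div_const
    (1 - γ)
  refine this.congr_deriv ?_
  have h1 : 1 - γ ≠ 0 := by linarith
  rw [show 1 - γ - 1 = -γ by ring]
  field_simp

/-- For large `x`, the potential dominates the slow exponent. -/
lemma eventually_slowExp_le (hγ : γ ∈ Set.Ioo (1 / 3 : ℝ) 1) (hlam : 0 < lam) :
    ∀ᶠ x : ℝ in atTop, x + Vp γ x / 2 ≤ Vpot γ x / 2 - slowExp γ lam x := by
  obtain ⟨h3, h1⟩ := hγ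
  set C := lam / (1 - γ) with hC
  have hC0 : 0 < C := div_pos hlam (by linarith)
  filter_upwards [eventually_ge_atTop 1,
    (tendsto_rpow_atTop (show 0 < γ by linarith)).eventually_ge_atTop
      (2 * (γ + 1) * (C + 3 / 2))] with x hx hT
  have hx0 : 0 < x := by linarith
  have e1 : x ^ (1 - γ) ≤ x := by
    simpa using Real.rpow_le_rpow_of_exponent_le hx (show 1 - γ ≤ 1 by linarith)
  have e2 : x ^ γ ≤ x := by
    simpa using Real.rpow_le_rpow_of_exponent_le hx h1.le
  have e3 : Vpot γ x = x ^ γ * x / (γ + 1) := by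
    rw [Vpot, abs_of_pos hx0, Real.rpow_add_one hx0.ne']
  have e4 : slowExp γ lam x = C * x ^ (1 - γ) := by
    rw [slowExp, hC]; ring
  have e5 : (C + 3 / 2) * x ≤ Vpot γ x / 2 := by
    rw [e3, div_div, le_div_iff₀ (by linarith)]
    nlinarith
  rw [e4, Vp_of_pos γ hx0]
  nlinarith

/-- The eigenfunction is nonzero and at most of order `exp (slowExp)` near `+∞`. -/
lemma eventually_le (h : IsEigenfun γ lam ψ) (hγ : γ ∈ Set.Ioo (1 / 3 : ℝ) 1) (hlam : 0 < lam) :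
    ∃ X M : ℝ, 0 < M ∧ ∀ x, X ≤ x → ψ x ≠ 0 ∧ |ψ x| ≤ M * Real.exp (slowExp γ lam x) := by
  have hγ0 : 0 < γ := by linarith [hγ.1]
  have h1γ : 0 < 1 - γ := by linarith [hγ.2]
  set K := (lam + 1) ^ 2 with hK
  have hK0 : 0 < K := by positivity
  set b : ℝ → ℝ := fun x => lam * x ^ (-γ) + K * x ^ (-(3 * γ)) with hb
  set b' : ℝ → ℝ := fun x =>
    lam * (-γ * x ^ (-γ - 1)) + K * (-(3 * γ) * x ^ (-(3 * γ) - 1)) with hb'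
  set B : ℝ → ℝ := fun x => slowExp γ lam x + K * x ^ (1 - 3 * γ) / (1 - 3 * γ) with hBdef
  have hB : ∀ x, 0 < x → HasDerivAt B (b x) x := by
    intro x hx
    have := (slowExp_hasDerivAt (lam := lam) hγ.2 hx).add
      (((Real.hasDerivAt_rpow_const (p := 1 - 3 * γ) (Or.inl hx.ne')).const_mul K).div_const
        (1 - 3 * γ))
    refine this.congr_deriv ?_
    have h1 : 1 - 3 * γ ≠ 0 := by linarith [hγ.1]
    rw [show 1 - 3 * γ - 1 = -(3 * γ) by ring]
    rw [mul_left_comm, mul_div_cancel_left₀ _ h1]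
  have hbd : ∀ x, 0 < x → HasDerivAt b (b' x) x := fun x hx =>
    ((Real.hasDerivAt_rpow_const (Or.inl hx.ne')).const_mul lam).add
      ((Real.hasDerivAt_rpow_const (Or.inl hx.ne')).const_mul K)
  have hBle : ∀ x, 0 < x → B x ≤ slowExp γ lam x := by
    intro x hx
    have : K * x ^ (1 - 3 * γ) / (1 - 3 * γ) ≤ 0 :=
      div_nonpos_of_nonneg_of_nonpos (by positivity) (by linarith [hγ.1])
    simp only [hBdef]
    linarith
  obtain ⟨X, hX⟩ := eventually_atTop.1 ((eventually_slowExp_le hγ hlam).and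
    ((eventually_ge_atTop (1 : ℝ)).and
      ((tendsto_rpow_atTop hγ0).eventually_ge_atTop (2 * (lam + K) + 1))))
  have hpos : ∀ x, X ≤ x → 0 < x := fun x hx => by linarith [(hX x hx).2.1]
  have hineq : ∀ x, X ≤ x → 0 ≤ b x * Vp γ x - b x ^ 2 - b' x - lam ∧ b x ≤ Vp γ x / 2 := by
    intro x hx
    obtain ⟨-, hx1, hT⟩ := hX x hx
    have hx0 := hpos x hx
    set y := x ^ γ with hy
    have hy1 : 1 ≤ y := by linarith
    have hy0 : 0 < y := by linarith
    have e1 : x ^ (-γ) = y⁻¹ := Real.rpow_neg hx0.le γ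
    have e2 : x ^ (-(3 * γ)) = y⁻¹ ^ 3 := by
      rw [Real.rpow_neg hx0.le, mul_comm, Real.rpow_mul hx0.le, inv_pow, ← hy]
      norm_cast
    have hz0 : 0 < y⁻¹ := inv_pos.2 hy0
    have hz1 : y⁻¹ ≤ 1 := inv_le_one_of_one_le₀ hy1
    have hzy : y⁻¹ * y = 1 := inv_mul_cancel₀ hy0.ne'
    set z := y⁻¹
    have hb'0 : b' x ≤ 0 := by
      have p1 : 0 < lam * (γ * x ^ (-γ - 1)) := by positivity
      have p2 : 0 < K * (3 * γ * x ^ (-(3 * γ) - 1)) := by positivity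
      simp only [hb']
      linarith
    have hbx : b x = lam * z + K * z ^ 3 := by simp only [hb, e1, e2]
    rw [Vp_of_pos γ hx0, ← hy]
    have hKz : K * z ^ 2 ≤ 1 := by
      have : K * z ≤ 1 := by nlinarith
      nlinarith
    constructor
    · have q1 : b x * y = lam + K * z ^ 2 := by
        rw [hbx]
        linear_combination (lam + K * z ^ 2) * hzy
      have q2 : b x ^ 2 = z ^ 2 * (lam + K * z ^ 2) ^ 2 := by rw [hbx]; ring
      have q3 : (lam + K * z ^ 2) ^ 2 ≤ K := by
        rw [hK]
        have : 0 ≤ K * z ^ 2 := by positivity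
        gcongr
      have := mul_le_mul_of_nonneg_left q3 (sq_nonneg z)
      rw [q1, q2]
      linarith
    · have q1 : z ^ 3 ≤ 1 := pow_le_one₀ hz0.le hz1
      rw [hbx]
      nlinarith
  set φ : ℝ → ℝ := fun x => ψ x * Real.exp (-B x) with hφ
  set w : ℝ → ℝ := fun x => (deriv ψ x - b x * ψ x) * Real.exp (B x - Vpot γ x) with hw
  have hGge : ∀ x, X ≤ x → x + Vp γ x / 2 ≤ Vpot γ x / 2 - B x := fun x hx => by
    linarith [(hX x hx).1, hBle x (hpos x hx)]
  have hVp : ∀ x, X ≤ x → 0 < Vp γ x := fun x hx => by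
    rw [Vp_of_pos γ (hpos x hx)]
    exact Real.rpow_pos_of_pos (hpos x hx) _
  have hbpos : ∀ x, X ≤ x → 0 < b x := fun x hx => by
    have := hpos x hx
    simp only [hb]
    positivity
  have key : ∀ x, X ≤ x → 0 ≤ φ x * w x → w x = 0 := by
    intro x hx
    refine eq_zero_of_growing_system (G := fun x => Real.exp (Vpot γ x / 2 - B x)) hx
      (fun y hy => h.hasDerivAt_fst (hB y (hpos y hy)))
      (fun y hy => h.hasDerivAt_snd hγ0 (hpos y hy) (hB y (hpos y hy)) (hbd y (hpos y hy)))
      (fun y hy => mul_nonneg (hineq y hy).1 (Real.exp_pos _).le)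
      (fun y hy => hasDerivAt_exp_half hγ0 (hpos y hy) (hB y (hpos y hy)))
      (fun y hy => mul_nonneg (by linarith [(hineq y hy).2]) (Real.exp_pos _).le)
      (fun y hy => ?_) ?_ ?_
    · rw [sq]
      refine mul_le_mul_of_nonneg_right ?_ (Real.exp_pos _).le
      have := Real.add_one_le_exp (Vpot γ y / 2 - B y)
      linarith [hGge y hy, hbpos y hy, hpos y hy]
    · refine Real.tendsto_exp_atTop.comp (tendsto_atTop_mono' _ ?_ tendsto_id)
      filter_upwards [eventually_ge_atTop X] with y hy
      simp only [id]
      linarith [hGge y hy, hVp y hy]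
    · simp only [hφ, sq_div_sq_eq]
      exact h.sq_int.integrableOn
  have hne : ∀ x, X ≤ x → ψ x ≠ 0 := by
    intro x hx h0
    have hw0 := key x hx (by simp [hφ, h0])
    simp only [hw, h0, mul_zero, sub_zero, mul_eq_zero, Real.exp_ne_zero, or_false] at hw0
    exact h.deriv_ne_zero_of_eq_zero hγ0 h0 hw0
  have hanti := ge_of_hasDerivAt_nonpos (a := X) (f := fun x => φ x ^ 2)
    (fun y hy => (h.hasDerivAt_fst (hB y (hpos y hy))).pow 2) fun y hy => by
      have : φ y * w y ≤ 0 := by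
        by_contra! hc
        have := key y hy hc.le
        simp [this] at hc
      have h2 : 0 ≤ Real.exp (Vpot γ y / 2 - B y) ^ 2 := by positivity
      have := mul_nonpos_of_nonpos_of_nonneg this h2
      simp only [hφ, hw] at this
      norm_num
      linarith
  refine ⟨X, |φ X|, abs_pos.2 (mul_ne_zero (hne X le_rfl) (Real.exp_ne_zero _)), fun x hx =>
    ⟨hne x hx, ?_⟩⟩
  have h1 : |φ x| ≤ |φ X| := sq_le_sq.1 (hanti x hx)
  have h2 : |ψ x| = |φ x| * Real.exp (B x) := by
    simp only [hφ, abs_mul, Real.abs_exp, mul_assoc, ← Real.exp_add]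
    simp
  rw [h2]
  gcongr
  exact hBle x (hpos x hx)

/-- A positive eigenfunction is at least of order `exp (slowExp)` near `+∞`. -/
lemma eventually_ge (h : IsEigenfun γ lam ψ) (hγ : γ ∈ Set.Ioo (1 / 3 : ℝ) 1) (hlam : 0 < lam)
    {X₀ : ℝ} (hψ : ∀ x, X₀ ≤ x → 0 < ψ x) :
    ∃ X m : ℝ, 0 < m ∧ ∀ x, X ≤ x → m * Real.exp (slowExp γ lam x) ≤ ψ x := by
  have hγ0 : 0 < γ := by linarith [hγ.1]
  have h1γ : 0 < 1 - γ := by linarith [hγ.2]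
  obtain ⟨X, hX⟩ := eventually_atTop.1 ((eventually_slowExp_le hγ hlam).and
    ((eventually_ge_atTop (1 : ℝ)).and ((eventually_ge_atTop X₀).and
      ((tendsto_rpow_atTop h1γ).eventually_ge_atTop (γ / lam)))))
  have hpos : ∀ x, X ≤ x → 0 < x := fun x hx => by linarith [(hX x hx).2.1]
  set a : ℝ → ℝ := fun x => lam * x ^ (-γ) with ha
  have hA : ∀ x, X ≤ x → HasDerivAt (slowExp γ lam) (a x) x := fun x hx =>
    slowExp_hasDerivAt hγ.2 (hpos x hx)
  have had : ∀ x, X ≤ x → HasDerivAt a (lam * (-γ * x ^ (-γ - 1))) x := fun x hx =>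
    (Real.hasDerivAt_rpow_const (Or.inl (hpos x hx).ne')).const_mul lam
  set f : ℝ → ℝ := fun x => a x * Vp γ x - a x ^ 2 - lam * (-γ * x ^ (-γ - 1)) - lam with hf
  have hf0 : ∀ x, X ≤ x → f x ≤ 0 := by
    intro x hx
    have hx0 := hpos x hx
    have hT := (div_le_iff₀ hlam).1 (hX x hx).2.2.2
    have e1 : a x * Vp γ x = lam := by
      rw [Vp_of_pos γ hx0]
      simp only [ha]
      rw [mul_assoc, ← Real.rpow_add hx0]
      simp
    have e2 : x ^ (-γ) * x ^ (-γ) = x ^ (-γ - 1) * x ^ (1 - γ) := by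
      rw [← Real.rpow_add hx0, ← Real.rpow_add hx0]
      congr 1
      ring
    have e3 : 0 < x ^ (-γ - 1) := Real.rpow_pos_of_pos hx0 _
    have e4 : a x ^ 2 = lam * x ^ (-γ - 1) * (x ^ (1 - γ) * lam) := by
      simp only [ha]
      linear_combination lam ^ 2 * e2
    have e5 := mul_le_mul_of_nonneg_left hT (mul_pos hlam e3).le
    simp only [hf]
    rw [e1, e4]
    linarith
  have key : ∀ x, X ≤ x →
      0 ≤ (deriv ψ x - a x * ψ x) * Real.exp (slowExp γ lam x - Vpot γ x) := by
    intro x hx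
    refine nonneg_of_pos_system (φ := fun x => ψ x * Real.exp (-slowExp γ lam x))
      (w := fun x => (deriv ψ x - a x * ψ x) * Real.exp (slowExp γ lam x - Vpot γ x))
      (G := fun x => Real.exp (Vpot γ x / 2 - slowExp γ lam x))
      (E := fun x => -f x * Real.exp (2 * slowExp γ lam x - Vpot γ x)) hx
      (fun y hy => h.hasDerivAt_fst (hA y hy))
      (fun y hy => (h.hasDerivAt_snd hγ0 (hpos y hy) (hA y hy) (had y hy)).congr_deriv ?_)
      (fun y hy => mul_nonneg (neg_nonneg.2 (hf0 y hy)) (Real.exp_pos _).le)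
      (fun y hy => Real.one_le_exp ?_)
      (fun y hy => mul_pos (hψ y (hX y hy).2.2.1) (Real.exp_pos _))
    · simp only [hf]
      ring
    · have := Real.rpow_pos_of_pos (hpos y hy) γ
      have h1 := (hX y hy).1
      rw [Vp_of_pos γ (hpos y hy)] at h1
      linarith [hpos y hy]
  have hmono := le_of_hasDerivAt_nonneg (a := X) (fun y hy => h.hasDerivAt_fst (hA y hy))
    fun y hy => mul_nonneg (key y hy) (by positivity)
  refine ⟨X, ψ X * Real.exp (-slowExp γ lam X),
    mul_pos (hψ X (hX X le_rfl).2.2.1) (Real.exp_pos _), fun x hx => ?_⟩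
  calc _ ≤ ψ x * Real.exp (-slowExp γ lam x) * Real.exp (slowExp γ lam x) :=
        mul_le_mul_of_nonneg_right (hmono x hx) (Real.exp_pos _).le
    _ = ψ x := by rw [mul_assoc, ← Real.exp_add]; simp

/-- Up to sign, the eigenfunction is of exact order `exp (slowExp)` near `+∞`. -/
lemma exists_bounds (h : IsEigenfun γ lam ψ) (hγ : γ ∈ Set.Ioo (1 / 3 : ℝ) 1) (hlam : 0 < lam) :
    ∃ σ X m M : ℝ, |σ| = 1 ∧ 0 < m ∧ 0 < M ∧ ∀ x, X ≤ x →
      m * Real.exp (slowExp γ lam x) ≤ σ * ψ x ∧ σ * ψ x ≤ M * Real.exp (slowExp γ lam x) := by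
  obtain ⟨X, M, hM, hX⟩ := h.eventually_le hγ hlam
  have hsign : ∀ {χ : ℝ → ℝ}, ContinuousOn χ (Set.Ici X) → (∀ x, X ≤ x → χ x ≠ 0) →
      0 < χ X → ∀ x, X ≤ x → 0 < χ x := by
    intro χ hc hne h0 x hx
    by_contra! hle
    obtain ⟨y, hy, hy0⟩ := isPreconnected_Ici.intermediate_value (s := Set.Ici X) hx
      Set.self_mem_Ici hc ⟨hle, h0.le⟩
    exact hne y hy hy0
  have hc : Continuous ψ := h.smooth.continuous
  rcases lt_or_gt_of_ne (hX X le_rfl).1 with h0 | h0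
  · obtain ⟨X', m, hm, hX'⟩ := h.neg.eventually_ge hγ hlam
      (hsign hc.neg.continuousOn (fun x hx => neg_ne_zero.2 (hX x hx).1) (neg_pos.2 h0))
    refine ⟨-1, max X X', m, M, by simp, hm, hM, fun x hx => ⟨?_, ?_⟩⟩
    · simpa using hX' x ((le_max_right _ _).trans hx)
    · have := (hX x ((le_max_left _ _).trans hx)).2
      linarith [neg_abs_le (ψ x)]
  · obtain ⟨X', m, hm, hX'⟩ := h.eventually_ge hγ hlam
      (hsign hc.continuousOn (fun x hx => (hX x hx).1) h0)
    refine ⟨1, max X X', m, M, by simp, hm, hM, fun x hx => ⟨?_, ?_⟩⟩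
    · simpa using hX' x ((le_max_right _ _).trans hx)
    · have := (hX x ((le_max_left _ _).trans hx)).2
      linarith [le_abs_self (ψ x)]

end IsEigenfun

lemma abs_rpow_sub_rpow_le {x y p : ℝ} (hx : 0 < x) (hy : 0 < y) (hp0 : 0 < p) (hp1 : p ≤ 1) :
    |x ^ p - y ^ p| ≤ y ^ p / y * |x - y| := by
  have hu : 0 < x / y := div_pos hx hy
  have key : |(x / y) ^ p - 1| ≤ |x / y - 1| := by
    rcases le_total (x / y) 1 with h | h
    · have h1 : x / y ≤ (x / y) ^ p := by
        simpa using Real.rpow_le_rpow_of_exponent_ge hu h hp1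
      have h2 : (x / y) ^ p ≤ 1 := Real.rpow_le_one hu.le h hp0.le
      rw [abs_of_nonpos (by linarith), abs_of_nonpos (by linarith)]
      linarith
    · have h1 : (x / y) ^ p ≤ x / y := by
        simpa using Real.rpow_le_rpow_of_exponent_le h hp1
      have h2 : 1 ≤ (x / y) ^ p := Real.one_le_rpow h hp0.le
      rw [abs_of_nonneg (by linarith), abs_of_nonneg (by linarith)]
      linarith
  have hyp : 0 < y ^ p := Real.rpow_pos_of_pos hy p
  calc |x ^ p - y ^ p| = y ^ p * |(x / y) ^ p - 1| := by
        rw [Real.div_rpow hx.le hy.le, ← abs_of_pos hyp, ← abs_mul, abs_of_pos hyp]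
        congr 1
        field_simp
    _ ≤ y ^ p * |x / y - 1| := by gcongr
    _ = y ^ p / y * |x - y| := by
        rw [div_mul_eq_mul_div, mul_div_assoc, ← abs_of_pos hy, ← abs_div, abs_of_pos hy]
        congr 2
        field_simp

lemma delta_pos (γ : ℝ) {ε : ℝ} (hε : 0 < ε) : 0 < delta γ ε := Real.rpow_pos_of_pos hε _

lemma tendsto_delta {γ : ℝ} (h0 : 0 < γ) (h1 : γ < 1) :
    Tendsto (delta γ) (nhdsWithin 0 (Set.Ioi 0)) (nhdsWithin 0 (Set.Ioi 0)) := by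
  refine tendsto_nhdsWithin_iff.2 ⟨?_, ?_⟩
  · have hp : 0 < (1 - γ) / (1 + γ) := div_pos (by linarith) (by linarith)
    have := (Real.continuousAt_rpow_const 0 _ (Or.inr hp.le)).tendsto
    rw [Real.zero_rpow hp.ne'] at this
    exact this.mono_left nhdsWithin_le_nhds
  · filter_upwards [self_mem_nhdsWithin] with ε hε
    exact delta_pos γ hε

lemma le_fCoeff_of_le {γ x₀ ε a : ℝ} {ψ : ℝ → ℝ} (hε : 0 < ε) (hψ : Continuous ψ)
    (h : ∀ x ∈ Set.Icc (x₀ - delta γ ε) (x₀ + delta γ ε), a ≤ ψ (x * ε ^ (-(1 : ℝ) / (1 + γ)))) :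
    a ≤ fCoeff γ x₀ ψ ε := by
  have hδ := delta_pos γ hε
  have hc : Continuous fun x => ψ (x * ε ^ (-(1 : ℝ) / (1 + γ))) := by fun_prop
  have := intervalIntegral.integral_mono_on (μ := volume)
    (show x₀ - delta γ ε ≤ x₀ + delta γ ε by linarith)
    (intervalIntegrable_const (c := a))
    (hc.intervalIntegrable _ _) h
  rw [intervalIntegral.integral_const, smul_eq_mul] at this
  rw [fCoeff, one_div_mul_eq_div, le_div_iff₀ (by linarith)]
  linarith

lemma fCoeff_const_mul (γ x₀ ε c : ℝ) (ψ : ℝ → ℝ) :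
    fCoeff γ x₀ (fun x => c * ψ x) ε = c * fCoeff γ x₀ ψ ε := by
  simp only [fCoeff, intervalIntegral.integral_const_mul]
  ring

lemma fCoeff_neg_center (γ x₀ ε : ℝ) (ψ : ℝ → ℝ) :
    fCoeff γ (-x₀) (fun x => ψ (-x)) ε = fCoeff γ x₀ ψ ε := by
  have := intervalIntegral.integral_comp_neg (a := -x₀ - delta γ ε) (b := -x₀ + delta γ ε)
    (fun x => ψ (x * ε ^ (-(1 : ℝ) / (1 + γ))))
  simp only [neg_mul] at this
  rw [fCoeff, fCoeff, this]
  congr 2 <;> ring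

/-- Two-sided bounds for the Fourier coefficients at a positive centre. -/
lemma IsEigenfun.fCoeff_bounds_of_pos {γ lam x₀ : ℝ} {ψ : ℝ → ℝ} (h : IsEigenfun γ lam ψ)
    (hγ : γ ∈ Set.Ioo (1 / 3 : ℝ) 1) (hlam : 0 < lam) (hx₀ : 0 < x₀) :
    ∃ m M : ℝ, 0 < m ∧ 0 < M ∧ ∀ᶠ ε in nhdsWithin 0 (Set.Ioi 0),
      m * Real.exp (lam * (x₀ ^ (1 - γ) / (1 - γ)) / delta γ ε) ≤ |fCoeff γ x₀ ψ ε| ∧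
      |fCoeff γ x₀ ψ ε| ≤ M * Real.exp (lam * (x₀ ^ (1 - γ) / (1 - γ)) / delta γ ε) := by
  obtain ⟨σ, X, m, M, hσ, hm, hM, hX⟩ := h.exists_bounds hγ hlam
  have hγ0 : 0 < γ := by linarith [hγ.1]
  have h1γ : 0 < 1 - γ := by linarith [hγ.2]
  set κ := lam / (1 - γ) * (x₀ ^ (1 - γ) / x₀) with hκ
  have hs : Tendsto (fun ε : ℝ => ε ^ (-(1 : ℝ) / (1 + γ))) (nhdsWithin 0 (Set.Ioi 0)) atTop :=
    tendsto_rpow_neg_nhdsGT_zero (div_neg_of_neg_of_pos (by norm_num) (by linarith))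
  refine ⟨m * Real.exp (-κ), M * Real.exp κ, by positivity, by positivity, ?_⟩
  filter_upwards [self_mem_nhdsWithin, hs.eventually_ge_atTop (X / (x₀ / 2)),
    ((tendsto_delta hγ0 hγ.2).mono_right nhdsWithin_le_nhds).eventually_le_const
      (half_pos hx₀)] with ε hε hsX hδ
  replace hε : 0 < ε := hε
  have hδ0 := delta_pos γ hε
  set s := ε ^ (-(1 : ℝ) / (1 + γ)) with hsdef
  have hs0 : 0 < s := Real.rpow_pos_of_pos hε _
  have hsδ : s ^ (1 - γ) = (delta γ ε)⁻¹ := by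
    rw [hsdef, delta, ← Real.rpow_mul hε.le, ← Real.rpow_neg hε.le]
    congr 1
    ring
  set a := lam * (x₀ ^ (1 - γ) / (1 - γ)) / delta γ ε with ha
  have hexp : ∀ x ∈ Set.Icc (x₀ - delta γ ε) (x₀ + delta γ ε),
      X ≤ x * s ∧ |IsEigenfun.slowExp γ lam (x * s) - a| ≤ κ := by
    intro x hx
    have hx2 : x₀ / 2 ≤ x := by linarith [hx.1]
    have hx0 : 0 < x := by linarith
    refine ⟨?_, ?_⟩
    · rw [div_le_iff₀ (by linarith)] at hsX
      nlinarith
    · have h1 := abs_rpow_sub_rpow_le hx0 hx₀ h1γ (by linarith : 1 - γ ≤ 1)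
      have h2 : |x - x₀| ≤ delta γ ε := abs_le.2 ⟨by linarith [hx.1], by linarith [hx.2]⟩
      have h3 : IsEigenfun.slowExp γ lam (x * s) - a
          = lam / (1 - γ) / delta γ ε * (x ^ (1 - γ) - x₀ ^ (1 - γ)) := by
        rw [IsEigenfun.slowExp, Real.mul_rpow hx0.le hs0.le, hsδ, ha]
        field_simp
      have h4 : 0 < lam / (1 - γ) / delta γ ε := by positivity
      rw [h3, abs_mul, abs_of_pos h4]
      calc _ ≤ lam / (1 - γ) / delta γ ε * (x₀ ^ (1 - γ) / x₀ * delta γ ε) := by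
            gcongr
            exact h1.trans (by gcongr)
        _ = κ := by rw [hκ]; field_simp
  have hcont : Continuous ψ := h.smooth.continuous
  have hlow : m * Real.exp (-κ) * Real.exp a ≤ σ * fCoeff γ x₀ ψ ε := by
    rw [← fCoeff_const_mul]
    refine le_fCoeff_of_le hε (hcont.const_mul _) fun x hx => ?_
    obtain ⟨hx1, hx2⟩ := hexp x hx
    refine le_trans ?_ (hX _ hx1).1
    rw [mul_assoc, ← Real.exp_add]
    gcongr
    linarith [(abs_le.1 hx2).1]
  have hupp : σ * fCoeff γ x₀ ψ ε ≤ M * Real.exp κ * Real.exp a := by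
    rw [← neg_le_neg_iff, ← neg_mul σ, ← fCoeff_const_mul]
    refine le_fCoeff_of_le hε (hcont.const_mul _) fun x hx => ?_
    obtain ⟨hx1, hx2⟩ := hexp x hx
    rw [neg_mul]
    refine neg_le_neg ((hX _ hx1).2.trans ?_)
    rw [mul_assoc, ← Real.exp_add]
    gcongr
    linarith [(abs_le.1 hx2).2]
  have habs : |fCoeff γ x₀ ψ ε| = σ * fCoeff γ x₀ ψ ε := by
    rw [← abs_of_nonneg (le_trans (by positivity) hlow), abs_mul, hσ, one_mul]
  rw [habs]
  exact ⟨hlow, hupp⟩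

/-- Two-sided bounds for the Fourier coefficients. -/
lemma IsEigenfun.fCoeff_bounds {γ lam x₀ : ℝ} {ψ : ℝ → ℝ} (h : IsEigenfun γ lam ψ)
    (hγ : γ ∈ Set.Ioo (1 / 3 : ℝ) 1) (hlam : 0 < lam) (hx₀ : x₀ ≠ 0) :
    ∃ m M : ℝ, 0 < m ∧ 0 < M ∧ ∀ᶠ ε in nhdsWithin 0 (Set.Ioi 0),
      m * Real.exp (lam * (|x₀| ^ (1 - γ) / (1 - γ)) / delta γ ε) ≤ |fCoeff γ x₀ ψ ε| ∧
      |fCoeff γ x₀ ψ ε| ≤ M * Real.exp (lam * (|x₀| ^ (1 - γ) / (1 - γ)) / delta γ ε) := by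
  rcases lt_or_gt_of_ne hx₀ with h0 | h0
  · have := h.comp_neg.fCoeff_bounds_of_pos hγ hlam (neg_pos.2 h0)
    simpa only [fCoeff_neg_center, abs_of_neg h0] using this
  · simpa only [abs_of_pos h0] using h.fCoeff_bounds_of_pos hγ hlam h0

lemma rpow_eq_inv_delta (γ : ℝ) {ε : ℝ} (hε : 0 < ε) :
    ε ^ ((γ - 1) / (γ + 1)) = (delta γ ε)⁻¹ := by
  rw [delta, ← Real.rpow_neg hε.le, add_comm γ 1, ← neg_div, neg_sub]

/-- The exponent of a mode at the time `t_ε + r w_ε`. -/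
lemma exponent_cutoffTime_add {γ lam₁ x₀ ε : ℝ} (lam r : ℝ) (ψ₁ : ℝ → ℝ) (hε : 0 < ε)
    (hlam₁ : 0 < lam₁) :
    -2 * (lam * ε ^ ((γ - 1) / (γ + 1))) * (cutoffTime γ lam₁ x₀ ψ₁ ε + r * delta γ ε)
      = -2 * (lam / lam₁) * Real.log |fCoeff γ x₀ ψ₁ ε| + -2 * lam * r := by
  have := delta_pos γ hε
  rw [cutoffTime, rpow_eq_inv_delta γ hε]
  field_simp
  ring

lemma mode_le {γ x₀ ε a lam₁ lam m M : ℝ} {ψ₁ ψ : ℝ → ℝ} (r : ℝ) (hε : 0 < ε)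
    (hlam₁ : 0 < lam₁) (hlam : 0 < lam) (hm : 0 < m)
    (h₁ : m * Real.exp (lam₁ * a / delta γ ε) ≤ |fCoeff γ x₀ ψ₁ ε|)
    (h : |fCoeff γ x₀ ψ ε| ≤ M * Real.exp (lam * a / delta γ ε)) :
    Real.exp (-2 * (lam * ε ^ ((γ - 1) / (γ + 1)))
        * (cutoffTime γ lam₁ x₀ ψ₁ ε + r * delta γ ε)) * fCoeff γ x₀ ψ ε ^ 2
      ≤ M ^ 2 * Real.exp (-2 * (lam / lam₁) * Real.log m) * Real.exp (-2 * lam * r) := by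
  have hδ := delta_pos γ hε
  have hlog : Real.log m + lam₁ * a / delta γ ε ≤ Real.log |fCoeff γ x₀ ψ₁ ε| := by
    rw [← Real.log_exp (lam₁ * a / delta γ ε), ← Real.log_mul hm.ne' (Real.exp_ne_zero _)]
    exact Real.log_le_log (by positivity) h₁
  have hsq : fCoeff γ x₀ ψ ε ^ 2 ≤ M ^ 2 * Real.exp (2 * (lam * a / delta γ ε)) := by
    calc fCoeff γ x₀ ψ ε ^ 2 = |fCoeff γ x₀ ψ ε| ^ 2 := (sq_abs _).symm
      _ ≤ (M * Real.exp (lam * a / delta γ ε)) ^ 2 := by gcongr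
      _ = _ := by rw [mul_pow, ← Real.exp_nat_mul]; norm_num
  have hq : 0 < lam / lam₁ := div_pos hlam hlam₁
  have hle : -2 * (lam / lam₁) * Real.log |fCoeff γ x₀ ψ₁ ε|
      ≤ -2 * (lam / lam₁) * Real.log m + -(2 * (lam * a / delta γ ε)) := by
    have e := mul_le_mul_of_nonneg_left hlog hq.le
    have e2 : lam / lam₁ * (Real.log m + lam₁ * a / delta γ ε)
        = lam / lam₁ * Real.log m + lam * a / delta γ ε := by field_simp
    linarith
  rw [exponent_cutoffTime_add lam r ψ₁ hε hlam₁]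
  calc _ ≤ Real.exp (-2 * (lam / lam₁) * Real.log m + -(2 * (lam * a / delta γ ε))
          + -2 * lam * r) * (M ^ 2 * Real.exp (2 * (lam * a / delta γ ε))) := by gcongr
    _ = M ^ 2 * Real.exp (-2 * (lam / lam₁) * Real.log m) * Real.exp (-2 * lam * r)
          * (Real.exp (-(2 * (lam * a / delta γ ε))) * Real.exp (2 * (lam * a / delta γ ε))) := by
        rw [Real.exp_add, Real.exp_add]
        ring
    _ = _ := by rw [← Real.exp_add]; simp

/-- The leading mode at the time `t_ε + r w_ε` is exactly `e^{-lam₁ r}`. -/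
lemma leading_mode {γ x₀ ε lam₁ : ℝ} {ψ₁ : ℝ → ℝ} (r : ℝ) (hε : 0 < ε) (hlam₁ : 0 < lam₁)
    (h₁ : 0 < |fCoeff γ x₀ ψ₁ ε|) :
    Real.exp (-2 * (lam₁ * ε ^ ((γ - 1) / (γ + 1)))
        * (cutoffTime γ lam₁ x₀ ψ₁ ε + r * delta γ ε)) * fCoeff γ x₀ ψ₁ ε ^ 2
      = Real.exp (-lam₁ * r) ^ 2 := by
  have h2 : fCoeff γ x₀ ψ₁ ε ^ 2 = Real.exp (2 * Real.log |fCoeff γ x₀ ψ₁ ε|) := by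
    rw [two_mul, Real.exp_add, Real.exp_log h₁, ← sq, sq_abs]
  rw [exponent_cutoffTime_add lam₁ r ψ₁ hε hlam₁, h2, ← Real.exp_add, div_self hlam₁.ne',
    ← Real.exp_nat_mul]
  congr 1
  push_cast
  ring

/-- Profiles squeezed between `e^{-c r}` and a function vanishing at `+∞` exhibit window cut-off. -/
lemma cutoff_of_bounds {ι : Type*} {l : Filter ι} [l.NeBot] {d : ι → ℝ → ℝ} {D : ℝ → ℝ} {c : ℝ}
    (hc : 0 < c) (hlow : ∀ᶠ i in l, ∀ r, Real.exp (-c * r) ≤ d i r)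
    (hupp : ∀ᶠ i in l, ∀ r, d i r ≤ D r) (hD : Tendsto D atTop (nhds 0)) :
    (∀ r : ℝ, 0 < Filter.liminf (fun i => ENNReal.ofReal (d i r)) l ∧
      Filter.liminf (fun i => ENNReal.ofReal (d i r)) l
        ≤ Filter.limsup (fun i => ENNReal.ofReal (d i r)) l ∧
      Filter.limsup (fun i => ENNReal.ofReal (d i r)) l < ⊤) ∧
    Tendsto (fun r => Filter.liminf (fun i => ENNReal.ofReal (d i r)) l) atBot (nhds ⊤) ∧
    Tendsto (fun r => Filter.limsup (fun i => ENNReal.ofReal (d i r)) l) atTop (nhds 0) := by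
  have h1 : ∀ r, ENNReal.ofReal (Real.exp (-c * r))
      ≤ Filter.liminf (fun i => ENNReal.ofReal (d i r)) l := fun r =>
    le_liminf_of_le (by isBoundedDefault)
      (hlow.mono fun i hi => ENNReal.ofReal_le_ofReal (hi r))
  have h2 : ∀ r, Filter.limsup (fun i => ENNReal.ofReal (d i r)) l ≤ ENNReal.ofReal (D r) :=
    fun r => limsup_le_of_le (by isBoundedDefault)
      (hupp.mono fun i hi => ENNReal.ofReal_le_ofReal (hi r))
  refine ⟨fun r => ⟨(ENNReal.ofReal_pos.2 (Real.exp_pos _)).trans_le (h1 r),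
    liminf_le_limsup, (h2 r).trans_lt ENNReal.ofReal_lt_top⟩, ?_, ?_⟩
  · refine tendsto_nhds_top_mono' (f := fun r => ENNReal.ofReal (Real.exp (-c * r))) ?_ h1
    exact ENNReal.tendsto_ofReal_atTop.comp
      (Real.tendsto_exp_atTop.comp (tendsto_id.const_mul_atBot_of_neg (neg_neg_of_pos hc)))
  · have := ENNReal.tendsto_ofReal hD
    rw [ENNReal.ofReal_zero] at this
    exact tendsto_of_tendsto_of_tendsto_of_le_of_le tendsto_const_nhds this
      (fun _ => zero_le) h2

/-- **Window cut-off for the Galerkin-projected χ²-distance, `1/3 < γ < 1`,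
`x₀ ≠ 0`.**  For small `ε` the cut-off time `t_ε = λ_{1,ε}^{−1} log|c_{1,ε}|`
is well defined and positive, and with window `w_ε = ε^{(1−γ)/(1+γ)}` the
profiles `𝔭₊(r) = limsup_{ε→0} d_{n,ε}(t_ε + r w_ε)` and
`𝔭₋(r) = liminf_{ε→0} d_{n,ε}(t_ε + r w_ε)` satisfy
`0 < 𝔭₋(r) ≤ 𝔭₊(r) < ∞`, `𝔭₋(r) → ∞` as `r → −∞`, and `𝔭₊(r) → 0` as
`r → +∞`. -/
theorem stmt18 (γ x₀ : ℝ) (hγ : γ ∈ Set.Ioo (1 / 3 : ℝ) 1) (hx₀ : x₀ ≠ 0)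
    (n : ℕ) (hn : 1 ≤ n) (lam : ℕ → ℝ) (ψ : ℕ → ℝ → ℝ)
    (hlam1 : 0 < lam 1)
    (hlam_mono : ∀ k, 1 ≤ k → k < n → lam k < lam (k + 1))
    (hψ_smooth : ∀ k ∈ Finset.Icc 1 n, ContDiff ℝ 2 (ψ k))
    (hψ_ne : ∀ k ∈ Finset.Icc 1 n, ∃ x, ψ k x ≠ 0)
    (hψ_ode : ∀ k ∈ Finset.Icc 1 n, ∀ x : ℝ,
      -(deriv (deriv (ψ k)) x) + Vp γ x * deriv (ψ k) x = lam k * ψ k x)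
    (hψ_L2 : ∀ k ∈ Finset.Icc 1 n,
      Integrable (fun x => (ψ k x) ^ 2 * Real.exp (-(Vpot γ x)))) :
    (∃ ε₀ : ℝ, 0 < ε₀ ∧ ∀ ε : ℝ, 0 < ε → ε < ε₀ →
      1 < |fCoeff γ x₀ (ψ 1) ε| ∧
      0 < cutoffTime γ (lam 1) x₀ (ψ 1) ε) ∧
    (∀ r : ℝ,
      0 < Filter.liminf (fun ε : ℝ => ENNReal.ofReal
            (truncDist γ n lam ψ x₀ ε
              (cutoffTime γ (lam 1) x₀ (ψ 1) ε + r * delta γ ε)))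
          (nhdsWithin 0 (Set.Ioi 0)) ∧
      Filter.liminf (fun ε : ℝ => ENNReal.ofReal
            (truncDist γ n lam ψ x₀ ε
              (cutoffTime γ (lam 1) x₀ (ψ 1) ε + r * delta γ ε)))
          (nhdsWithin 0 (Set.Ioi 0))
        ≤ Filter.limsup (fun ε : ℝ => ENNReal.ofReal
            (truncDist γ n lam ψ x₀ ε
              (cutoffTime γ (lam 1) x₀ (ψ 1) ε + r * delta γ ε)))
          (nhdsWithin 0 (Set.Ioi 0)) ∧
      Filter.limsup (fun ε : ℝ => ENNReal.ofReal
            (truncDist γ n lam ψ x₀ ε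
              (cutoffTime γ (lam 1) x₀ (ψ 1) ε + r * delta γ ε)))
          (nhdsWithin 0 (Set.Ioi 0)) < ⊤) ∧
    Tendsto (fun r : ℝ =>
        Filter.liminf (fun ε : ℝ => ENNReal.ofReal
            (truncDist γ n lam ψ x₀ ε
              (cutoffTime γ (lam 1) x₀ (ψ 1) ε + r * delta γ ε)))
          (nhdsWithin 0 (Set.Ioi 0)))
      atBot (nhds ⊤) ∧
    Tendsto (fun r : ℝ =>
        Filter.limsup (fun ε : ℝ => ENNReal.ofReal
            (truncDist γ n lam ψ x₀ ε
              (cutoffTime γ (lam 1) x₀ (ψ 1) ε + r * delta γ ε)))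
          (nhdsWithin 0 (Set.Ioi 0)))
      atTop (nhds 0) := by
  have hγ0 : 0 < γ := by linarith [hγ.1]
  have h1γ : 0 < 1 - γ := by linarith [hγ.2]
  have hlam : ∀ k ∈ Finset.Icc 1 n, 0 < lam k := by
    intro k hk
    obtain ⟨hk1, hkn⟩ := Finset.mem_Icc.1 hk
    induction k, hk1 using Nat.le_induction with
    | base => exact hlam1
    | succ j hj ih =>
      exact (ih (Finset.mem_Icc.2 ⟨hj, by omega⟩) (by omega)).trans
        (hlam_mono j hj (by omega))
  have heig : ∀ k ∈ Finset.Icc 1 n, IsEigenfun γ (lam k) (ψ k) := fun k hk =>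
    ⟨hψ_smooth k hk, hψ_ne k hk, hψ_ode k hk, hψ_L2 k hk⟩
  have hone : 1 ∈ Finset.Icc 1 n := Finset.mem_Icc.2 ⟨le_rfl, hn⟩
  set a := |x₀| ^ (1 - γ) / (1 - γ) with ha
  have ha0 : 0 < a := div_pos (Real.rpow_pos_of_pos (abs_pos.2 hx₀) _) h1γ
  obtain ⟨m, M₁, hm, -, hc₁⟩ := (heig 1 hone).fCoeff_bounds hγ hlam1 hx₀
  have hgt : ∀ᶠ ε in nhdsWithin 0 (Set.Ioi 0), 1 < |fCoeff γ x₀ (ψ 1) ε| := by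
    have hinv : Tendsto (fun ε => lam 1 * a / delta γ ε) (nhdsWithin 0 (Set.Ioi 0)) atTop := by
      simp only [div_eq_mul_inv]
      exact (tendsto_inv_nhdsGT_zero.comp (tendsto_delta hγ0 hγ.2)).const_mul_atTop
        (mul_pos hlam1 ha0)
    filter_upwards [hc₁, ((Real.tendsto_exp_atTop.comp hinv).const_mul_atTop hm).eventually_gt_atTop
      1] with ε h1 h2
    exact lt_of_lt_of_le h2 h1.1
  refine ⟨?_, ?_⟩
  · obtain ⟨u, hu, hsub⟩ := mem_nhdsGT_iff_exists_Ioo_subset.1 hgt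
    refine ⟨u, hu, fun ε h0 h1 => ?_⟩
    have hε : 1 < |fCoeff γ x₀ (ψ 1) ε| := hsub ⟨h0, h1⟩
    exact ⟨hε, mul_pos (inv_pos.2 (mul_pos hlam1 (Real.rpow_pos_of_pos h0 _))) (Real.log_pos hε)⟩
  have hmode : ∀ k ∈ Finset.Icc 1 n, ∃ C : ℝ, ∀ᶠ ε in nhdsWithin 0 (Set.Ioi 0), ∀ r,
      Real.exp (-2 * (lam k * ε ^ ((γ - 1) / (γ + 1)))
        * (cutoffTime γ (lam 1) x₀ (ψ 1) ε + r * delta γ ε)) * fCoeff γ x₀ (ψ k) ε ^ 2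
      ≤ C * Real.exp (-2 * lam k * r) := by
    intro k hk
    obtain ⟨_, M, _, _, hcM⟩ := (heig k hk).fCoeff_bounds hγ (hlam k hk) hx₀
    refine ⟨M ^ 2 * Real.exp (-2 * (lam k / lam 1) * Real.log m), ?_⟩
    filter_upwards [self_mem_nhdsWithin, hc₁, hcM] with ε hε h1 hk2 r
    exact mode_le r hε hlam1 (hlam k hk) hm h1.1 hk2.2
  choose! C hC using hmode
  refine cutoff_of_bounds
    (d := fun ε r => truncDist γ n lam ψ x₀ ε
      (cutoffTime γ (lam 1) x₀ (ψ 1) ε + r * delta γ ε))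
    (D := fun r => Real.sqrt (∑ k ∈ Finset.Icc 1 n, C k * Real.exp (-2 * lam k * r)))
    hlam1 ?_ ?_ ?_
  · filter_upwards [self_mem_nhdsWithin, hgt] with ε hε h1 r
    refine Real.le_sqrt_of_sq_le ?_
    rw [← leading_mode r hε hlam1 (by linarith)]
    exact Finset.single_le_sum (f := fun k => Real.exp (-2 * (lam k * ε ^ ((γ - 1) / (γ + 1)))
        * (cutoffTime γ (lam 1) x₀ (ψ 1) ε + r * delta γ ε)) * fCoeff γ x₀ (ψ k) ε ^ 2)
      (fun k _ => by positivity) hone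
  · filter_upwards [(Filter.eventually_all_finset _).2 hC] with ε hε r
    exact Real.sqrt_le_sqrt (Finset.sum_le_sum fun k hk => hε k hk r)
  · have hsum : Tendsto (fun r => ∑ k ∈ Finset.Icc 1 n, C k * Real.exp (-2 * lam k * r)) atTop
        (nhds 0) := by
      rw [show (0 : ℝ) = ∑ k ∈ Finset.Icc 1 n, 0 from Finset.sum_const_zero.symm]
      refine tendsto_finsetSum _ fun k hk => ?_
      have h1 : Tendsto (fun r => -2 * lam k * r) atTop atBot :=
        tendsto_id.const_mul_atTop_of_neg (by linarith [hlam k hk])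
      simpa using (Real.tendsto_exp_atBot.comp h1).const_mul (C k)
    rw [← Real.sqrt_zero]
    exact (Real.continuous_sqrt.tendsto 0).comp hsum
end
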